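/- arXiv:1703.01207 — 2 statements merged into one kernel-verified Lean document; each statement's English description precedes it below -/
import Mathlib

section
/- Let (p_n) be a sequence in [0,1] satisfying n·p_n − log n − log log n → ∞ and n²(1 − p_n) → ∞ as n → ∞, and let G ∼ 𝒢(n, p_n). Then asymptotically almost surely G has a legal system. -/
open SimpleGraph

noncomputable def chi {V : Type*} (A : Set V) : V → ZMod 2 :=
  A.indicator 1

def LegalState {V : Type*} (G : SimpleGraph V) (S : Set V) : Prop :=
  S.Nonempty ∧ Sᶜ.Nonempty ∧ (G.induce S).Connected ∧ (G.induce Sᶜ).Connected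

def IsMove {V : Type*} (G : SimpleGraph V) (v : V) (M : Set V) : Prop :=
  v ∈ M ∧ ∀ u ∈ M, ¬ G.Adj v u

noncomputable def actSet {V : Type*} (f : V → ZMod 2) (S : Set V) : Set V :=
  {x | f x + chi S x = 1}

def IsLegalSystem {V : Type*} (G : SimpleGraph V) (S : Set V) (M : V → Set V) : Prop :=
  (∀ v, IsMove G v (M v)) ∧
    ∀ g ∈ AddSubgroup.closure (Set.range fun v => chi (M v)),
      LegalState G (actSet g S)

def HasLegalSystem {V : Type*} (G : SimpleGraph V) : Prop :=
  ∃ (S : Set V) (M : V → Set V), IsLegalSystem G S M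

open MeasureTheory Filter

/-- Bernoulli measure on `Bool` with success probability `p`. -/
noncomputable def bernoulliMeasure (p : ℝ) : Measure Bool :=
  ENNReal.ofReal p • Measure.dirac true + ENNReal.ofReal (1 - p) • Measure.dirac false

/-- The Erdős–Rényi measure `𝒢(n,p)`: the product over all (unordered) vertex pairs of
Bernoulli(p) indicators. -/
noncomputable def erdosRenyi (n : ℕ) (p : ℝ) : Measure (Sym2 (Fin n) → Bool) :=
  Measure.pi fun _ => bernoulliMeasure p

/-- The simple graph on `{1,…,n}` determined by an indicator `ω` of the edges. -/
def graphOf {n : ℕ} (ω : Sym2 (Fin n) → Bool) : SimpleGraph (Fin n) where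
  Adj u v := u ≠ v ∧ ω s(u, v) = true
  symm := by
    constructor
    intro u v h
    exact ⟨h.1.symm, by rw [Sym2.eq_swap]; exact h.2⟩
  loopless := ⟨fun v h => h.1 rfl⟩

instance {n : ℕ} (ω : Sym2 (Fin n) → Bool) : DecidableRel (graphOf ω).Adj :=
  fun u v => inferInstanceAs (Decidable (u ≠ v ∧ ω s(u, v) = true))


open SimpleGraph MeasureTheory Filter

lemma legal_of_classes {V κ : Type*} (G : SimpleGraph V) (c : V → κ) (s : V → ZMod 2)
    (h1 : ∀ u v, c u = c v → ¬ G.Adj u v)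
    (h2 : ∀ x : κ → ZMod 2, (G.induce {v | x (c v) + s v = 1}).Connected) :
    HasLegalSystem G := by
  classical
  have key : ∀ x : ZMod 2, x ≠ 1 ↔ x + 1 = 1 := by decide
  have key0 : ∀ x : ZMod 2, x = 0 ∨ x = 1 := by decide
  have hS : ∀ v, chi {v | s v = 1} v = s v := by
    intro v
    unfold chi
    by_cases h : s v = 1
    · simp [Set.indicator, h]
    · rcases key0 (s v) with h0 | h0
      · simp [Set.indicator, h0]
      · exact absurd h0 h
  refine ⟨{v | s v = 1}, fun v => {u | c u = c v}, ?_, ?_⟩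
  · intro v
    refine ⟨rfl, ?_⟩
    intro u hu hadj
    exact h1 v u (Eq.symm hu) hadj
  · intro g hg
    have hx : ∃ x : κ → ZMod 2, ∀ v, g v = x (c v) := by
      induction hg using AddSubgroup.closure_induction with
      | mem g hg =>
        obtain ⟨v, rfl⟩ := hg
        refine ⟨fun k => if k = c v then 1 else 0, fun u => ?_⟩
        simp [chi, Set.indicator]
      | zero => exact ⟨0, fun _ => rfl⟩
      | add a b _ _ ha hb =>
        obtain ⟨x, hx⟩ := ha
        obtain ⟨y, hy⟩ := hb
        exact ⟨x + y, fun v => by simp [hx, hy]⟩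
      | neg a _ ha =>
        obtain ⟨x, hx⟩ := ha
        exact ⟨-x, fun v => by simp [hx]⟩
    obtain ⟨x, hx⟩ := hx
    have e1 : actSet g {v | s v = 1} = {v | x (c v) + s v = 1} := by
      ext v
      simp only [actSet, Set.mem_ofPred_eq, hS, hx]
    have e2 : (actSet g {v | s v = 1})ᶜ = {v | (x + 1) (c v) + s v = 1} := by
      rw [e1]
      ext v
      simp only [Set.mem_compl_iff, Set.mem_ofPred_eq, Pi.add_apply, Pi.one_apply]
      rw [← ne_eq, key]
      rw [add_right_comm]
    have c1 := h2 x
    have c2 := h2 (x + 1)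
    rw [← e1] at c1
    rw [← e2] at c2
    refine ⟨?_, ?_, c1, c2⟩
    · exact Set.nonempty_coe_sort.mp c1.nonempty
    · exact Set.nonempty_coe_sort.mp c2.nonempty

/-- edges of `F` are edges of `G` inside `W` -/
def EdgesIn {V : Type*} (G : SimpleGraph V) (W : Finset V) (F : Finset (Sym2 V)) : Prop :=
  ∀ e ∈ F, e ∈ G.edgeSet ∧ ∀ v ∈ e, v ∈ W

lemma degSum_edges {V : Type*} [Fintype V] [DecidableEq V] (G : SimpleGraph V) (W : Finset V)
    (d : V → ℕ) (h : ∀ v ∈ W, ∃ A ⊆ W, d v ≤ A.card ∧ ∀ a ∈ A, G.Adj v a) :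
    ∃ F, EdgesIn G W F ∧ ∑ v ∈ W, d v ≤ 2 * F.card := by
  classical
  refine ⟨G.edgeFinset.filter (fun e => ∀ v ∈ e, v ∈ W), ?_, ?_⟩
  · intro e he
    simpa using he
  · set H : SimpleGraph V := SimpleGraph.mk (fun u v => G.Adj u v ∧ u ∈ W ∧ v ∈ W)
      ⟨fun u v h => ⟨h.1.symm, h.2.2, h.2.1⟩⟩ ⟨fun v h => G.loopless.irrefl v h.1⟩ with hH
    have hE : G.edgeFinset.filter (fun e => ∀ v ∈ e, v ∈ W) = H.edgeFinset := by
      ext e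
      induction e with
      | _ u v => simp [hH]
    rw [hE, ← H.sum_degrees_eq_twice_card_edges]
    calc ∑ v ∈ W, d v ≤ ∑ v ∈ W, H.degree v := by
          apply Finset.sum_le_sum
          intro v hv
          obtain ⟨A, hA, hd, hadj⟩ := h v hv
          refine hd.trans ?_
          rw [← H.card_neighborFinset_eq_degree]
          apply Finset.card_le_card
          intro a ha
          simp [hH, hadj a ha, hv, hA ha]
      _ ≤ ∑ v, H.degree v := Finset.sum_le_sum_of_subset (Finset.subset_univ _)

lemma connected_of_minDeg {V : Type*} [Fintype V] [DecidableEq V] (G : SimpleGraph V)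
    (T : Set V) (hT : T.Nonempty) (d N : ℕ)
    (hd : ∀ v ∈ T, ∃ A : Finset V, d ≤ A.card ∧ ∀ a ∈ A, G.Adj v a ∧ a ∈ T)
    (hE2 : ∀ W : Finset V, W.Nonempty → W.card ≤ N → ∀ F, EdgesIn G W F → 2 * F.card < d * W.card)
    (hE3 : ∀ X Y : Finset V, N < X.card → N < Y.card → Disjoint X Y →
      ∃ x ∈ X, ∃ y ∈ Y, G.Adj x y) :
    (G.induce T).Connected := by
  classical
  have big : ∀ W : Finset V, W.Nonempty → (∀ v ∈ W, v ∈ T) →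
      (∀ v ∈ W, ∀ a ∈ T, G.Adj v a → a ∈ W) → N < W.card := by
    intro W hW hWT hcl
    by_contra hc
    push Not at hc
    obtain ⟨F, hF, hF2⟩ := degSum_edges G W (fun _ => d) (by
      intro v hv
      obtain ⟨A, hA, hA2⟩ := hd v (hWT v hv)
      exact ⟨A, fun a ha => hcl v hv a (hA2 a ha).2 (hA2 a ha).1, hA, fun a ha => (hA2 a ha).1⟩)
    have := hE2 W hW hc F hF
    simp at hF2
    nlinarith
  have : Nonempty T := hT.to_subtype
  rw [SimpleGraph.connected_iff]
  refine ⟨?_, inferInstance⟩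
  intro u v
  by_contra huv
  let X : Finset V := Finset.univ.filter (fun w => ∃ h : w ∈ T, (G.induce T).Reachable u ⟨w, h⟩)
  let Y : Finset V := Finset.univ.filter (fun w => ∃ h : w ∈ T, ¬ (G.induce T).Reachable u ⟨w, h⟩)
  have hX : N < X.card := by
    apply big
    · exact ⟨u, by simp [X]⟩
    · intro w hw
      simp only [X, Finset.mem_filter] at hw
      exact hw.2.1
    · intro w hw a ha hadj
      simp only [X, Finset.mem_filter, Finset.mem_univ, true_and] at hw ⊢
      obtain ⟨h, hr⟩ := hw
      refine ⟨ha, hr.trans ?_⟩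
      exact SimpleGraph.Adj.reachable (by simpa using hadj)
  have hY : N < Y.card := by
    apply big
    · exact ⟨v, by simpa [Y] using huv⟩
    · intro w hw
      simp only [Y, Finset.mem_filter] at hw
      exact hw.2.1
    · intro w hw a ha hadj
      simp only [Y, Finset.mem_filter, Finset.mem_univ, true_and] at hw ⊢
      obtain ⟨h, hr⟩ := hw
      refine ⟨ha, fun hr' => hr (hr'.trans ?_)⟩
      exact SimpleGraph.Adj.reachable (by simpa using hadj.symm)
  obtain ⟨x, hx, y, hy, hxy⟩ := hE3 X Y hX hY (by
    rw [Finset.disjoint_left]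
    intro w hw hw'
    simp only [X, Y, Finset.mem_filter, Finset.mem_univ, true_and] at hw hw'
    obtain ⟨_, h1⟩ := hw
    obtain ⟨_, h2⟩ := hw'
    exact h2 h1)
  simp only [X, Y, Finset.mem_filter, Finset.mem_univ, true_and] at hx hy
  obtain ⟨_, h1⟩ := hx
  obtain ⟨_, h2⟩ := hy
  exact h2 (h1.trans (SimpleGraph.Adj.reachable (by simpa using hxy)))

open SimpleGraph MeasureTheory Filter

lemma legal_of_attach {V : Type*} [Fintype V] [DecidableEq V] (G : SimpleGraph V)
    (c : V → ℕ) (s : V → ZMod 2) (B : Finset V) (x y : V → V) (rk : V → ℕ) (m N : ℕ)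
    (hm : 0 < m) (hBne : ∃ v, v ∉ B)
    (hx : ∀ v ∈ B, G.Adj v (x v)) (hy : ∀ v ∈ B, G.Adj v (y v))
    (hxy : ∀ v ∈ B, ¬ G.Adj (x v) (y v)) (hne : ∀ v ∈ B, x v ≠ y v)
    (hdis : ∀ v ∈ B, ∀ w ∈ B, v ≠ w → x v ≠ x w ∧ x v ≠ y w ∧ y v ≠ y w)
    (hrx : ∀ v ∈ B, rk (x v) < rk v) (hry : ∀ v ∈ B, rk (y v) < rk v)
    (hR : ∀ v, v ∉ B → ∃ I : Finset ℕ, m + 8 ≤ I.card ∧ ∀ i ∈ I, ∃ a b, G.Adj v a ∧ G.Adj v b ∧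
      c a = i ∧ c b = i ∧ s a = 0 ∧ s b = 1 ∧ (∀ u, c u = c a → ¬ G.Adj a u) ∧
      (∀ u, c u = c b → ¬ G.Adj b u))
    (hfew : ∀ v, v ∉ B → ∀ A : Finset V,
      (∀ a ∈ A, G.Adj v a ∧ (a ∈ B ∨ ∃ w ∈ B, G.Adj w a)) → A.card ≤ 8)
    (hE2 : ∀ W : Finset V, W.Nonempty → W.card ≤ N → ∀ F, EdgesIn G W F → 2 * F.card < m * W.card)
    (hE3 : ∀ X Y : Finset V, N < X.card → N < Y.card → Disjoint X Y →
      ∃ x ∈ X, ∃ y ∈ Y, G.Adj x y) :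
    HasLegalSystem G := by
  classical
  have hVne : Nonempty V := ⟨hBne.choose⟩
  let bad : V → Prop := fun u => u ∈ B ∨ ∃ w ∈ B, G.Adj w u
  let core : V → Prop := fun a => ∀ u, c u = c a → ¬ G.Adj a u
  let cl : V → V ⊕ (ℕ ⊕ V) := fun u =>
    if h : ∃ v ∈ B, u = x v ∨ u = y v then Sum.inl h.choose
    else if core u ∧ ¬ bad u then Sum.inr (Sum.inl (c u)) else Sum.inr (Sum.inr u)
  let sg : V → ZMod 2 := fun u =>
    if ∃ v ∈ B, u = x v then 0 else if ∃ v ∈ B, u = y v then 1 else s u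
  have uniq : ∀ u, ∀ v ∈ B, ∀ w ∈ B, (u = x v ∨ u = y v) → (u = x w ∨ u = y w) → v = w := by
    intro u v hv w hw h1 h2
    by_contra hvw
    have d1 := hdis v hv w hw hvw
    have d2 := hdis w hw v hv (Ne.symm hvw)
    rcases h1 with h1 | h1 <;> rcases h2 with h2 | h2
    · exact d1.1 (h1.symm.trans h2)
    · exact d1.2.1 (h1.symm.trans h2)
    · exact d2.2.1 (h2.symm.trans h1)
    · exact d1.2.2 (h1.symm.trans h2)
  have clP : ∀ u, ∀ v ∈ B, (u = x v ∨ u = y v) → cl u = Sum.inl v := by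
    intro u v hv h
    have hex : ∃ v ∈ B, u = x v ∨ u = y v := ⟨v, hv, h⟩
    have : cl u = Sum.inl hex.choose := by simp only [cl]; rw [dif_pos hex]
    rw [this]
    congr 1
    exact uniq u _ hex.choose_spec.1 v hv hex.choose_spec.2 h
  have sgx : ∀ v ∈ B, sg (x v) = 0 := by
    intro v hv
    simp only [sg]
    rw [if_pos ⟨v, hv, rfl⟩]
  have sgy : ∀ v ∈ B, sg (y v) = 1 := by
    intro v hv
    simp only [sg]
    rw [if_neg, if_pos ⟨v, hv, rfl⟩]
    rintro ⟨w, hw, h⟩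
    have := uniq (y v) v hv w hw (Or.inr rfl) (Or.inl h)
    subst this
    exact hne v hv h.symm
  have notP : ∀ u, ¬ bad u → ¬ ∃ v ∈ B, u = x v ∨ u = y v := by
    rintro u hu ⟨v, hv, rfl | rfl⟩
    · exact hu (Or.inr ⟨v, hv, hx v hv⟩)
    · exact hu (Or.inr ⟨v, hv, hy v hv⟩)
  have clC : ∀ u, core u → ¬ bad u → cl u = Sum.inr (Sum.inl (c u)) := by
    intro u h1 h2
    simp only [cl]
    rw [dif_neg (notP u h2), if_pos ⟨h1, h2⟩]
  have sgC : ∀ u, ¬ bad u → sg u = s u := by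
    intro u h2
    have := notP u h2
    simp only [sg]
    rw [if_neg, if_neg]
    · rintro ⟨v, hv, h⟩; exact this ⟨v, hv, Or.inr h⟩
    · rintro ⟨v, hv, h⟩; exact this ⟨v, hv, Or.inl h⟩
  have clcases : ∀ u, (∃ v ∈ B, (u = x v ∨ u = y v) ∧ cl u = Sum.inl v) ∨
      (core u ∧ cl u = Sum.inr (Sum.inl (c u))) ∨ cl u = Sum.inr (Sum.inr u) := by
    intro u
    by_cases h : ∃ v ∈ B, u = x v ∨ u = y v
    · obtain ⟨v, hv, h⟩ := h
      exact Or.inl ⟨v, hv, h, clP u v hv h⟩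
    · right
      by_cases h2 : core u ∧ ¬ bad u
      · exact Or.inl ⟨h2.1, clC u h2.1 h2.2⟩
      · right
        simp only [cl]
        rw [dif_neg h, if_neg h2]
  have key0 : ∀ a b : ZMod 2, b = 0 ∨ b = 1 := by decide
  have key1 : ∀ z : ZMod 2, z + 0 = 1 ∨ z + 1 = 1 := by decide
  apply legal_of_classes G cl sg
  · intro u w huw hadj
    rcases clcases u with ⟨v, hv, h1, h2⟩ | ⟨h1, h2⟩ | h2 <;>
    rcases clcases w with ⟨v', hv', h1', h2'⟩ | ⟨h1', h2'⟩ | h2' <;>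
    rw [h2, h2'] at huw <;> simp at huw
    · subst huw
      rcases h1 with rfl | rfl <;> rcases h1' with rfl | rfl
      · exact G.loopless.irrefl _ hadj
      · exact hxy v hv hadj
      · exact hxy v hv hadj.symm
      · exact G.loopless.irrefl _ hadj
    · exact h1 w huw.symm hadj
    · subst huw
      exact G.loopless.irrefl _ hadj
  · intro z
    set T : Set V := {v | z (cl v) + sg v = 1} with hT
    let T' : Set V := {v | v ∈ T ∧ v ∉ B}
    have hnb : ∀ v, v ∉ B → ∃ A : Finset V, m ≤ A.card ∧ ∀ a ∈ A, G.Adj v a ∧ a ∈ T' := by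
      intro v hv
      obtain ⟨I, hI, hI2⟩ := hR v hv
      let P : ℕ → Prop := fun i => ∃ u, G.Adj v u ∧ c u = i ∧ u ∈ T'
      let J := I.filter P
      have hkill : (I.filter (fun i => ¬ P i)).card ≤ 8 := by
        have : ∀ i ∈ I.filter (fun i => ¬ P i), ∃ u, G.Adj v u ∧ bad u ∧ c u = i := by
          intro i hi
          rw [Finset.mem_filter] at hi
          obtain ⟨a, b, ha, hb, ca, cb, sa, sb, coa, cob⟩ := hI2 i hi.1
          by_contra hcon
          push Not at hcon
          have nba : ¬ bad a := fun h => hcon a ha h ca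
          have nbb : ¬ bad b := fun h => hcon b hb h cb
          apply hi.2
          rcases key1 (z (Sum.inr (Sum.inl i))) with h | h
          · refine ⟨a, ha, ca, ?_, fun h => nba (Or.inl h)⟩
            show z (cl a) + sg a = 1
            rw [clC a coa nba, sgC a nba, ca, sa, h]
          · refine ⟨b, hb, cb, ?_, fun h => nbb (Or.inl h)⟩
            show z (cl b) + sg b = 1
            rw [clC b cob nbb, sgC b nbb, cb, sb, h]
        choose! f hf using this
        have hinj : Set.InjOn f (I.filter (fun i => ¬ P i)) := by
          intro i hi j hj hij
          rw [← (hf i hi).2.2, ← (hf j hj).2.2, hij]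
        rw [← Finset.card_image_of_injOn hinj]
        apply hfew v hv
        intro a ha
        obtain ⟨i, hi, rfl⟩ := Finset.mem_image.mp ha
        exact ⟨(hf i hi).1, (hf i hi).2.1⟩
      have hJ : m ≤ J.card := by
        have := Finset.card_filter_add_card_filter_not (s := I) P
        simp only [J]
        omega
      have : ∀ i ∈ J, ∃ u, G.Adj v u ∧ c u = i ∧ u ∈ T' := by
        intro i hi
        exact (Finset.mem_filter.mp hi).2
      choose! f hf using this
      have hinj : Set.InjOn f J := by
        intro i hi j hj hij
        rw [← (hf i hi).2.1, ← (hf j hj).2.1, hij]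
      refine ⟨J.image f, by rwa [Finset.card_image_of_injOn hinj], ?_⟩
      intro a ha
      obtain ⟨i, hi, rfl⟩ := Finset.mem_image.mp ha
      exact ⟨(hf i hi).1, (hf i hi).2.2⟩
    have hT'ne : T'.Nonempty := by
      obtain ⟨v, hv⟩ := hBne
      obtain ⟨A, hA, hA2⟩ := hnb v hv
      obtain ⟨a, ha⟩ := Finset.card_pos.mp (lt_of_lt_of_le hm hA)
      exact ⟨a, (hA2 a ha).2⟩
    have hconn : (G.induce T').Connected :=
      connected_of_minDeg G T' hT'ne m N (fun v hv => hnb v hv.2) hE2 hE3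
    have hsub : T' ⊆ T := fun v hv => hv.1
    have reach : ∀ k, ∀ v (hv : v ∈ T), rk v ≤ k → ∃ w, ∃ hw : w ∈ T',
        (G.induce T).Reachable ⟨v, hv⟩ ⟨w, hsub hw⟩ := by
      have base : ∀ v (hv : v ∈ T), v ∉ B → ∃ w, ∃ hw : w ∈ T',
        (G.induce T).Reachable ⟨v, hv⟩ ⟨w, hsub hw⟩ := by
        intro v hv hvB
        exact ⟨v, ⟨hv, hvB⟩, SimpleGraph.Reachable.refl _⟩
      intro k
      induction k with
      | zero =>
        intro v hv hk
        by_cases hvB : v ∈ B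
        · have := hrx v hvB
          omega
        · exact base v hv hvB
      | succ k ih =>
        intro v hv hk
        by_cases hvB : v ∈ B
        · rcases key1 (z (Sum.inl v)) with h | h
          · have hxT : x v ∈ T := by
              show z (cl (x v)) + sg (x v) = 1
              rw [clP (x v) v hvB (Or.inl rfl), sgx v hvB, h]
            obtain ⟨w, hw, hr⟩ := ih (x v) hxT (by have := hrx v hvB; omega)
            refine ⟨w, hw, SimpleGraph.Reachable.trans (SimpleGraph.Adj.reachable ?_) hr⟩
            simpa using hx v hvB
          · have hxT : y v ∈ T := by
              show z (cl (y v)) + sg (y v) = 1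
              rw [clP (y v) v hvB (Or.inr rfl), sgy v hvB, h]
            obtain ⟨w, hw, hr⟩ := ih (y v) hxT (by have := hry v hvB; omega)
            refine ⟨w, hw, SimpleGraph.Reachable.trans (SimpleGraph.Adj.reachable ?_) hr⟩
            simpa using hy v hvB
        · exact base v hv hvB
    have hTne : Nonempty T := ⟨⟨hT'ne.some, hsub hT'ne.some_mem⟩⟩
    rw [SimpleGraph.connected_iff]
    refine ⟨?_, hTne⟩
    rintro ⟨u, hu⟩ ⟨v, hv⟩
    obtain ⟨w, hw, hr⟩ := reach _ u hu le_rfl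
    obtain ⟨w', hw', hr'⟩ := reach _ v hv le_rfl
    refine hr.trans (SimpleGraph.Reachable.trans ?_ hr'.symm)
    have := hconn.preconnected ⟨w, hw⟩ ⟨w', hw'⟩
    exact this.map (SimpleGraph.induceHomOfLE G hsub).toHom

open SimpleGraph MeasureTheory Filter

lemma closure_exists {V : Type*} [Fintype V] [DecidableEq V] (G : SimpleGraph V)
    (Bad0 : Finset V)
    (hsp : ∀ W : Finset V, W.Nonempty → W.card ≤ 30 * Bad0.card + 10 → ∀ F, EdgesIn G W F →
      4 * F.card < 5 * W.card) :
    ∃ B : Finset V, Bad0 ⊆ B ∧ B.card ≤ 3 * Bad0.card ∧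
      ∀ v, v ∉ B → ∀ A : Finset V,
      (∀ a ∈ A, G.Adj v a ∧ (a ∈ B ∨ ∃ w ∈ B, G.Adj w a)) → A.card ≤ 8 := by
  classical
  let Φ : Finset V → Prop := fun B => Bad0 ⊆ B ∧ ∀ v ∈ B \ Bad0, ∃ A : Finset V, A.card = 9 ∧
    ∀ a ∈ A, G.Adj v a ∧ (a ∈ B ∨ ∃ w ∈ B, w ≠ v ∧ G.Adj w a)
  have claim : ∀ B, Φ B → B.card ≤ 3 * Bad0.card + 1 → B.card ≤ 3 * Bad0.card := by
    intro B hB hcard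
    obtain ⟨hsub, hA⟩ := hB
    by_cases hBe : B.Nonempty
    swap
    · rw [Finset.not_nonempty_iff_eq_empty] at hBe
      simp [hBe]
    have hA' : ∀ v, ∃ A : Finset V, A.card ≤ 9 ∧ (v ∈ B \ Bad0 → A.card = 9 ∧
      ∀ a ∈ A, G.Adj v a ∧ (a ∈ B ∨ ∃ w ∈ B, w ≠ v ∧ G.Adj w a)) := by
      intro v
      by_cases hv : v ∈ B \ Bad0
      · obtain ⟨A, h1, h2⟩ := hA v hv
        exact ⟨A, h1.le, fun _ => ⟨h1, h2⟩⟩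
      · exact ⟨∅, by simp, fun h => absurd h hv⟩
    choose f hf9 hf using hA'
    let U := ((B \ Bad0).biUnion f) \ B
    let W := B ∪ U
    have hU : U.card ≤ 9 * (B \ Bad0).card := by
      calc U.card ≤ ((B \ Bad0).biUnion f).card := Finset.card_le_card Finset.sdiff_subset
        _ ≤ (B \ Bad0).card * 9 := Finset.card_biUnion_le_card_mul _ _ _ (fun v _ => hf9 v)
        _ = _ := mul_comm _ _
    have hdisj : Disjoint B U := Finset.disjoint_sdiff
    have hW : W.card = B.card + U.card := Finset.card_union_of_disjoint hdisj
    have ht : (B \ Bad0).card + Bad0.card = B.card := Finset.card_sdiff_add_card_eq_card hsub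
    obtain ⟨F, hF, hF2⟩ := degSum_edges G W
      (fun v => if v ∈ B then (if v ∈ Bad0 then 0 else 9) else 2) (by
      intro v hv
      by_cases hvB : v ∈ B
      · by_cases hv0 : v ∈ Bad0
        · exact ⟨∅, by simp, by simp [hvB, hv0], by simp⟩
        · have hvm : v ∈ B \ Bad0 := Finset.mem_sdiff.mpr ⟨hvB, hv0⟩
          obtain ⟨h1, h2⟩ := hf v hvm
          refine ⟨f v, ?_, by simp [hvB, hv0, h1], fun a ha => (h2 a ha).1⟩
          intro a ha
          by_cases haB : a ∈ B
          · exact Finset.mem_union_left _ haB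
          · exact Finset.mem_union_right _ (Finset.mem_sdiff.mpr
              ⟨Finset.mem_biUnion.mpr ⟨v, hvm, ha⟩, haB⟩)
      · have hvU : v ∈ U := by
          rcases Finset.mem_union.mp hv with h | h
          · exact absurd h hvB
          · exact h
        obtain ⟨w, hw, hvw⟩ := Finset.mem_biUnion.mp (Finset.mem_sdiff.mp hvU).1
        obtain ⟨h1, h2⟩ := (hf w hw).2 v hvw
        obtain ⟨w', hw', hne, hadj⟩ := h2.resolve_left hvB
        refine ⟨{w, w'}, ?_, ?_, ?_⟩
        · intro a ha
          apply Finset.mem_union_left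
          simp only [Finset.mem_insert, Finset.mem_singleton] at ha
          rcases ha with rfl | rfl
          · exact (Finset.mem_sdiff.mp hw).1
          · exact hw'
        · rw [Finset.card_pair (Ne.symm hne)]
          simp [hvB]
        · intro a ha
          simp only [Finset.mem_insert, Finset.mem_singleton] at ha
          rcases ha with rfl | rfl
          · exact h1.symm
          · exact hadj.symm)
    have hsum : ∑ v ∈ W, (if v ∈ B then (if v ∈ Bad0 then 0 else 9) else 2)
        = 9 * (B \ Bad0).card + 2 * U.card := by
      rw [Finset.sum_union hdisj]
      congr 1
      · rw [Finset.sum_congr rfl (g := fun v => if v ∈ Bad0 then 0 else 9)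
          (fun v hv => by simp [hv])]
        rw [Finset.sum_ite]
        simp [Finset.sdiff_eq_filter, mul_comm]
      · rw [Finset.sum_congr rfl (g := fun v => 2)
          (fun v hv => by simp [Finset.disjoint_right.mp hdisj hv])]
        simp [mul_comm]
    rw [hsum] at hF2
    have := hsp W (hBe.mono Finset.subset_union_left) (by omega) F hF
    omega
  let fam := (Finset.univ : Finset (Finset V)).filter (fun B => Φ B ∧ B.card ≤ 3 * Bad0.card)
  have hfam : fam.Nonempty := by
    refine ⟨Bad0, ?_⟩
    simp only [fam, Finset.mem_filter, Finset.mem_univ, true_and]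
    refine ⟨⟨subset_rfl, by simp⟩, by omega⟩
  obtain ⟨B, hBm, hBmax⟩ := fam.exists_max_image Finset.card hfam
  simp only [fam, Finset.mem_filter, Finset.mem_univ, true_and] at hBm hBmax
  refine ⟨B, hBm.1.1, hBm.2, ?_⟩
  intro v hv A hA
  by_contra hc
  push Not at hc
  obtain ⟨A', hA', hA9⟩ := Finset.exists_subset_card_eq (show 9 ≤ A.card by omega)
  have hΦ : Φ (insert v B) := by
    refine ⟨hBm.1.1.trans (Finset.subset_insert _ _), ?_⟩
    intro w hw
    rw [Finset.mem_sdiff, Finset.mem_insert] at hw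
    rcases hw with ⟨rfl | hw, hw0⟩
    · refine ⟨A', hA9, fun a ha => ?_⟩
      obtain ⟨h1, h2⟩ := hA a (hA' ha)
      refine ⟨h1, ?_⟩
      rcases h2 with h2 | ⟨u, hu, hu2⟩
      · exact Or.inl (Finset.mem_insert_of_mem h2)
      · refine Or.inr ⟨u, Finset.mem_insert_of_mem hu, ?_, hu2⟩
        rintro rfl
        exact hv hu
    · obtain ⟨A2, h1, h2⟩ := hBm.1.2 w (Finset.mem_sdiff.mpr ⟨hw, hw0⟩)
      refine ⟨A2, h1, fun a ha => ⟨(h2 a ha).1, ?_⟩⟩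
      rcases (h2 a ha).2 with h | ⟨u, hu, hu2⟩
      · exact Or.inl (Finset.mem_insert_of_mem h)
      · exact Or.inr ⟨u, Finset.mem_insert_of_mem hu, hu2⟩
  have hcard := Finset.card_insert_of_notMem hv
  have h3 := claim _ hΦ (by omega)
  have := hBmax _ ⟨hΦ, h3⟩
  omega

lemma degenerate_rank {V : Type*} [DecidableEq V] (G : SimpleGraph V) (k : ℕ) : ∀ (W0 : Finset V),
    (∀ W ⊆ W0, W.Nonempty → ∃ v ∈ W, ∀ A ⊆ W, (∀ a ∈ A, G.Adj v a) → A.card ≤ k) →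
    ∃ rank : V → ℕ, ∀ v ∈ W0, ∀ A ⊆ W0, (∀ a ∈ A, G.Adj v a ∧ rank a ≤ rank v) → A.card ≤ k := by
  intro W0
  induction hn : W0.card generalizing W0 with
  | zero =>
    intro _
    rw [Finset.card_eq_zero] at hn
    subst hn
    exact ⟨fun _ => 0, by simp⟩
  | succ n ih =>
    intro h
    obtain ⟨v, hv, hvA⟩ := h W0 subset_rfl (Finset.card_pos.mp (by omega))
    obtain ⟨rank, hr⟩ := ih (W0.erase v) (by rw [Finset.card_erase_of_mem hv]; omega)
      (fun W hW => h W (hW.trans (Finset.erase_subset _ _)))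
    refine ⟨fun w => if w = v then (W0.sup rank) + 1 else rank w, ?_⟩
    intro w hw A hA hadj
    by_cases hwv : w = v
    · subst hwv
      exact hvA A hA (fun a ha => (hadj a ha).1)
    · apply hr w (Finset.mem_erase.mpr ⟨hwv, hw⟩) A
      · intro a ha
        rw [Finset.mem_erase]
        refine ⟨?_, hA ha⟩
        rintro rfl
        have := (hadj a ha).2
        simp only [if_true, hwv, if_false] at this
        have h2 : rank w ≤ W0.sup rank := Finset.le_sup hw
        omega
      · intro a ha
        refine ⟨(hadj a ha).1, ?_⟩
        have := (hadj a ha).2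
        simp only [hwv, if_false] at this
        by_cases hav : a = v
        · subst hav
          simp only [if_true] at this
          have h2 : rank w ≤ W0.sup rank := Finset.le_sup hw
          omega
        · simpa [hav] using this

open SimpleGraph MeasureTheory Filter

/-- vertices of degree at most 10 -/
def Low {V : Type*} (G : SimpleGraph V) (v : V) : Prop :=
  ∀ A : Finset V, (∀ a ∈ A, G.Adj v a) → A.card ≤ 10

lemma privates_exist {V : Type*} [Fintype V] [DecidableEq V] (G : SimpleGraph V)
    (B : Finset V) (b : ℕ) (hB : B.card ≤ 3 * b)
    (hsp : ∀ W : Finset V, W.Nonempty → W.card ≤ 30 * b + 10 → ∀ F, EdgesIn G W F →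
      4 * F.card < 5 * W.card)
    (h2 : ∀ v, ∃ x y, x ≠ y ∧ G.Adj v x ∧ G.Adj v y)
    (htri : ∀ v x y, Low G v → G.Adj v x → G.Adj v y → ¬ G.Adj x y)
    (hp1 : ∀ u v, Low G u → Low G v → u ≠ v → ¬ G.Adj u v)
    (hp2 : ∀ u v a, Low G u → Low G v → u ≠ v → G.Adj u a → G.Adj a v → False)
    (hp3 : ∀ u v a b, Low G u → Low G v → u ≠ v → G.Adj u a → G.Adj a b → G.Adj b v → False)
    (hp4 : ∀ u v a b c, Low G u → Low G v → u ≠ v → G.Adj u a → G.Adj a b → G.Adj b c →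
      G.Adj c v → False) :
    ∃ (x y : V → V) (rk : V → ℕ),
      (∀ v ∈ B, G.Adj v (x v)) ∧ (∀ v ∈ B, G.Adj v (y v)) ∧
      (∀ v ∈ B, ¬ G.Adj (x v) (y v)) ∧ (∀ v ∈ B, x v ≠ y v) ∧
      (∀ v ∈ B, ∀ w ∈ B, v ≠ w → x v ≠ x w ∧ x v ≠ y w ∧ y v ≠ y w) ∧
      (∀ v ∈ B, rk (x v) < rk v) ∧ (∀ v ∈ B, rk (y v) < rk v) := by
  classical
  choose x0 y0 hne0 hx0 hy0 using h2
  let PL : V → Prop := fun a => ∃ u, Low G u ∧ (a = u ∨ a = x0 u ∨ a = y0 u)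
  have hN : ∀ v, ∃ A : Finset V, A.card ≤ 8 ∧ (¬ Low G v → A.card = 8 ∧ ∀ a ∈ A, G.Adj v a ∧ ¬ PL a) := by
    intro v
    by_cases hv : Low G v
    · exact ⟨∅, by simp, fun h => absurd hv h⟩
    unfold Low at hv
    push Not at hv
    obtain ⟨A, hA, hA11⟩ := hv
    have h3 : (A.filter PL).card ≤ 3 := by
      by_cases hem : (A.filter PL).Nonempty
      swap
      · rw [Finset.not_nonempty_iff_eq_empty] at hem
        simp [hem]
      obtain ⟨a0, ha0⟩ := hem
      obtain ⟨ha0A, u, hu, hau⟩ := Finset.mem_filter.mp ha0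
      have hsub : A.filter PL ⊆ {u, x0 u, y0 u} := by
        intro a1 ha1
        obtain ⟨ha1A, w, hw, haw⟩ := Finset.mem_filter.mp ha1
        have huw : u = w := by
          by_contra hne
          have dist : ∀ a z, a ∈ A → (a = z ∨ a = x0 z ∨ a = y0 z) → G.Adj v z ∨
              ∃ q, G.Adj v q ∧ G.Adj q z := by
            intro a z haA h
            rcases h with rfl | rfl | rfl
            · exact Or.inl (hA _ haA)
            · exact Or.inr ⟨_, hA _ haA, (hx0 z).symm⟩
            · exact Or.inr ⟨_, hA _ haA, (hy0 z).symm⟩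
          rcases dist a0 u ha0A hau with h | ⟨q, hq1, hq2⟩ <;>
          rcases dist a1 w ha1A haw with h' | ⟨q', hq1', hq2'⟩
          · exact hp2 u w v hu hw hne h.symm h'
          · exact hp3 u w v q' hu hw hne h.symm hq1' hq2'
          · exact hp3 u w q v hu hw hne hq2.symm hq1.symm h'
          · exact hp4 u w q v q' hu hw hne hq2.symm hq1.symm hq1' hq2'
        subst huw
        simpa using haw
      exact (Finset.card_le_card hsub).trans Finset.card_le_three
    have h8 : 8 ≤ (A.filter (fun a => ¬ PL a)).card := by
      have := Finset.card_filter_add_card_filter_not (s := A) PL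
      omega
    obtain ⟨A', hA', hA8⟩ := Finset.exists_subset_card_eq h8
    refine ⟨A', hA8.le, fun _ => ⟨hA8, fun a ha => ?_⟩⟩
    obtain ⟨h1, h2⟩ := Finset.mem_filter.mp (hA' ha)
    exact ⟨hA a h1, h2⟩
  choose N hN8 hN using hN
  let B1 := B.filter (fun v => ¬ Low G v)
  have hB1 : B1.card ≤ B.card := Finset.card_filter_le _ _
  let W0 := B1 ∪ B1.biUnion N
  have hW0 : W0.card ≤ 27 * b := by
    have h1 : W0.card ≤ B1.card + (B1.biUnion N).card := Finset.card_union_le _ _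
    have h2 : (B1.biUnion N).card ≤ B1.card * 8 :=
      Finset.card_biUnion_le_card_mul _ _ _ (fun v _ => hN8 v)
    omega
  obtain ⟨rank, hrank⟩ := degenerate_rank G 2 W0 (by
    intro W hW hWne
    by_contra hcon
    push Not at hcon
    obtain ⟨F, hF, hF2⟩ := degSum_edges G W (fun _ => 3) (by
      intro v hv
      obtain ⟨A, h1, h2, h3⟩ := hcon v hv
      exact ⟨A, h1, h3, h2⟩)
    have hc := Finset.card_le_card hW
    have := hsp W hWne (by omega) F hF
    simp at hF2
    omega)
  let later : V → Finset V := fun v => (N v).filter (fun u => rank v < rank u)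
  have hlater : ∀ v ∈ B1, 6 ≤ (later v).card := by
    intro v hv
    have hvl := (Finset.mem_filter.mp hv).2
    have h1 : ((N v).filter (fun u => ¬ rank v < rank u)).card ≤ 2 := by
      apply hrank v (Finset.mem_union_left _ hv)
      · intro a ha
        exact Finset.mem_union_right _ (Finset.mem_biUnion.mpr ⟨v, hv, (Finset.mem_filter.mp ha).1⟩)
      · intro a ha
        obtain ⟨h1, h2⟩ := Finset.mem_filter.mp ha
        exact ⟨((hN v hvl).2 a h1).1, not_lt.mp h2⟩
    have h2 := Finset.card_filter_add_card_filter_not (s := N v) (fun u => rank v < rank u)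
    have h3 := (hN v hvl).1
    simp only [later]
    omega
  have hhall : ∀ s : Finset (B1 × Fin 3), s.card ≤ (s.biUnion (fun z => later z.1.1)).card := by
    intro s
    let B' : Finset V := s.image (fun z => z.1.1)
    have hB'1 : B' ⊆ B1 := by
      intro v hv
      obtain ⟨z, _, rfl⟩ := Finset.mem_image.mp hv
      exact z.1.2
    have hs : s.card ≤ B'.card * 3 := by
      have hinj : Function.Injective (fun z : B1 × Fin 3 => (z.1.1, z.2)) := by
        rintro ⟨⟨a, _⟩, i⟩ ⟨⟨c, _⟩, j⟩ h
        simpa using h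
      rw [← Finset.card_image_of_injective s hinj]
      have : s.image (fun z : B1 × Fin 3 => (z.1.1, z.2)) ⊆ B' ×ˢ (Finset.univ : Finset (Fin 3)) := by
        intro q hq
        obtain ⟨z, hz, rfl⟩ := Finset.mem_image.mp hq
        simp only [Finset.mem_product, Finset.mem_univ, and_true]
        exact Finset.mem_image.mpr ⟨z, hz, rfl⟩
      have := Finset.card_le_card this
      rwa [Finset.card_product, Finset.card_univ, Fintype.card_fin] at this
    have heq : s.biUnion (fun z => later z.1.1) = B'.biUnion later := by
      simp only [B', Finset.image_biUnion]
    rw [heq]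
    have hdc : B'.card * 6 ≤ (B'.biUnion later).card * 2 := by
      apply Finset.card_mul_le_card_mul (fun v u => u ∈ later v)
      · intro v hv
        refine (hlater v (hB'1 hv)).trans (Finset.card_le_card ?_)
        intro u hu
        rw [Finset.mem_bipartiteAbove]
        exact ⟨Finset.mem_biUnion.mpr ⟨v, hv, hu⟩, hu⟩
      · intro u hu
        obtain ⟨v0, hv0, hu0⟩ := Finset.mem_biUnion.mp hu
        apply hrank u
        · exact Finset.mem_union_right _ (Finset.mem_biUnion.mpr
            ⟨v0, hB'1 hv0, (Finset.mem_filter.mp hu0).1⟩)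
        · intro v hv
          rw [Finset.mem_bipartiteBelow] at hv
          exact Finset.mem_union_left _ (hB'1 hv.1)
        · intro v hv
          rw [Finset.mem_bipartiteBelow] at hv
          obtain ⟨h1, h2⟩ := Finset.mem_filter.mp hv.2
          exact ⟨(((hN v (Finset.mem_filter.mp (hB'1 hv.1)).2).2 u h1).1).symm, h2.le⟩
    omega
  obtain ⟨f, hfinj, hf⟩ := (Finset.all_card_le_biUnion_card_iff_exists_injective
    (fun z : B1 × Fin 3 => later z.1.1)).mp hhall
  have hfadj : ∀ z : B1 × Fin 3, G.Adj z.1.1 (f z) ∧ ¬ PL (f z) ∧ rank z.1.1 < rank (f z) := by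
    intro z
    obtain ⟨h1, h2⟩ := Finset.mem_filter.mp (hf z)
    have := (hN z.1.1 (Finset.mem_filter.mp z.1.2).2).2 _ h1
    exact ⟨this.1, this.2, h2⟩
  have hpair : ∀ v : B1, ∃ i j : Fin 3, i ≠ j ∧ ¬ G.Adj (f (v, i)) (f (v, j)) := by
    intro v
    by_contra hcon
    push Not at hcon
    have hfi : Function.Injective (fun i : Fin 3 => f (v, i)) := by
      intro i j h
      have := hfinj h
      simpa using this
    let I : Finset V := Finset.univ.image (fun i : Fin 3 => f (v, i))
    have hI : I.card = 3 := by
      simp only [I]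
      rw [Finset.card_image_of_injective _ hfi]; simp
    have hvI : v.1 ∉ I := by
      intro h
      obtain ⟨i, _, hi⟩ := Finset.mem_image.mp h
      have := (hfadj (v, i)).1
      simp only [hi] at this
      exact G.loopless.irrefl _ this
    have hWc : (insert v.1 I).card = 4 := by rw [Finset.card_insert_of_notMem hvI, hI]
    have cl : ∀ a ∈ insert v.1 I, ∀ c ∈ insert v.1 I, a ≠ c → G.Adj a c := by
      intro a ha c hc hac
      rw [Finset.mem_insert] at ha hc
      rcases ha with rfl | ha <;> rcases hc with rfl | hc
      · exact absurd rfl hac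
      · obtain ⟨i, _, rfl⟩ := Finset.mem_image.mp hc
        exact (hfadj (v, i)).1
      · obtain ⟨i, _, rfl⟩ := Finset.mem_image.mp ha
        exact (hfadj (v, i)).1.symm
      · obtain ⟨i, _, rfl⟩ := Finset.mem_image.mp hc
        obtain ⟨j, _, rfl⟩ := Finset.mem_image.mp ha
        apply hcon
        rintro rfl
        exact hac rfl
    obtain ⟨F, hF, hF2⟩ := degSum_edges G (insert v.1 I) (fun _ => 3) (by
      intro a ha
      refine ⟨(insert v.1 I).erase a, Finset.erase_subset _ _, ?_, ?_⟩
      · rw [Finset.card_erase_of_mem ha, hWc]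
      · intro c hc
        rw [Finset.mem_erase] at hc
        exact cl a ha c hc.2 (Ne.symm hc.1))
    have := hsp (insert v.1 I) (Finset.insert_nonempty _ _) (by omega) F hF
    rw [Finset.sum_const, hWc] at hF2
    simp at hF2
    omega
  have hall : ∀ v, ∃ a c : V, v ∈ B → (Low G v → a = x0 v ∧ c = y0 v) ∧
      (¬ Low G v → ∃ (hv : v ∈ B1) (i j : Fin 3), i ≠ j ∧ a = f (⟨v, hv⟩, i) ∧ c = f (⟨v, hv⟩, j) ∧
        ¬ G.Adj a c) := by
    intro v
    by_cases hl : Low G v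
    · exact ⟨x0 v, y0 v, fun _ => ⟨fun _ => ⟨rfl, rfl⟩, fun h => absurd hl h⟩⟩
    · by_cases hvB : v ∈ B
      · have hv1 : v ∈ B1 := Finset.mem_filter.mpr ⟨hvB, hl⟩
        obtain ⟨i, j, hij, hadj⟩ := hpair ⟨v, hv1⟩
        exact ⟨_, _, fun _ => ⟨fun h => absurd h hl, fun _ => ⟨hv1, i, j, hij, rfl, rfl, hadj⟩⟩⟩
      · exact ⟨v, v, fun h => absurd h hvB⟩
  choose x y hxy using hall
  let M := Finset.univ.sup rank
  have hM : ∀ v, rank v ≤ M := fun v => Finset.le_sup (Finset.mem_univ v)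
  let rk : V → ℕ := fun v => if Low G v then M + 1 else M - rank v
  have rkf : ∀ v (hv : v ∈ B1) i, rk (f (⟨v, hv⟩, i)) < rk v := by
    intro v hv i
    obtain ⟨h1, h2, h3⟩ := hfadj (⟨v, hv⟩, i)
    have hl : ¬ Low G v := (Finset.mem_filter.mp hv).2
    have hl2 : ¬ Low G (f (⟨v, hv⟩, i)) := fun h => h2 ⟨_, h, Or.inl rfl⟩
    simp only [rk, hl, hl2, if_false]
    have := hM (f (⟨v, hv⟩, i))
    simp only at h3
    omega
  have rk0 : ∀ v a, Low G v → G.Adj v a → rk a < rk v := by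
    intro v a hl hadj
    have hl2 : ¬ Low G a := fun h => hp1 v a hl h hadj.ne hadj
    simp only [rk, hl, hl2, if_false, if_true]
    omega
  -- membership description
  have desc : ∀ v ∈ B, ∀ a, (a = x v ∨ a = y v) → (Low G v ∧ (a = x0 v ∨ a = y0 v)) ∨
      ∃ (hv : v ∈ B1) (i : Fin 3), a = f (⟨v, hv⟩, i) := by
    intro v hv a ha
    by_cases hl : Low G v
    · obtain ⟨h1, h2⟩ := (hxy v hv).1 hl
      rw [h1, h2] at ha
      exact Or.inl ⟨hl, ha⟩
    · obtain ⟨hv1, i, j, hij, h1, h2, h3⟩ := (hxy v hv).2 hl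
      right
      rcases ha with rfl | rfl
      · exact ⟨hv1, i, h1⟩
      · exact ⟨hv1, j, h2⟩
  have dis : ∀ v ∈ B, ∀ w ∈ B, v ≠ w → ∀ a, (a = x v ∨ a = y v) → (a = x w ∨ a = y w) → False := by
    intro v hv w hw hvw a ha hb
    rcases desc v hv a ha with ⟨h1, h2⟩ | ⟨hv1, i, h2⟩ <;>
    rcases desc w hw a hb with ⟨h1', h2'⟩ | ⟨hw1, j, h2'⟩
    · have e1 : G.Adj v a := by rcases h2 with rfl | rfl; exacts [hx0 v, hy0 v]
      have e2 : G.Adj w a := by rcases h2' with rfl | rfl; exacts [hx0 w, hy0 w]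
      exact hp2 v w a h1 h1' hvw e1 e2.symm
    · apply (hfadj (⟨w, hw1⟩, j)).2.1
      rw [← h2']
      exact ⟨v, h1, Or.inr h2⟩
    · apply (hfadj (⟨v, hv1⟩, i)).2.1
      rw [← h2]
      exact ⟨w, h1', Or.inr h2'⟩
    · have := hfinj (h2.symm.trans h2')
      simp at this
      exact hvw this.1
  refine ⟨x, y, rk, ?_, ?_, ?_, ?_, ?_, ?_, ?_⟩
  · intro v hv
    rcases desc v hv _ (Or.inl rfl) with ⟨h1, h2 | h2⟩ | ⟨hv1, i, h2⟩ <;> rw [h2]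
    exacts [hx0 v, hy0 v, (hfadj (⟨v, hv1⟩, i)).1]
  · intro v hv
    rcases desc v hv _ (Or.inr rfl) with ⟨h1, h2 | h2⟩ | ⟨hv1, i, h2⟩ <;> rw [h2]
    exacts [hx0 v, hy0 v, (hfadj (⟨v, hv1⟩, i)).1]
  · intro v hv
    by_cases hl : Low G v
    · obtain ⟨h1, h2⟩ := (hxy v hv).1 hl
      rw [h1, h2]
      exact htri v _ _ hl (hx0 v) (hy0 v)
    · obtain ⟨hv1, i, j, hij, h1, h2, h3⟩ := (hxy v hv).2 hl
      exact h3
  · intro v hv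
    by_cases hl : Low G v
    · obtain ⟨h1, h2⟩ := (hxy v hv).1 hl
      rw [h1, h2]
      exact hne0 v
    · obtain ⟨hv1, i, j, hij, h1, h2, h3⟩ := (hxy v hv).2 hl
      rw [h1, h2]
      intro h
      have := hfinj h
      simp at this
      exact hij this
  · intro v hv w hw hvw
    refine ⟨fun h => ?_, fun h => ?_, fun h => ?_⟩
    · exact dis v hv w hw hvw (x v) (Or.inl rfl) (Or.inl h)
    · exact dis v hv w hw hvw (x v) (Or.inl rfl) (Or.inr h)
    · exact dis v hv w hw hvw (y v) (Or.inr rfl) (Or.inr h)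
  · intro v hv
    rcases desc v hv _ (Or.inl rfl) with ⟨h1, h2 | h2⟩ | ⟨hv1, i, h2⟩ <;> rw [h2]
    exacts [rk0 v _ h1 (hx0 v), rk0 v _ h1 (hy0 v), rkf v hv1 i]
  · intro v hv
    rcases desc v hv _ (Or.inr rfl) with ⟨h1, h2 | h2⟩ | ⟨hv1, i, h2⟩ <;> rw [h2]
    exacts [rk0 v _ h1 (hx0 v), rk0 v _ h1 (hy0 v), rkf v hv1 i]

open SimpleGraph MeasureTheory Filter

lemma legal_of_matching {V : Type*} [Fintype V] [DecidableEq V] (G : SimpleGraph V) (D : ℕ)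
    (hD : ∀ v, ∀ A : Finset V, (∀ a ∈ A, a ≠ v ∧ ¬ G.Adj v a) → A.card ≤ D)
    (P : Finset (V × V)) (hP : ∀ e ∈ P, e.1 ≠ e.2 ∧ ¬ G.Adj e.1 e.2)
    (hdis : ∀ e ∈ P, ∀ e' ∈ P, e ≠ e' → e.1 ≠ e'.1 ∧ e.1 ≠ e'.2 ∧ e.2 ≠ e'.2)
    (hcard : 2 * D + 3 ≤ P.card) : HasLegalSystem G := by
  classical
  let cl : V → V := fun u => if h : ∃ a, (a, u) ∈ P then h.choose else u
  let sg : V → ZMod 2 := fun u => if ∃ a, (a, u) ∈ P then 1 else 0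
  have nofst : ∀ a b, (a, b) ∈ P → ¬ ∃ c, (c, a) ∈ P := by
    rintro a b hab ⟨c, hc⟩
    by_cases h : (a, b) = (c, a)
    · simp only [Prod.mk.injEq] at h
      exact (hP _ hab).1 h.2.symm
    · exact (hdis _ hab _ hc h).2.1 rfl
  have cl2 : ∀ a b, (a, b) ∈ P → cl b = a ∧ sg b = 1 := by
    intro a b hab
    have hex : ∃ a, (a, b) ∈ P := ⟨a, hab⟩
    constructor
    · have : cl b = hex.choose := by simp only [cl]; rw [dif_pos hex]
      rw [this]
      by_contra hne
      exact (hdis _ hex.choose_spec _ hab (fun h => hne (Prod.mk.inj h).1)).2.2 rfl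
    · simp only [sg]; rw [if_pos hex]
  have cl0 : ∀ u, (¬ ∃ a, (a, u) ∈ P) → cl u = u ∧ sg u = 0 := by
    intro u hu
    simp only [cl, sg]
    rw [dif_neg hu, if_neg hu]
    exact ⟨rfl, rfl⟩
  have key1 : ∀ z : ZMod 2, z + 0 = 1 ∨ z + 1 = 1 := by decide
  apply legal_of_classes G cl sg
  · intro u w huw hadj
    by_cases hu : ∃ a, (a, u) ∈ P <;> by_cases hw : ∃ a, (a, w) ∈ P
    · obtain ⟨a, ha⟩ := hu
      obtain ⟨c, hc⟩ := hw
      rw [(cl2 a u ha).1, (cl2 c w hc).1] at huw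
      subst huw
      by_cases h : u = w
      · subst h; exact G.loopless.irrefl _ hadj
      · exact (hdis _ ha _ hc (fun h' => h (Prod.mk.inj h').2)).1 rfl
    · obtain ⟨a, ha⟩ := hu
      rw [(cl2 a u ha).1, (cl0 w hw).1] at huw
      subst huw
      exact (hP _ ha).2 hadj.symm
    · obtain ⟨a, ha⟩ := hw
      rw [(cl2 a w ha).1, (cl0 u hu).1] at huw
      subst huw
      exact (hP _ ha).2 hadj
    · rw [(cl0 w hw).1, (cl0 u hu).1] at huw
      subst huw
      exact G.loopless.irrefl _ hadj
  · intro z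
    set T : Set V := {v | z (cl v) + sg v = 1} with hT
    have ht : ∀ e : V × V, ∃ t, e ∈ P → t ∈ T ∧ (t = e.1 ∨ t = e.2) := by
      intro e
      by_cases he : e ∈ P
      · rcases key1 (z e.1) with h | h
        · refine ⟨e.1, fun _ => ⟨?_, Or.inl rfl⟩⟩
          show z (cl e.1) + sg e.1 = 1
          obtain ⟨h1, h2⟩ := cl0 e.1 (nofst e.1 e.2 he)
          rw [h1, h2, h]
        · refine ⟨e.2, fun _ => ⟨?_, Or.inr rfl⟩⟩
          show z (cl e.2) + sg e.2 = 1
          obtain ⟨h1, h2⟩ := cl2 e.1 e.2 he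
          rw [h1, h2, h]
      · exact ⟨e.1, fun h => absurd h he⟩
    choose t ht using ht
    have tinj : Set.InjOn t P := by
      intro e he e' he' h
      by_contra hne
      have d1 := hdis e he e' he' hne
      have d2 := hdis e' he' e he (Ne.symm hne)
      rcases (ht e he).2 with h1 | h1 <;> rcases (ht e' he').2 with h2 | h2 <;>
      rw [h1, h2] at h
      · exact d1.1 h
      · exact d1.2.1 h
      · exact d2.2.1 h.symm
      · exact d1.2.2 h
    have common : ∀ u v : V, ∃ w ∈ T, G.Adj u w ∧ G.Adj v w := by
      intro u v
      let Q := P.image t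
      have hQ : Q.card = P.card := Finset.card_image_of_injOn tinj
      let Q1 := Q.filter (fun w => w ≠ u ∧ ¬ G.Adj u w)
      let Q2 := Q.filter (fun w => w ≠ v ∧ ¬ G.Adj v w)
      have h1 : Q1.card ≤ D := hD u _ (fun a ha => (Finset.mem_filter.mp ha).2)
      have h2 : Q2.card ≤ D := hD v _ (fun a ha => (Finset.mem_filter.mp ha).2)
      have h3 : (Q1 ∪ Q2 ∪ {u, v}).card < Q.card := by
        have := Finset.card_union_le (Q1 ∪ Q2) {u, v}
        have := Finset.card_union_le Q1 Q2
        have : ({u, v} : Finset V).card ≤ 2 := Finset.card_le_two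
        omega
      obtain ⟨w, hw, hw2⟩ := Finset.exists_mem_notMem_of_card_lt_card h3
      simp only [Finset.mem_union, not_or, Q1, Q2, Finset.mem_filter, hw, true_and, not_and,
        not_not, Finset.mem_insert, Finset.mem_singleton] at hw2
      obtain ⟨e, he, rfl⟩ := Finset.mem_image.mp hw
      exact ⟨t e, (ht e he).1, hw2.1.1 hw2.2.1, hw2.1.2 hw2.2.2⟩
    have hTne : Nonempty T := by
      obtain ⟨e, he⟩ := Finset.card_pos.mp (show 0 < P.card by omega)
      exact ⟨⟨t e, (ht e he).1⟩⟩
    rw [SimpleGraph.connected_iff]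
    refine ⟨?_, hTne⟩
    rintro ⟨u, hu⟩ ⟨v, hv⟩
    obtain ⟨w, hw, h1, h2⟩ := common u v
    have r1 : (G.induce T).Reachable ⟨u, hu⟩ ⟨w, hw⟩ := SimpleGraph.Adj.reachable (by simpa using h1)
    have r2 : (G.induce T).Reachable ⟨v, hv⟩ ⟨w, hw⟩ := SimpleGraph.Adj.reachable (by simpa using h2)
    exact r1.trans r2.symm

lemma legal_dense {V : Type*} [Fintype V] [DecidableEq V] (G : SimpleGraph V) (D : ℕ)
    (hD : ∀ v, ∀ A : Finset V, (∀ a ∈ A, a ≠ v ∧ ¬ G.Adj v a) → A.card ≤ D)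
    (F : Finset (Sym2 V)) (hF : ∀ e ∈ F, ¬ e.IsDiag ∧ e ∉ G.edgeSet)
    (hcard : 4 * D * (D + 1) < F.card) : HasLegalSystem G := by
  classical
  let ok : Finset (V × V) → Prop := fun P => (∀ e ∈ P, e.1 ≠ e.2 ∧ ¬ G.Adj e.1 e.2) ∧
    (∀ e ∈ P, ∀ e' ∈ P, e ≠ e' → e.1 ≠ e'.1 ∧ e.1 ≠ e'.2 ∧ e.2 ≠ e'.2)
  obtain ⟨P, hPm, hPmax⟩ := ((Finset.univ : Finset (Finset (V × V))).filter ok).exists_max_image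
    Finset.card ⟨∅, by simp [ok]⟩
  simp only [Finset.mem_filter, Finset.mem_univ, true_and] at hPm hPmax
  apply legal_of_matching G D hD P hPm.1 hPm.2
  by_contra hlt
  let X := P.image Prod.fst ∪ P.image Prod.snd
  have hX : X.card ≤ 2 * P.card := by
    have h1 := Finset.card_union_le (P.image Prod.fst) (P.image Prod.snd)
    have h2 : (P.image Prod.fst).card ≤ P.card := Finset.card_image_le
    have h3 : (P.image Prod.snd).card ≤ P.card := Finset.card_image_le
    simp only [X]
    omega
  have htouch : ∀ e ∈ F, ∃ v ∈ X, v ∈ e := by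
    intro e he
    by_contra hcon
    push Not at hcon
    induction e with
    | _ a b =>
    obtain ⟨h1, h2⟩ := hF _ he
    have haX : a ∉ X := fun h => hcon a h (by simp)
    have hbX : b ∉ X := fun h => hcon b h (by simp)
    have hX1 : ∀ e ∈ P, e.1 ∈ X ∧ e.2 ∈ X := fun e he =>
      ⟨Finset.mem_union_left _ (Finset.mem_image_of_mem _ he),
        Finset.mem_union_right _ (Finset.mem_image_of_mem _ he)⟩
    have hnew : (a, b) ∉ P := fun h => haX (hX1 _ h).1
    have hab : a ≠ b := by simpa using h1
    have hok : ok (insert (a, b) P) := by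
      constructor
      · intro e he
        rcases Finset.mem_insert.mp he with rfl | he
        · exact ⟨hab, by simpa using h2⟩
        · exact hPm.1 e he
      · intro e he e' he' hne
        rcases Finset.mem_insert.mp he with rfl | he <;>
        rcases Finset.mem_insert.mp he' with rfl | he'
        · exact absurd rfl hne
        · refine ⟨fun h => haX ?_, fun h => haX ?_, fun h => hbX ?_⟩
          · simp only at h; rw [h]; exact (hX1 _ he').1
          · simp only at h; rw [h]; exact (hX1 _ he').2
          · simp only at h; rw [h]; exact (hX1 _ he').2
        · refine ⟨fun h => haX ?_, fun h => hbX ?_, fun h => hbX ?_⟩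
          · simp only at h; rw [← h]; exact (hX1 _ he).1
          · simp only at h; rw [← h]; exact (hX1 _ he).1
          · simp only at h; rw [← h]; exact (hX1 _ he).2
        · exact hPm.2 e he e' he' hne
    have := hPmax _ hok
    rw [Finset.card_insert_of_notMem hnew] at this
    omega
  have hcount : F.card ≤ X.card * D := by
    have hsub : F ⊆ X.biUnion (fun v => F.filter (fun e => v ∈ e)) := by
      intro e he
      obtain ⟨v, hv, hve⟩ := htouch e he
      exact Finset.mem_biUnion.mpr ⟨v, hv, Finset.mem_filter.mpr ⟨he, hve⟩⟩
    refine (Finset.card_le_card hsub).trans (Finset.card_biUnion_le_card_mul _ _ _ ?_)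
    intro v _
    let A := (Finset.univ : Finset V).filter (fun a => s(v, a) ∈ F)
    have hA : A.card ≤ D := by
      apply hD v
      intro a ha
      obtain ⟨h1, h2⟩ := hF _ (Finset.mem_filter.mp ha).2
      exact ⟨fun h => h1 (by simp [h]), by simpa using h2⟩
    refine le_trans ?_ hA
    have : F.filter (fun e => v ∈ e) ⊆ A.image (fun a => s(v, a)) := by
      intro e he
      obtain ⟨h1, h2⟩ := Finset.mem_filter.mp he
      obtain ⟨a, rfl⟩ := Sym2.mem_iff_exists.mp h2
      exact Finset.mem_image.mpr ⟨a, Finset.mem_filter.mpr ⟨Finset.mem_univ _, h1⟩, rfl⟩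
    exact (Finset.card_le_card this).trans Finset.card_image_le
  have h1 : P.card ≤ 2 * D + 2 := by omega
  have h2 : X.card * D ≤ (2 * (2 * D + 2)) * D := Nat.mul_le_mul_right _ (by omega)
  have h3 : (2 * (2 * D + 2)) * D = 4 * D * (D + 1) := by ring
  omega

open SimpleGraph MeasureTheory Filter

instance bern_prob {p : ℝ} [hp : Fact (p ∈ Set.Icc (0:ℝ) 1)] : IsProbabilityMeasure (bernoulliMeasure p) := by
  constructor
  have h := hp.out
  simp only [bernoulliMeasure, Measure.coe_add, Measure.coe_smul, Pi.add_apply, Pi.smul_apply,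
    measure_univ, smul_eq_mul, mul_one]
  rw [← ENNReal.ofReal_add h.1 (by linarith [h.2])]
  simp

instance er_prob {n : ℕ} {p : ℝ} [hp : Fact (p ∈ Set.Icc (0:ℝ) 1)] : IsProbabilityMeasure (erdosRenyi n p) := by
  unfold erdosRenyi; infer_instance

lemma bern_integral {p : ℝ} [hp : Fact (p ∈ Set.Icc (0:ℝ) 1)] (f : Bool → ℝ) :
    ∫ b, f b ∂(bernoulliMeasure p) = p * f true + (1 - p) * f false := by
  have h := hp.out
  unfold bernoulliMeasure
  have i1 : IsFiniteMeasure (ENNReal.ofReal p • (Measure.dirac true : Measure Bool)) := ⟨by simp⟩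
  have i2 : IsFiniteMeasure (ENNReal.ofReal (1 - p) • (Measure.dirac false : Measure Bool)) := ⟨by
    rw [Measure.smul_apply, measure_univ, smul_eq_mul, mul_one]; exact ENNReal.ofReal_lt_top⟩
  rw [integral_add_measure (.of_finite) (.of_finite), integral_smul_measure, integral_smul_measure]
  simp [ENNReal.toReal_ofReal h.1, ENNReal.toReal_ofReal (show (0:ℝ) ≤ 1 - p by linarith [h.2])]

noncomputable def Pr (n : ℕ) (p : ℝ) (A : (Sym2 (Fin n) → Bool) → Prop) : ℝ :=
  (erdosRenyi n p).real {ω | A ω}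

noncomputable def EX (n : ℕ) (p : ℝ) (f : (Sym2 (Fin n) → Bool) → ℝ) : ℝ :=
  ∫ ω, f ω ∂(erdosRenyi n p)

set_option linter.unusedSectionVars false
section
variable {n : ℕ} {p : ℝ} [hp : Fact (p ∈ Set.Icc (0:ℝ) 1)]

lemma Pr_eq_EX (A : (Sym2 (Fin n) → Bool) → Prop) [DecidablePred A] :
    Pr n p A = EX n p (fun ω => if A ω then 1 else 0) := by
  unfold Pr EX
  rw [← integral_indicator_one (Set.Finite.measurableSet (Set.toFinite _))]
  congr 1
  funext ω
  by_cases h : A ω <;> simp [Set.indicator, h]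

lemma EX_mono {f g : (Sym2 (Fin n) → Bool) → ℝ} (h : ∀ ω, f ω ≤ g ω) : EX n p f ≤ EX n p g :=
  integral_mono .of_finite .of_finite h

lemma EX_add (f g : (Sym2 (Fin n) → Bool) → ℝ) :
    EX n p (fun ω => f ω + g ω) = EX n p f + EX n p g :=
  integral_add .of_finite .of_finite

lemma EX_mul_left (c : ℝ) (f : (Sym2 (Fin n) → Bool) → ℝ) :
    EX n p (fun ω => c * f ω) = c * EX n p f :=
  integral_const_mul _ _

lemma EX_const (c : ℝ) : EX n p (fun _ => c) = c := by
  simp [EX]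

lemma EX_sum {ι : Type*} (s : Finset ι) (f : ι → (Sym2 (Fin n) → Bool) → ℝ) :
    EX n p (fun ω => ∑ i ∈ s, f i ω) = ∑ i ∈ s, EX n p (f i) :=
  integral_finsetSum _ (fun _ _ => .of_finite)

lemma Pr_le_EX {A : (Sym2 (Fin n) → Bool) → Prop} {f : (Sym2 (Fin n) → Bool) → ℝ}
    (h0 : ∀ ω, 0 ≤ f ω) (h : ∀ ω, A ω → 1 ≤ f ω) : Pr n p A ≤ EX n p f := by
  classical
  rw [Pr_eq_EX]
  apply EX_mono
  intro ω
  split_ifs with hA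
  · exact h ω hA
  · exact h0 ω

lemma Pr_nonneg {A : (Sym2 (Fin n) → Bool) → Prop} : 0 ≤ Pr n p A := measureReal_nonneg

lemma Pr_mono {A B : (Sym2 (Fin n) → Bool) → Prop} (h : ∀ ω, A ω → B ω) : Pr n p A ≤ Pr n p B :=
  measureReal_mono (fun ω hω => h ω hω)

lemma Pr_or {A B : (Sym2 (Fin n) → Bool) → Prop} : Pr n p (fun ω => A ω ∨ B ω) ≤ Pr n p A + Pr n p B :=
  measureReal_union_le _ _

lemma Pr_ex {ι : Type*} (s : Finset ι) (A : ι → (Sym2 (Fin n) → Bool) → Prop) :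
    Pr n p (fun ω => ∃ i ∈ s, A i ω) ≤ ∑ i ∈ s, Pr n p (A i) := by
  have : {ω | ∃ i ∈ s, A i ω} = ⋃ i ∈ s, {ω | A i ω} := by ext; simp
  unfold Pr; rw [this]
  exact measureReal_biUnion_finset_le _ _

lemma Pr_ex_le {ι : Type*} (s : Finset ι) (A : ι → (Sym2 (Fin n) → Bool) → Prop) (c : ℝ)
    (h : ∀ i ∈ s, Pr n p (A i) ≤ c) :
    Pr n p (fun ω => ∃ i ∈ s, A i ω) ≤ s.card * c := by
  refine (Pr_ex s A).trans ?_
  refine (Finset.sum_le_sum h).trans ?_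
  simp

lemma EX_coord (g : Sym2 (Fin n) → Bool → ℝ) :
    EX n p (fun ω => ∏ e, g e (ω e)) = ∏ e, (p * g e true + (1 - p) * g e false) := by
  unfold EX erdosRenyi
  rw [integral_fintype_prod_eq_prod]
  simp_rw [bern_integral]

lemma EX_box (F S : Finset (Sym2 (Fin n))) (hd : Disjoint F S) (z w : ℝ) :
    EX n p (fun ω => (∏ e ∈ F, if ω e then 1 else 0) * ∏ e ∈ S, if ω e then z else w)
      = p ^ F.card * (p * z + (1 - p) * w) ^ S.card := by
  have h1 : ∀ ω : Sym2 (Fin n) → Bool, (∏ e ∈ F, if ω e then (1:ℝ) else 0) * (∏ e ∈ S, if ω e then z else w)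
     = ∏ e, (fun (e : Sym2 (Fin n)) (b : Bool) => (if e ∈ F then (if b then (1:ℝ) else 0) else 1) *
        (if e ∈ S then (if b then z else w) else 1)) e (ω e) := by
    intro ω
    rw [Finset.prod_mul_distrib, Finset.prod_ite_mem, Finset.prod_ite_mem]
    simp
  have h0 : EX n p _ = EX n p _ := congrArg (EX n p) (funext h1)
  refine h0.trans ((EX_coord (fun (e : Sym2 (Fin n)) (b : Bool) => (if e ∈ F then (if b then (1:ℝ) else 0) else 1) *
        (if e ∈ S then (if b then z else w) else 1))).trans ?_)
  have h2 : ∀ e, (p * ((if e ∈ F then (if true then (1:ℝ) else 0) else 1) *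
        (if e ∈ S then (if true then z else w) else 1)) + (1 - p) * ((if e ∈ F then (if false then (1:ℝ) else 0) else 1) *
        (if e ∈ S then (if false then z else w) else 1))) = (if e ∈ F then p else 1) * (if e ∈ S then (p * z + (1 - p) * w) else 1) := by
    intro e
    by_cases hF : e ∈ F
    · have : e ∉ S := fun h => (Finset.disjoint_left.mp hd) hF h
      simp [hF, this]
    · by_cases hS : e ∈ S <;> simp [hF, hS]
  have h3 := Finset.prod_congr (rfl : (Finset.univ : Finset (Sym2 (Fin n))) = _) (fun e _ => h2 e)
  refine Eq.trans h3 ?_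
  rw [Finset.prod_mul_distrib, Finset.prod_ite_mem, Finset.prod_ite_mem]
  simp

/-- upper tail bound: F all present, at most k of S present -/
lemma Pr_low (F S : Finset (Sym2 (Fin n))) (hd : Disjoint F S) (k : ℕ) (z : ℝ) (hz0 : 0 ≤ z) (hz1 : z ≤ 1) :
    Pr n p (fun ω => (∀ e ∈ F, ω e = true) ∧ (S.filter (fun e => ω e = true)).card ≤ k) * z ^ k ≤
      p ^ F.card * (1 - p * (1 - z)) ^ S.card := by
  classical
  have h := EX_box (p := p) F S hd z 1
  have h4 : p * z + (1 - p) * 1 = 1 - p * (1 - z) := by ring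
  rw [h4] at h
  rw [← h, Pr_eq_EX, mul_comm, ← EX_mul_left]
  apply EX_mono
  intro ω
  have hprod : (∏ e ∈ S, if ω e then z else 1) = z ^ (S.filter (fun e => ω e = true)).card := by
    rw [Finset.prod_ite]; simp
  rw [hprod]
  split_ifs with hA
  · rw [Finset.prod_congr rfl (g := fun _ => (1:ℝ)) (fun e he => by simp [hA.1 e he])]
    simp only [Finset.prod_const_one, one_mul, mul_one]
    exact pow_le_pow_of_le_one hz0 hz1 hA.2
  · rw [mul_zero]
    apply mul_nonneg (Finset.prod_nonneg (fun e _ => by split_ifs <;> norm_num)) (pow_nonneg hz0 _)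

lemma Pr_box_le (F S : Finset (Sym2 (Fin n))) (hd : Disjoint F S) :
    Pr n p (fun ω => (∀ e ∈ F, ω e = true) ∧ ∀ e ∈ S, ω e = false) ≤ p ^ F.card * (1 - p) ^ S.card := by
  have h := Pr_low (p := p) F S hd 0 0 le_rfl zero_le_one
  simp only [pow_zero, mul_one, sub_zero] at h
  refine le_trans (Pr_mono ?_) h
  intro ω hω
  refine ⟨hω.1, ?_⟩
  simp only [Nat.le_zero, Finset.card_eq_zero, Finset.filter_eq_empty_iff]
  intro e he; simp [hω.2 e he]

lemma Pr_all_le (F : Finset (Sym2 (Fin n))) :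
    Pr n p (fun ω => (∀ e ∈ F, ω e = true)) ≤ p ^ F.card := by
  have h := Pr_box_le (p := p) F ∅ (by simp)
  simpa using h

lemma Pr_box_eq (F S : Finset (Sym2 (Fin n))) (hd : Disjoint F S) :
    Pr n p (fun ω => (∀ e ∈ F, ω e = true) ∧ ∀ e ∈ S, ω e = false) = p ^ F.card * (1 - p) ^ S.card := by
  classical
  have h := EX_box (p := p) F S hd 0 1
  have h4 : p * 0 + (1 - p) * 1 = 1 - p := by ring
  rw [h4] at h
  rw [← h, Pr_eq_EX]
  congr 1
  funext ω
  rw [Finset.prod_ite_zero]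
  have : (∏ e ∈ S, if ω e = true then (0:ℝ) else 1) = if ∀ e ∈ S, ω e = false then 1 else 0 := by
    have := Finset.prod_ite_zero (s := S) (p := fun e => ω e = false) (f := fun _ => (1:ℝ))
    simp only [Finset.prod_const_one] at this
    rw [← this]
    apply Finset.prod_congr rfl
    intro e _; cases ω e <;> simp
  rw [this]
  rw [Finset.prod_const_one, ite_and]
  by_cases h1 : ∀ e ∈ F, ω e = true
  · rw [if_pos h1, if_pos h1, one_mul]
  · rw [if_neg h1, if_neg h1, zero_mul]

open ProbabilityTheory in
lemma EX_indep_two (S T : Finset (Sym2 (Fin n))) (hST : Disjoint S T)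
    (f g : (Sym2 (Fin n) → Bool) → ℝ) (hf : DependsOn f (S : Set (Sym2 (Fin n)))) (hg : DependsOn g (T : Set (Sym2 (Fin n)))) :
    EX n p (fun ω => f ω * g ω) = EX n p f * EX n p g := by
  classical
  have hi : iIndepFun (fun (i : Sym2 (Fin n)) (ω : Sym2 (Fin n) → Bool) => ω i) (erdosRenyi n p) := 
    iIndepFun_pi (X := fun _ (b : Bool) => b) (fun i => aemeasurable_id)
  have h := hi.indepFun_finset S T hST (fun i => measurable_pi_apply i)
  obtain ⟨f', hf'⟩ := dependsOn_iff_exists_comp.mp hf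
  obtain ⟨g', hg'⟩ := dependsOn_iff_exists_comp.mp hg
  have h2 := h.comp (φ := f') (ψ := g') (measurable_of_finite _) (measurable_of_finite _)
  have := h2.integral_mul_eq_mul_integral (measurable_of_finite _).aestronglyMeasurable (measurable_of_finite _).aestronglyMeasurable
  subst hf' hg'
  exact this

lemma EX_indep {ι : Type*} [DecidableEq ι] (I : Finset ι) (T : ι → Finset (Sym2 (Fin n)))
    (hT : ∀ i ∈ I, ∀ j ∈ I, i ≠ j → Disjoint (T i) (T j))
    (f : ι → (Sym2 (Fin n) → Bool) → ℝ) (hf : ∀ i ∈ I, DependsOn (f i) (T i : Set (Sym2 (Fin n)))) :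
    EX n p (fun ω => ∏ i ∈ I, f i ω) = ∏ i ∈ I, EX n p (f i) := by
  induction I using Finset.induction_on with
  | empty => simp [EX_const]
  | insert a I ha ih =>
    rw [Finset.prod_insert ha, ← ih (fun i hi j hj => hT i (Finset.mem_insert_of_mem hi) j (Finset.mem_insert_of_mem hj))
      (fun i hi => hf i (Finset.mem_insert_of_mem hi))]
    simp_rw [Finset.prod_insert ha]
    apply EX_indep_two (T a) (I.biUnion T)
    · rw [Finset.disjoint_biUnion_right]
      intro i hi
      exact hT a (Finset.mem_insert_self _ _) i (Finset.mem_insert_of_mem hi) (by rintro rfl; exact ha hi)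
    · exact hf a (Finset.mem_insert_self _ _)
    · intro x y hxy
      apply Finset.prod_congr rfl
      intro i hi
      apply hf i (Finset.mem_insert_of_mem hi)
      intro e he
      apply hxy
      simp only [Finset.coe_biUnion, Set.mem_iUnion]
      exact ⟨i, hi, he⟩

end

open SimpleGraph MeasureTheory Filter

lemma choose_le_exp (N k : ℕ) (hk : 1 ≤ k) : (N.choose k : ℝ) ≤ (Real.exp 1 * N / k) ^ k := by
  have h1 : (N.choose k : ℝ) ≤ (N:ℝ) ^ k / (k.factorial : ℝ) := Nat.choose_le_pow_div k N
  have h2 : (k:ℝ) ^ k / k.factorial ≤ Real.exp k := Real.pow_div_factorial_le_exp (k:ℝ) (by positivity) k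
  have hk' : (0:ℝ) < k := by exact_mod_cast hk
  refine h1.trans ?_
  have h3 : Real.exp (k:ℝ) = Real.exp 1 ^ k := by rw [← Real.exp_nat_mul]; simp
  rw [h3] at h2
  have hf : (0:ℝ) < k.factorial := by positivity
  rw [div_pow, mul_pow]
  rw [div_le_div_iff₀ hf (by positivity)]
  rw [div_le_iff₀ hf] at h2
  have : (0:ℝ) ≤ (N:ℝ)^k := by positivity
  nlinarith [mul_le_mul_of_nonneg_left h2 this]

lemma geom_le2 (ρ : ℝ) (h0 : 0 ≤ ρ) (h1 : ρ ≤ 1/2) (T : ℕ) : ∑ t ∈ Finset.Icc 1 T, ρ ^ t ≤ 2 * ρ := by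
  have : ∑ t ∈ Finset.Icc 1 T, ρ ^ t ≤ 2 * ρ - 2 * ρ ^ (T+1) := by
    induction T with
    | zero => simp
    | succ T ih =>
      rw [Finset.sum_Icc_succ_top (by omega)]
      have : ρ ^ (T+1+1) = ρ ^ (T+1) * ρ := pow_succ _ _
      have h3 : 0 ≤ ρ ^ (T+1) := by positivity
      nlinarith
  have h3 : 0 ≤ ρ ^ (T+1) := by positivity
  linarith

section
variable {n : ℕ} {p : ℝ} [hp : Fact (p ∈ Set.Icc (0:ℝ) 1)]

lemma Pr_EV (α : ℝ) (hα : 1 ≤ α) (T : ℕ) (ρ : ℝ) (h0 : 0 ≤ ρ) (h1 : ρ ≤ 1/2)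
    (hb : ∀ t : ℕ, 1 ≤ t → t ≤ T → Real.exp 1 * t * p / α ≤ 1 ∧
      Real.exp 1 * n / t * (Real.exp 1 * t * p / α) ^ α ≤ ρ) :
    Pr n p (fun ω => ∃ W : Finset (Fin n), W.Nonempty ∧ W.card ≤ T ∧ ∃ F, EdgesIn (graphOf ω) W F ∧
      α * W.card ≤ F.card) ≤ 2 * ρ := by
  have hp0 := hp.out.1
  have hα0 : 0 < α := by linarith
  have hstep : Pr n p (fun ω => ∃ W : Finset (Fin n), W.Nonempty ∧ W.card ≤ T ∧ ∃ F, EdgesIn (graphOf ω) W F ∧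
      α * W.card ≤ F.card) ≤ Pr n p (fun ω => ∃ t ∈ Finset.Icc 1 T, ∃ W ∈ Finset.powersetCard t (Finset.univ : Finset (Fin n)),
        ∃ F ∈ Finset.powersetCard ⌈α * t⌉₊ W.sym2, ∀ e ∈ F, ω e = true) := by
    apply Pr_mono
    rintro ω ⟨W, hW, hWT, F, hF, hc⟩
    refine ⟨W.card, Finset.mem_Icc.mpr ⟨hW.card_pos, hWT⟩, W, by simp, ?_⟩
    obtain ⟨F', hF', hcard⟩ := Finset.exists_subset_card_eq (Nat.ceil_le.mpr hc)
    refine ⟨F', Finset.mem_powersetCard.mpr ⟨?_, hcard⟩, ?_⟩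
    · intro e he
      rw [Finset.mem_sym2_iff]
      exact (hF e (hF' he)).2
    · intro e he
      have := (hF e (hF' he)).1
      induction e with | _ a b => 
      exact this.2
  refine hstep.trans ((Pr_ex _ _).trans ?_)
  refine le_trans (Finset.sum_le_sum ?_) (geom_le2 ρ h0 h1 T)
  intro t ht
  rw [Finset.mem_Icc] at ht
  obtain ⟨hb1, hb2⟩ := hb t ht.1 ht.2
  have ht0 : (0:ℝ) < t := by exact_mod_cast ht.1
  set k := ⌈α * t⌉₊ with hk
  have hkα : α * t ≤ k := Nat.le_ceil _
  have hk1 : 1 ≤ k := by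
    rw [hk, Nat.one_le_ceil_iff]; positivity
  have hk0 : (0:ℝ) < k := by exact_mod_cast hk1
  set b := Real.exp 1 * t * p / α with hbdef
  have hb0 : 0 ≤ b := by positivity
  refine (Pr_ex_le _ _ ((b ^ α) ^ t) ?_).trans ?_
  · intro W hW
    have hWc : W.card = t := (Finset.mem_powersetCard.mp hW).2
    refine (Pr_ex_le _ _ (p ^ k) ?_).trans ?_
    · intro F hF
      rw [← (Finset.mem_powersetCard.mp hF).2]
      exact Pr_all_le F
    · rw [Finset.card_powersetCard]
      have hM : W.sym2.card ≤ t ^ 2 := by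
        rw [Finset.card_sym2, hWc, Nat.choose_two_right]
        apply Nat.div_le_of_le_mul
        simp only [Nat.add_sub_cancel]
        nlinarith [ht.1]
      have e1 : ((W.sym2.card.choose k : ℕ) : ℝ) ≤ (Real.exp 1 * (t:ℝ)^2 / k) ^ k := by
        refine le_trans (by exact_mod_cast Nat.choose_le_choose k hM) (le_trans (choose_le_exp (t^2) k hk1) ?_)
        push_cast; exact le_rfl
      calc ((W.sym2.card.choose k : ℕ) : ℝ) * p ^ k ≤ (Real.exp 1 * (t:ℝ)^2 / k) ^ k * p ^ k := by gcongr
        _ = (Real.exp 1 * (t:ℝ)^2 * p / k) ^ k := by rw [← mul_pow]; congr 1; ring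
        _ ≤ b ^ k := by
            gcongr
            rw [hbdef, div_le_div_iff₀ hk0 hα0]
            have : 0 ≤ Real.exp 1 * t * p := by positivity
            nlinarith [mul_le_mul_of_nonneg_left hkα this]
        _ = b ^ (k:ℝ) := by rw [Real.rpow_natCast]
        _ ≤ b ^ (α * t) := Real.rpow_le_rpow_of_exponent_ge' hb0 hb1 (by positivity) hkα
        _ = (b ^ α) ^ t := by rw [Real.rpow_mul hb0, Real.rpow_natCast]
  · rw [Finset.card_powersetCard, Finset.card_univ, Fintype.card_fin]
    calc ((n.choose t : ℕ) : ℝ) * (b ^ α) ^ t ≤ (Real.exp 1 * n / t) ^ t * (b ^ α) ^ t := by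
          gcongr; exact choose_le_exp n t ht.1
      _ = (Real.exp 1 * n / t * b ^ α) ^ t := by rw [mul_pow]
      _ ≤ ρ ^ t := by gcongr

lemma Pr_noexp (N : ℕ) :
    Pr n p (fun ω => ¬ ∀ X Y : Finset (Fin n), N < X.card → N < Y.card → Disjoint X Y →
      ∃ x ∈ X, ∃ y ∈ Y, (graphOf ω).Adj x y) ≤ Real.exp (n * Real.log 4 - p * (N:ℝ) ^ 2) := by
  have hp0 := hp.out.1
  have hp1 := hp.out.2
  have hstep : Pr n p (fun ω => ¬ ∀ X Y : Finset (Fin n), N < X.card → N < Y.card → Disjoint X Y →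
      ∃ x ∈ X, ∃ y ∈ Y, (graphOf ω).Adj x y) ≤ Pr n p (fun ω => ∃ XY ∈ (Finset.univ : Finset (Finset (Fin n) × Finset (Fin n))).filter
        (fun XY => N < XY.1.card ∧ N < XY.2.card ∧ Disjoint XY.1 XY.2),
        (∀ e ∈ (∅ : Finset (Sym2 (Fin n))), ω e = true) ∧ ∀ e ∈ (XY.1 ×ˢ XY.2).image (fun q => s(q.1, q.2)), ω e = false) := by
    apply Pr_mono
    intro ω h
    push Not at h
    obtain ⟨X, Y, hX, hY, hd, h⟩ := h
    refine ⟨(X, Y), by simp [hX, hY, hd], by simp, ?_⟩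
    intro e he
    simp only [Finset.mem_image, Finset.mem_product] at he
    obtain ⟨⟨x, y⟩, ⟨hx, hy⟩, rfl⟩ := he
    have h2 := h x hx y hy
    have hne : x ≠ y := fun hxy => (Finset.disjoint_left.mp hd) hx (hxy ▸ hy)
    by_contra h3
    exact h2 ⟨hne, by simpa using h3⟩
  refine hstep.trans ((Pr_ex_le _ _ (Real.exp (- p * (N:ℝ)^2)) ?_).trans ?_)
  · rintro ⟨X, Y⟩ hXY
    simp only [Finset.mem_filter, Finset.mem_univ, true_and] at hXY
    obtain ⟨hX, hY, hd⟩ := hXY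
    refine (Pr_box_le _ _ (by simp)).trans ?_
    have hc : ((X ×ˢ Y).image (fun q => s(q.1, q.2))).card = X.card * Y.card := by
      rw [Finset.card_image_of_injOn, Finset.card_product]
      rintro ⟨a, b⟩ hab ⟨c, d⟩ hcd h
      simp only [Finset.coe_product, Set.mem_prod, Finset.mem_coe] at hab hcd
      simp only [Sym2.eq_iff] at h
      rcases h with h | h
      · exact Prod.ext h.1 h.2
      · exact absurd hcd.2 ((Finset.disjoint_left.mp hd) (h.1 ▸ hab.1))
    simp only [hc, Finset.card_empty, pow_zero, one_mul]
    have h1 : (1 - p) ^ (X.card * Y.card) ≤ (1 - p) ^ (N ^ 2) :=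
      pow_le_pow_of_le_one (by linarith) (by linarith) (by nlinarith)
    refine h1.trans ?_
    have h2 : 1 - p ≤ Real.exp (-p) := by linarith [Real.add_one_le_exp (-p)]
    refine (pow_le_pow_left₀ (by linarith) h2 _).trans ?_
    rw [← Real.exp_nat_mul]
    push_cast
    rw [mul_comm]
  · have hc : (((Finset.univ : Finset (Finset (Fin n) × Finset (Fin n))).filter
        (fun XY => N < XY.1.card ∧ N < XY.2.card ∧ Disjoint XY.1 XY.2)).card : ℝ) ≤ 4 ^ n := by
      have : ((Finset.univ : Finset (Finset (Fin n) × Finset (Fin n))).filter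
        (fun XY => N < XY.1.card ∧ N < XY.2.card ∧ Disjoint XY.1 XY.2)).card ≤ 4 ^ n := by
        refine (Finset.card_filter_le _ _).trans ?_
        rw [Finset.card_univ, Fintype.card_prod, Fintype.card_finset, Fintype.card_fin, ← mul_pow]; norm_num
      exact_mod_cast this
    refine (mul_le_mul_of_nonneg_right hc (Real.exp_pos _).le).trans ?_
    have : (4:ℝ) ^ n = Real.exp (n * Real.log 4) := by
      rw [Real.exp_nat_mul, Real.exp_log (by norm_num)]
    rw [this, ← Real.exp_add]
    apply le_of_eq; congr 1; ring
end

open SimpleGraph MeasureTheory Filter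

def cl {n : ℕ} (h : ℕ) (u : Fin n) : ℕ := u.val / (2 * h)
def sg {n : ℕ} (h : ℕ) (u : Fin n) : ZMod 2 := if u.val % (2 * h) < h then 0 else 1

def GoodC {n : ℕ} (h : ℕ) (v : Fin n) (i : ℕ) (ω : Sym2 (Fin n) → Bool) : Prop :=
  ∃ a b : Fin n, (graphOf ω).Adj v a ∧ (graphOf ω).Adj v b ∧ cl h a = i ∧ cl h b = i ∧ sg h a = 0 ∧ sg h b = 1 ∧
    (∀ u, cl h u = cl h a → ¬ (graphOf ω).Adj a u) ∧ (∀ u, cl h u = cl h b → ¬ (graphOf ω).Adj b u)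

open Classical in
noncomputable def goodSet {n : ℕ} (h : ℕ) (v : Fin n) (ω : Sym2 (Fin n) → Bool) : Finset ℕ :=
  ((Finset.range (n / (2 * h))).erase (cl h v)).filter (fun i => GoodC h v i ω)

section
variable {n : ℕ} {p : ℝ} [hp : Fact (p ∈ Set.Icc (0:ℝ) 1)]

lemma cl_card (h : ℕ) (hh : 1 ≤ h) (i : ℕ) : (Finset.univ.filter (fun u : Fin n => cl h u = i)).card ≤ 2 * h := by
  have : (Finset.Ico (2*h*i) (2*h*i+2*h)).card = 2 * h := by simp
  rw [← this]
  apply Finset.card_le_card_of_injOn (fun u => u.val)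
  · intro u hu
    rw [Finset.mem_coe, Finset.mem_filter] at hu
    replace hu := hu.2
    unfold cl at hu
    simp only [Finset.coe_Ico, Set.mem_Ico]
    have h1 := Nat.div_add_mod u.val (2*h)
    have h2 := Nat.mod_lt u.val (show 0 < 2*h by omega)
    rw [hu] at h1
    omega
  · intro a _ b _ hab
    exact Fin.ext hab

lemma sg_card (h : ℕ) (hh : 1 ≤ h) (i : ℕ) (hi : i < n / (2*h)) (j : ℕ) (hj : j < 2) :
    h ≤ (Finset.univ.filter (fun u : Fin n => cl h u = i ∧ sg h u = (j : ZMod 2))).card := by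
  have hlt : 2*h*i + 2*h ≤ n := by
    have := Nat.mul_le_of_le_div (2*h) (i+1) n hi
    nlinarith
  have hj' : j * h + h ≤ 2 * h := by nlinarith
  let f : ℕ → Fin n := fun k => if hk : 2*h*i + (j*h + k) < n then ⟨2*h*i + (j*h+k), hk⟩ else ⟨0, by omega⟩
  have hf : ∀ k < h, (f k).val = 2*h*i + (j*h+k) := by
    intro k hk
    have : 2*h*i + (j*h + k) < n := by omega
    simp [f, this]
  have : (Finset.range h).card = h := by simp
  conv_lhs => rw [← this]
  apply Finset.card_le_card_of_injOn f
  · intro k hk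
    simp only [Finset.coe_range, Set.mem_Iio] at hk
    rw [Finset.mem_coe, Finset.mem_filter]
    refine ⟨Finset.mem_univ _, ?_⟩
    unfold cl sg
    rw [hf k hk]
    have hm : (2*h*i + (j*h+k)) % (2*h) = j*h+k := by
      rw [Nat.mul_add_mod, Nat.mod_eq_of_lt (by omega)]
    constructor
    · rw [Nat.mul_add_div (by omega), Nat.div_eq_of_lt (by omega)]; rfl
    · rw [hm]
      interval_cases j
      · simp; omega
      · simp
  · intro a ha b hb hab
    simp only [Finset.coe_range, Set.mem_Iio] at ha hb
    have := congrArg Fin.val hab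
    rw [hf a ha, hf b hb] at this
    omega

lemma good_prob (h : ℕ) (hh : 1 ≤ h) (v : Fin n) (i : ℕ) (hi : i < n / (2*h)) (hiv : i ≠ cl h v) :
    (h:ℝ)^2 * (p^2 * (1-p)^(6*h)) ≤ Pr n p (GoodC h v i) := by
  classical
  have hp0 := hp.out.1
  have hp1 := hp.out.2
  set U := Finset.univ.filter (fun u : Fin n => cl h u = i) with hU
  set A := Finset.univ.filter (fun u : Fin n => cl h u = i ∧ sg h u = ((0:ℕ) : ZMod 2)) with hA
  set B := Finset.univ.filter (fun u : Fin n => cl h u = i ∧ sg h u = ((1:ℕ) : ZMod 2)) with hB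
  let F : Fin n × Fin n → Finset (Sym2 (Fin n)) := fun q => {s(v, q.1), s(v, q.2)}
  let S : Fin n × Fin n → Finset (Sym2 (Fin n)) := fun q => ((U.erase q.1).erase q.2).image (fun u => s(v,u)) ∪
    (U.image (fun u => s(q.1, u)) ∪ U.image (fun u => s(q.2, u)))
  have hvU : v ∉ U := by simp [hU, Ne.symm hiv]
  have hUv : ∀ u ∈ U, u ≠ v := fun u hu huv => hvU (huv ▸ hu)
  have hAU : ∀ a ∈ A, a ∈ U := by intro a ha; simp [hA, hU] at ha ⊢; exact ha.1
  have hBU : ∀ a ∈ B, a ∈ U := by intro a ha; simp [hB, hU] at ha ⊢; exact ha.1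
  have hAB : ∀ a ∈ A, ∀ b ∈ B, a ≠ b := by
    rintro a ha b hb rfl
    simp [hA, hB] at ha hb
    have := ha.2.symm.trans hb.2
    exact absurd this (by decide)
  -- box probability
  have hbox : ∀ q ∈ A ×ˢ B, p^2 * (1-p)^(6*h) ≤
      Pr n p (fun ω => (∀ e ∈ F q, ω e = true) ∧ ∀ e ∈ S q, ω e = false) := by
    rintro ⟨a, b⟩ hq
    rw [Finset.mem_product] at hq
    obtain ⟨ha, hb⟩ := hq
    simp only at ha hb
    have hab := hAB a ha b hb
    have hav := hUv a (hAU a ha)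
    have hbv := hUv b (hBU b hb)
    rw [Pr_box_eq]
    · have hF : (F (a,b)).card = 2 := by
        simp only [F]
        rw [Finset.card_pair]
        intro he
        simp only [Sym2.eq_iff] at he
        rcases he with he | he
        · exact hab he.2
        · exact hbv he.1.symm
      have hS : (S (a,b)).card ≤ 6 * h := by
        have hUc : U.card ≤ 2 * h := cl_card h hh i
        have h1 : ((U.erase a).erase b).card ≤ U.card := Finset.card_le_card ((Finset.erase_subset _ _).trans (Finset.erase_subset _ _))
        simp only [S]
        refine (Finset.card_union_le _ _).trans ?_
        have h2 := Finset.card_union_le (U.image (fun u => s(a, u))) (U.image (fun u => s(b, u)))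
        have h3 : (((U.erase a).erase b).image (fun u => s(v,u))).card ≤ _ := Finset.card_image_le
        have h4 : (U.image (fun u => s(a,u))).card ≤ _ := Finset.card_image_le
        have h5 : (U.image (fun u => s(b,u))).card ≤ _ := Finset.card_image_le
        omega
      rw [hF]
      apply mul_le_mul_of_nonneg_left _ (by positivity)
      exact pow_le_pow_of_le_one (by linarith) (by linarith) hS
    · rw [Finset.disjoint_left]
      intro e he hS
      have haU := hAU a ha
      have hbU := hBU b hb
      have key : ∀ x, (x = a ∨ x = b) → e ≠ s(v,x) := by
        rintro x hx rfl
        simp only [S, Finset.mem_union, Finset.mem_image, Finset.mem_erase] at hS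
        rcases hS with ⟨u, hu, he2⟩ | ⟨u, hu, he2⟩ | ⟨u, hu, he2⟩ <;> simp only [Sym2.eq_iff] at he2 <;> clear he
        · rcases he2 with he | he
          · rcases hx with rfl | rfl
            · exact hu.2.1 he.2
            · exact hu.1 he.2
          · exact hvU (he.2 ▸ hu.2.2)
        · rcases he2 with he | he
          · exact hav he.1
          · exact hvU (he.2 ▸ hu)
        · rcases he2 with he | he
          · exact hbv he.1
          · exact hvU (he.2 ▸ hu)
      simp only [F, Finset.mem_insert, Finset.mem_singleton] at he
      rcases he with he | he
      · exact key a (Or.inl rfl) he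
      · exact key b (Or.inr rfl) he
  have hsum : ∑ q ∈ A ×ˢ B, Pr n p (fun ω => (∀ e ∈ F q, ω e = true) ∧ ∀ e ∈ S q, ω e = false) ≤ Pr n p (GoodC h v i) := by
    rw [Pr_eq_EX (GoodC h v i)]
    simp_rw [Pr_eq_EX]
    rw [← EX_sum]
    apply EX_mono
    intro ω
    rw [← Finset.sum_filter, Finset.sum_const, nsmul_eq_mul, mul_one]
    have hone : ((A ×ˢ B).filter (fun q => (∀ e ∈ F q, ω e = true) ∧ ∀ e ∈ S q, ω e = false)).card ≤ 1 := by
      rw [Finset.card_le_one]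
      rintro ⟨a, b⟩ hq ⟨a', b'⟩ hq'
      simp only [Finset.mem_filter, Finset.mem_product] at hq hq'
      obtain ⟨⟨ha, hb⟩, hF, hS⟩ := hq
      obtain ⟨⟨ha', hb'⟩, hF', hS'⟩ := hq'
      have key : ∀ x ∈ U, ω s(v,x) = true → x = a ∨ x = b := by
        intro x hx hω
        by_contra hne
        push Not at hne
        have : ω s(v,x) = false := by
          apply hS
          simp only [S, Finset.mem_union, Finset.mem_image, Finset.mem_erase]
          exact Or.inl ⟨x, ⟨hne.2, hne.1, hx⟩, rfl⟩
        rw [this] at hω; exact absurd hω (by decide)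
      have k1 := key a' (hAU _ ha') (hF' _ (by simp [F]))
      have k2 := key b' (hBU _ hb') (hF' _ (by simp [F]))
      have n1 : a' ≠ b := hAB a' ha' b hb
      have n2 : b' ≠ a := (hAB a ha b' hb').symm
      simp only [Prod.mk.injEq]
      exact ⟨(k1.resolve_right n1).symm, (k2.resolve_left n2).symm⟩
    split_ifs with hG
    · exact_mod_cast hone
    · have : (A ×ˢ B).filter (fun q => (∀ e ∈ F q, ω e = true) ∧ ∀ e ∈ S q, ω e = false) = ∅ := by
        rw [Finset.filter_eq_empty_iff]
        rintro ⟨a, b⟩ hq ⟨hF, hS⟩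
        rw [Finset.mem_product] at hq
        obtain ⟨ha, hb⟩ := hq
        simp only at ha hb
        apply hG
        have ha2 := ha; have hb2 := hb
        simp only [hA, hB, Finset.mem_filter, Finset.mem_univ, true_and] at ha2 hb2
        refine ⟨a, b, ⟨(hUv a (hAU a ha)).symm, hF _ (by simp [F])⟩, ⟨(hUv b (hBU b hb)).symm, hF _ (by simp [F])⟩,
          ha2.1, hb2.1, by simpa using ha2.2, by simpa using hb2.2, ?_, ?_⟩
        · intro u hu hadj
          have : ω s(a,u) = false := by
            apply hS
            simp only [S, Finset.mem_union, Finset.mem_image]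
            exact Or.inr (Or.inl ⟨u, by simp [hU, hu, ha2.1], rfl⟩)
          have h2 := hadj.2
          rw [this] at h2; exact absurd h2 (by decide)
        · intro u hu hadj
          have : ω s(b,u) = false := by
            apply hS
            simp only [S, Finset.mem_union, Finset.mem_image]
            exact Or.inr (Or.inr ⟨u, by simp [hU, hu, hb2.1], rfl⟩)
          have h2 := hadj.2
          rw [this] at h2; exact absurd h2 (by decide)
      rw [this]; simp
  refine le_trans ?_ hsum
  refine le_trans ?_ (Finset.card_nsmul_le_sum _ _ _ hbox)
  rw [nsmul_eq_mul, Finset.card_product]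
  have cA : h ≤ A.card := sg_card h hh i hi 0 (by norm_num)
  have cB : h ≤ B.card := sg_card h hh i hi 1 (by norm_num)
  have hnn : 0 ≤ p^2 * (1-p)^(6*h) := mul_nonneg (by positivity) (pow_nonneg (by linarith) _)
  apply mul_le_mul_of_nonneg_right _ hnn
  have : h ^ 2 ≤ A.card * B.card := by rw [sq]; exact Nat.mul_le_mul cA cB
  exact_mod_cast this

/-- exponential-moment lower tail for the number of good classes -/
lemma good_tail (h : ℕ) (hh : 1 ≤ h) (v : Fin n) (c0 : ℝ) (hc0 : 0 ≤ c0)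
    (hc : c0 ≤ (h:ℝ)^2 * (p^2 * (1-p)^(6*h))) (x : ℝ) :
    Pr n p (fun ω => ((goodSet h v ω).card : ℝ) < x) ≤
      Real.exp (x - c0 / 2 * (((n / (2*h) : ℕ) : ℝ) - 1)) := by
  classical
  set I := (Finset.range (n / (2 * h))).erase (cl h v) with hI
  let f : ℕ → (Sym2 (Fin n) → Bool) → ℝ := fun i ω => if GoodC h v i ω then 1/2 else 1
  let T : ℕ → Finset (Sym2 (Fin n)) := fun i => Finset.univ.filter (fun e => (∃ u, cl h u = i ∧ u ∈ e) ∧ ∀ x ∈ e, x = v ∨ cl h x = i)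
  have hprod : EX n p (fun ω => ∏ i ∈ I, f i ω) = ∏ i ∈ I, EX n p (f i) := by
    apply EX_indep I T
    · intro i hi j hj hij
      rw [Finset.disjoint_left]
      intro e he he'
      simp only [T, Finset.mem_filter, Finset.mem_univ, true_and] at he he'
      obtain ⟨u, hu, hue⟩ := he.1
      rcases he'.2 u hue with rfl | h2
      · rw [hI, Finset.mem_erase] at hi
        exact hi.1 hu.symm
      · exact hij (hu.symm.trans h2)
    · intro i hi ω ω' hω
      have key : ∀ ω ω' : Sym2 (Fin n) → Bool, (∀ e ∈ (T i : Set (Sym2 (Fin n))), ω e = ω' e) → GoodC h v i ω → GoodC h v i ω' := by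
        rintro ω ω' hω ⟨a, b, h1, h2, h3, h4, h5, h6, h7, h8⟩
        have hv : ∀ a, cl h a = i → ω s(v,a) = ω' s(v,a) := by
          intro a ha
          apply hω
          simp only [T, Finset.coe_filter, Finset.mem_univ, true_and, Set.mem_ofPred_eq]
          refine ⟨⟨a, ha, by simp⟩, ?_⟩
          intro x hx
          rw [Sym2.mem_iff] at hx
          rcases hx with rfl | rfl
          · exact Or.inl rfl
          · exact Or.inr ha
        have hin : ∀ a u, cl h a = i → cl h u = i → ω s(a,u) = ω' s(a,u) := by
          intro a u ha hu
          apply hω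
          simp only [T, Finset.coe_filter, Finset.mem_univ, true_and, Set.mem_ofPred_eq]
          refine ⟨⟨a, ha, by simp⟩, ?_⟩
          intro x hx
          rw [Sym2.mem_iff] at hx
          rcases hx with rfl | rfl
          · exact Or.inr ha
          · exact Or.inr hu
        refine ⟨a, b, ⟨h1.1, (hv a h3) ▸ h1.2⟩, ⟨h2.1, (hv b h4) ▸ h2.2⟩, h3, h4, h5, h6, ?_, ?_⟩
        · intro u hu hadj
          exact h7 u hu ⟨hadj.1, (hin a u h3 (hu.trans h3)) ▸ hadj.2⟩
        · intro u hu hadj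
          exact h8 u hu ⟨hadj.1, (hin b u h4 (hu.trans h4)) ▸ hadj.2⟩
      have : GoodC h v i ω ↔ GoodC h v i ω' := ⟨key ω ω' hω, key ω' ω (fun e he => (hω e he).symm)⟩
      simp only [f, this]
  have hE : ∀ i ∈ I, EX n p (f i) ≤ Real.exp (-c0/2) := by
    intro i hi
    rw [hI, Finset.mem_erase, Finset.mem_range] at hi
    have hg := hc.trans (good_prob (p := p) h hh v i hi.2 hi.1)
    have : EX n p (f i) = 1 + (-1/2) * Pr n p (GoodC h v i) := by
      rw [Pr_eq_EX, ← EX_mul_left, ← EX_const (n := n) (p := p) 1, ← EX_add, EX_const]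
      congr 1
      funext ω
      simp only [f]
      split_ifs <;> norm_num
    rw [this]
    have := Real.add_one_le_exp (-c0/2)
    linarith
  have hcard : ((n / (2*h) : ℕ) : ℝ) - 1 ≤ I.card := by
    have : n / (2*h) - 1 ≤ I.card := by
      have := Finset.pred_card_le_card_erase (s := Finset.range (n / (2 * h))) (a := cl h v)
      simpa using this
    have h3 : n / (2*h) ≤ I.card + 1 := by omega
    have : ((n / (2*h) : ℕ) : ℝ) ≤ I.card + 1 := by exact_mod_cast h3
    linarith
  have hEX0 : ∀ i, 0 ≤ EX n p (f i) := by
    intro i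
    rw [← EX_const (n := n) (p := p) 0]
    apply EX_mono
    intro ω; simp only [f]; split_ifs <;> norm_num
  have hle : Pr n p (fun ω => ((goodSet h v ω).card : ℝ) < x) ≤ EX n p (fun ω => Real.exp x * ∏ i ∈ I, f i ω) := by
    apply Pr_le_EX
    · intro ω
      apply mul_nonneg (Real.exp_pos _).le
      apply Finset.prod_nonneg
      intro i _; simp only [f]; split_ifs <;> norm_num
    · intro ω hω
      have hpr : ∏ i ∈ I, f i ω = (1/2:ℝ) ^ (goodSet h v ω).card := by
        simp only [f]
        rw [Finset.prod_ite]
        simp only [Finset.prod_const, one_pow, mul_one]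
        rfl
      rw [hpr]
      have h1 : Real.exp (-1) ≤ 1/2 := by
        rw [Real.exp_neg, one_div]
        apply inv_anti₀ (by norm_num)
        have := Real.add_one_le_exp (1:ℝ); linarith
      have h2 : Real.exp (-1) ^ (goodSet h v ω).card ≤ (1/2:ℝ) ^ (goodSet h v ω).card :=
        pow_le_pow_left₀ (Real.exp_pos _).le h1 _
      refine le_trans ?_ (mul_le_mul_of_nonneg_left h2 (Real.exp_pos _).le)
      rw [← Real.exp_nat_mul, ← Real.exp_add]
      apply Real.one_le_exp
      linarith
  refine hle.trans ?_
  rw [EX_mul_left, hprod]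
  rw [sub_eq_add_neg, Real.exp_add]
  apply mul_le_mul_of_nonneg_left _ (Real.exp_pos _).le
  refine (Finset.prod_le_prod (fun i _ => hEX0 i) hE).trans ?_
  rw [Finset.prod_const, ← Real.exp_nat_mul]
  apply Real.exp_le_exp.mpr
  nlinarith
end

open SimpleGraph MeasureTheory Filter

noncomputable def kc0 : ℝ := Real.exp (-48000)
noncomputable def kc1 : ℝ := kc0 / 32
noncomputable def kc2 : ℝ := kc1 / 40
noncomputable def hh (p : ℝ) : ℕ := ⌈1 / p⌉₊

lemma kc0_pos : 0 < kc0 := Real.exp_pos _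
lemma kc1_pos : 0 < kc1 := div_pos kc0_pos (by norm_num)
lemma kc2_pos : 0 < kc2 := div_pos kc1_pos (by norm_num)
lemma kc1_lt : kc1 < 1 := by
  have : kc0 < 1 := by unfold kc0; rw [← Real.exp_zero]; exact Real.exp_lt_exp.mpr (by norm_num)
  unfold kc1; linarith

section
variable {n : ℕ} {p : ℝ} [hp : Fact (p ∈ Set.Icc (0:ℝ) 1)]

lemma good_tail' (hp0 : 0 < p) (hpq : p ≤ 1 - 1/4000) (hnp : 16 ≤ n * p) (v : Fin n) :
    Pr n p (fun ω => ((goodSet (hh p) v ω).card : ℝ) < kc1 * (n * p)) ≤ Real.exp (-(kc1 * (n * p))) := by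
  have h1 : 1 / p ≤ hh p := Nat.le_ceil _
  have h2 : (hh p : ℝ) < 1 / p + 1 := Nat.ceil_lt_add_one (by positivity)
  have h1' : 1 ≤ hh p * p := by rwa [div_le_iff₀ hp0] at h1
  have h2' : hh p * p ≤ 2 := by
    have := mul_lt_mul_of_pos_right h2 hp0
    rw [add_mul, div_mul_cancel₀ _ hp0.ne'] at this
    linarith [hp.out.2]
  have hh1 : 1 ≤ hh p := by
    unfold hh; rw [Nat.one_le_ceil_iff]; positivity
  have hc : kc0 ≤ (hh p:ℝ)^2 * (p^2 * (1-p)^(6*hh p)) := by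
    have e1 : Real.exp (-(4000*p)) ≤ 1 - p := by
      have hq : 0 < 1 - p := by linarith
      rw [Real.exp_neg, inv_le_comm₀ (Real.exp_pos _) hq]
      have := Real.add_one_le_exp (4000*p)
      refine le_trans ?_ this
      rw [inv_le_iff_one_le_mul₀ hq]
      nlinarith
    have e2 : kc0 ≤ (1-p)^(6*hh p) := by
      refine le_trans ?_ (pow_le_pow_left₀ (Real.exp_pos _).le e1 _)
      rw [← Real.exp_nat_mul]
      apply Real.exp_le_exp.mpr
      push_cast
      nlinarith
    have e3 : (hh p:ℝ)^2 * (p^2 * (1-p)^(6*hh p)) = (hh p * p)^2 * (1-p)^(6*hh p) := by ring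
    rw [e3]
    have e4 : 1 ≤ (hh p * p)^2 := one_le_pow₀ h1'
    nlinarith [kc0_pos]
  refine (good_tail (hh p) hh1 v kc0 kc0_pos.le hc _).trans ?_
  apply Real.exp_le_exp.mpr
  have hK : n * p / 4 - 1 ≤ ((n / (2 * hh p) : ℕ) : ℝ) := by
    have h3 : (n:ℝ) / ((2 * hh p : ℕ):ℝ) - 1 ≤ ((n / (2 * hh p) : ℕ) : ℝ) := by
      have := Nat.lt_floor_add_one ((n:ℝ) / ((2 * hh p : ℕ):ℝ))
      rw [Nat.floor_div_eq_div] at this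
      linarith
    refine le_trans ?_ h3
    have : n * p / 4 ≤ (n:ℝ) / ((2 * hh p : ℕ):ℝ) := by
      have hpos : (0:ℝ) < ((2 * hh p : ℕ):ℝ) := by exact_mod_cast (by omega : 0 < 2 * hh p)
      rw [le_div_iff₀ hpos]
      push_cast
      have hn0 : (0:ℝ) ≤ n := by positivity
      nlinarith [mul_le_mul_of_nonneg_left h2' hn0]
    linarith
  have hk : kc1 = kc0 / 32 := rfl
  rw [hk]
  have := kc0_pos
  nlinarith
end

noncomputable def mm (n : ℕ) (p : ℝ) : ℕ := ⌈kc1 * (n * p)⌉₊ - 8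
noncomputable def NN (n : ℕ) : ℕ := ⌊kc2 * n⌋₊

def E2 (n : ℕ) (p : ℝ) (ω : Sym2 (Fin n) → Bool) : Prop :=
  ∀ W : Finset (Fin n), W.Nonempty → W.card ≤ NN n → ∀ F, EdgesIn (graphOf ω) W F → 2 * F.card < mm n p * W.card
def E3 (n : ℕ) (ω : Sym2 (Fin n) → Bool) : Prop :=
  ∀ X Y : Finset (Fin n), NN n < X.card → NN n < Y.card → Disjoint X Y → ∃ x ∈ X, ∃ y ∈ Y, (graphOf ω).Adj x y

lemma mm_bounds {n : ℕ} {p : ℝ} (h : 32 ≤ kc1 * (n*p)) : 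
    kc1 * (n*p) / 2 ≤ mm n p ∧ (mm n p + 8 = ⌈kc1 * (n * p)⌉₊) := by
  have h1 : 9 ≤ ⌈kc1 * (n * p)⌉₊ := by
    have : (9:ℝ) ≤ ⌈kc1 * (n * p)⌉₊ := le_trans (by linarith) (Nat.le_ceil _)
    exact_mod_cast this
  have h2 : mm n p + 8 = ⌈kc1 * (n * p)⌉₊ := by unfold mm; omega
  refine ⟨?_, h2⟩
  have h3 : ((mm n p + 8 : ℕ) : ℝ) = ⌈kc1 * (n * p)⌉₊ := by rw [h2]
  push_cast at h3
  have := Nat.le_ceil (kc1 * (n * p))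
  linarith

lemma exp1_lt : Real.exp 1 < 3 := by have := Real.exp_one_lt_d9; linarith

lemma E3_small (ε : ℝ) (hε : 0 < ε) : ∃ M : ℝ, ∀ (n : ℕ) (p : ℝ) [Fact (p ∈ Set.Icc (0:ℝ) 1)],
    M ≤ n * p → Pr n p (fun ω => ¬ E3 n ω) ≤ ε := by
  have hlim : Tendsto (fun x : ℝ => Real.exp (-x)) atTop (nhds 0) := Real.tendsto_exp_neg_atTop_nhds_zero
  obtain ⟨M0, hM0⟩ := eventually_atTop.mp (hlim.eventually (ge_mem_nhds hε))
  refine ⟨max M0 (max (2/kc2) (4 * (Real.log 4 + 1) / kc2^2)), ?_⟩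
  intro n p hp hM
  have hk := kc2_pos
  have hp0 := hp.out.1
  have hp1 := hp.out.2
  have hn0 : (0:ℝ) ≤ n := by positivity
  have hnp : n * p ≤ n := by nlinarith
  have b0 := hM0 (n*p) ((le_max_left _ _).trans hM)
  have b1 : 2 / kc2 ≤ n * p := ((le_max_left _ _).trans (le_max_right _ _)).trans hM
  have b2 : 4 * (Real.log 4 + 1) / kc2^2 ≤ n * p := ((le_max_right _ _).trans (le_max_right _ _)).trans hM
  refine (Pr_noexp (NN n)).trans (le_trans (Real.exp_le_exp.mpr ?_) b0)
  have hN : kc2 * n / 2 ≤ NN n := by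
    have := Nat.lt_floor_add_one (kc2 * n)
    have h3 : 2 ≤ kc2 * n := by
      rw [div_le_iff₀ hk] at b1; nlinarith
    unfold NN; linarith
  rw [div_le_iff₀ (by positivity)] at b2
  have h4 : (kc2 * n / 2)^2 ≤ (NN n:ℝ)^2 := pow_le_pow_left₀ (by positivity) hN 2
  have h5 : p * (kc2 * n / 2)^2 ≤ p * (NN n:ℝ)^2 := mul_le_mul_of_nonneg_left h4 hp0
  have h6 : p * (kc2 * n / 2)^2 = n * (n * p * kc2^2) / 4 := by ring
  have h7 : n * (4 * (Real.log 4 + 1)) ≤ n * (n * p * kc2^2) := mul_le_mul_of_nonneg_left b2 hn0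
  nlinarith

lemma E2_small (ε : ℝ) (hε : 0 < ε) : ∃ M : ℝ, ∀ (n : ℕ) (p : ℝ) [Fact (p ∈ Set.Icc (0:ℝ) 1)],
    M ≤ n * p → Pr n p (fun ω => ¬ E2 n p ω) ≤ ε := by
  have hk := kc1_pos
  have he := exp1_lt
  have hlim : Tendsto (fun x : ℝ => 4 * Real.exp 1 ^ 2 / kc1 * Real.exp (-(kc1 / 4 * x - 1))) atTop (nhds 0) := by
    have h1 : Tendsto (fun x : ℝ => kc1 / 4 * x - 1) atTop atTop :=
      tendsto_atTop_add_const_right _ _ (Tendsto.const_mul_atTop (by positivity) tendsto_id)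
    have := (Real.tendsto_exp_neg_atTop_nhds_zero.comp h1).const_mul (4 * Real.exp 1 ^ 2 / kc1)
    simpa using this
  obtain ⟨M0, hM0⟩ := eventually_atTop.mp (hlim.eventually (ge_mem_nhds (show (0:ℝ) < min (ε/2) (1/2) by positivity)))
  refine ⟨max M0 (32/kc1), ?_⟩
  intro n p hp hM
  have hp0 := hp.out.1
  have b0 := hM0 (n*p) ((le_max_left _ _).trans hM)
  have b1 : 32 / kc1 ≤ n * p := (le_max_right _ _).trans hM
  rw [div_le_iff₀ hk] at b1
  have b2 : 32 ≤ kc1 * (n*p) := by linarith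
  obtain ⟨hm, _⟩ := mm_bounds b2
  set α : ℝ := (mm n p : ℝ) / 2 with hα
  have hα1 : kc1 * (n * p) / 4 ≤ α := by rw [hα]; linarith
  have hα0 : 1 ≤ α := by linarith
  have hnp : 0 < n * p := by
    by_contra h; push Not at h; nlinarith
  set ρ := 4 * Real.exp 1 ^ 2 / kc1 * Real.exp (-(kc1 / 4 * (n*p) - 1)) with hρ
  have hstep : Pr n p (fun ω => ¬ E2 n p ω) ≤ Pr n p (fun ω => ∃ W : Finset (Fin n), W.Nonempty ∧ W.card ≤ NN n ∧ ∃ F, EdgesIn (graphOf ω) W F ∧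
      α * W.card ≤ F.card) := by
    apply Pr_mono
    intro ω h
    unfold E2 at h
    push Not at h
    obtain ⟨W, hW, hWN, F, hF, hc⟩ := h
    refine ⟨W, hW, hWN, F, hF, ?_⟩
    have : ((mm n p * W.card : ℕ):ℝ) ≤ ((2 * F.card : ℕ):ℝ) := by exact_mod_cast hc
    push_cast at this
    rw [hα]; linarith
  refine hstep.trans ((Pr_EV α hα0 (NN n) ρ (by positivity) (b0.trans (min_le_right _ _)) ?_).trans ?_)
  · intro t ht1 htN
    have ht0 : (0:ℝ) < t := by exact_mod_cast ht1
    have htc : (t:ℝ) ≤ kc2 * n := le_trans (by exact_mod_cast htN) (Nat.floor_le (by have := kc2_pos; positivity))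
    set b := Real.exp 1 * t * p / α with hb
    have hb0 : 0 ≤ b := by positivity
    have hbe : b ≤ Real.exp (-1) := by
      rw [hb, div_le_iff₀ (by linarith), Real.exp_neg]
      have h1 : Real.exp 1 * t * p ≤ Real.exp 1 * (kc2 * n) * p := by gcongr
      have h2 : kc2 = kc1 / 40 := rfl
      have h3 : (Real.exp 1)⁻¹ * (kc1 * (n*p) / 4) ≤ (Real.exp 1)⁻¹ * α := by gcongr
      refine h1.trans (le_trans ?_ h3)
      rw [h2, inv_mul_eq_div, le_div_iff₀ (Real.exp_pos _)]
      have : Real.exp 1 * Real.exp 1 ≤ 10 := by nlinarith [Real.exp_pos 1]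
      have h5 : 0 ≤ kc1 * (n * p) := by positivity
      nlinarith [mul_le_mul_of_nonneg_right this h5]
    refine ⟨hbe.trans (Real.exp_le_one_iff.mpr (by norm_num)), ?_⟩
    have e1 : b ^ α ≤ b * Real.exp (-(kc1 / 4 * (n*p) - 1)) := by
      have : b ^ α = b * b ^ (α - 1) := by
        rcases eq_or_lt_of_le hb0 with h | h
        · rw [← h, Real.zero_rpow (by linarith)]; simp
        · rw [Real.rpow_sub h, Real.rpow_one]; field_simp
      rw [this]
      apply mul_le_mul_of_nonneg_left _ hb0
      calc b ^ (α - 1) ≤ (Real.exp (-1)) ^ (α - 1) := Real.rpow_le_rpow hb0 hbe (by linarith)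
        _ = Real.exp (-(α - 1)) := by rw [← Real.exp_mul]; congr 1; ring
        _ ≤ _ := Real.exp_le_exp.mpr (by linarith)
    calc Real.exp 1 * n / t * b ^ α ≤ Real.exp 1 * n / t * (b * Real.exp (-(kc1 / 4 * (n*p) - 1))) := by gcongr
      _ = (Real.exp 1 * n / t * b) * Real.exp (-(kc1 / 4 * (n*p) - 1)) := by ring
      _ ≤ ρ := by
        rw [hρ]
        apply mul_le_mul_of_nonneg_right _ (Real.exp_pos _).le
        have : Real.exp 1 * n / t * b = Real.exp 1 ^ 2 * (n * p) / α := by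
          rw [hb]; field_simp
        rw [this, div_le_div_iff₀ (by linarith) hk]
        have h5 : 0 ≤ Real.exp 1 ^ 2 := by positivity
        nlinarith [mul_le_mul_of_nonneg_left hα1 h5]
  · have := b0.trans (min_le_left _ _)
    linarith

open SimpleGraph MeasureTheory Filter

lemma legal_common {n : ℕ} {p : ℝ} (ω : Sym2 (Fin n) → Bool) (hnp : 32 ≤ kc1 * (n * p))
    (h2 : E2 n p ω) (h3 : E3 n ω) (B : Finset (Fin n)) (hBne : ∃ v, v ∉ B)
    (hgood : ∀ v, v ∉ B → kc1 * (n * p) ≤ (goodSet (hh p) v ω).card)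
    (hfew : ∀ v, v ∉ B → ∀ A : Finset (Fin n),
      (∀ a ∈ A, (graphOf ω).Adj v a ∧ (a ∈ B ∨ ∃ w ∈ B, (graphOf ω).Adj w a)) → A.card ≤ 8)
    (hpriv : ∃ (x y : Fin n → Fin n) (rk : Fin n → ℕ),
      (∀ v ∈ B, (graphOf ω).Adj v (x v)) ∧ (∀ v ∈ B, (graphOf ω).Adj v (y v)) ∧
      (∀ v ∈ B, ¬ (graphOf ω).Adj (x v) (y v)) ∧ (∀ v ∈ B, x v ≠ y v) ∧
      (∀ v ∈ B, ∀ w ∈ B, v ≠ w → x v ≠ x w ∧ x v ≠ y w ∧ y v ≠ y w) ∧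
      (∀ v ∈ B, rk (x v) < rk v) ∧ (∀ v ∈ B, rk (y v) < rk v)) :
    HasLegalSystem (graphOf ω) := by
  obtain ⟨x, y, rk, a1, a2, a3, a4, a5, a6, a7⟩ := hpriv
  obtain ⟨hm, hm8⟩ := mm_bounds hnp
  refine legal_of_attach (graphOf ω) (cl (hh p)) (sg (hh p)) B x y rk (mm n p) (NN n) ?_ hBne a1 a2 a3 a4 a5 a6 a7
    ?_ hfew h2 h3
  · have : (0:ℝ) < mm n p := by linarith
    exact_mod_cast this
  · intro v hv
    refine ⟨goodSet (hh p) v ω, ?_, ?_⟩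
    · rw [hm8]; exact Nat.ceil_le.mpr (hgood v hv)
    · intro i hi
      classical
      unfold goodSet at hi
      rw [Finset.mem_filter] at hi
      exact hi.2

lemma mid_regime (ε : ℝ) (hε : 0 < ε) : ∃ M : ℝ, ∀ (n : ℕ) (p : ℝ) [Fact (p ∈ Set.Icc (0:ℝ) 1)],
    p ≤ 1 - 1/4000 → M ≤ n * p → 2 / kc1 * Real.log n ≤ n * p →
    Pr n p (fun ω => ¬ HasLegalSystem (graphOf ω)) ≤ ε := by
  have hk := kc1_pos
  obtain ⟨M2, hM2⟩ := E2_small (ε/3) (by positivity)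
  obtain ⟨M3, hM3⟩ := E3_small (ε/3) (by positivity)
  have hlim : Tendsto (fun x : ℝ => Real.exp (-(kc1 / 2 * x))) atTop (nhds 0) :=
    Real.tendsto_exp_neg_atTop_nhds_zero.comp (Tendsto.const_mul_atTop (by positivity) tendsto_id)
  obtain ⟨M0, hM0⟩ := eventually_atTop.mp (hlim.eventually (ge_mem_nhds (show (0:ℝ) < ε/3 by positivity)))
  refine ⟨max (max M2 M3) (max M0 (max 16 (32/kc1))), ?_⟩
  intro n p hp hpq hM hlog
  have b2 := hM2 n p ((le_max_left _ _).trans ((le_max_left _ _).trans hM))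
  have b3 := hM3 n p ((le_max_right _ _).trans ((le_max_left _ _).trans hM))
  have hM' := (le_max_right _ _).trans hM
  have b0 := hM0 (n*p) ((le_max_left _ _).trans hM')
  have hM'' := (le_max_right _ _).trans hM'
  have b16 : 16 ≤ n * p := (le_max_left _ _).trans hM''
  have b32 : 32 / kc1 ≤ n * p := (le_max_right _ _).trans hM''
  rw [div_le_iff₀ hk] at b32
  have hp0 : 0 < p := by
    rcases eq_or_lt_of_le hp.out.1 with h | h
    · rw [← h] at b16; norm_num at b16
    · exact h
  have hn0 : 0 < n := by
    rcases Nat.eq_zero_or_pos n with h | h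
    · rw [h] at b16; norm_num at b16
    · exact h
  have hstep : Pr n p (fun ω => ¬ HasLegalSystem (graphOf ω)) ≤ Pr n p (fun ω => ¬ E2 n p ω ∨ (¬ E3 n ω ∨
      ∃ v ∈ (Finset.univ : Finset (Fin n)), ((goodSet (hh p) v ω).card : ℝ) < kc1 * (n * p))) := by
    apply Pr_mono
    intro ω
    contrapose!
    rintro ⟨h2, h3, hg⟩
    refine legal_common ω (by linarith) h2 h3 ∅ ⟨⟨0, hn0⟩, by simp⟩ (fun v _ => hg v (Finset.mem_univ _)) ?_ ?_
    · intro v _ A hA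
      have : A = ∅ := by
        rw [Finset.eq_empty_iff_forall_notMem]
        intro a ha
        have := (hA a ha).2
        simp at this
      simp [this]
    · exact ⟨id, id, fun _ => 0, by simp, by simp, by simp, by simp, by simp, by simp, by simp⟩
  refine hstep.trans (Pr_or.trans ?_)
  have h4 := Pr_or (n := n) (p := p) (A := fun ω => ¬ E3 n ω) (B := fun ω =>
      ∃ v ∈ (Finset.univ : Finset (Fin n)), ((goodSet (hh p) v ω).card : ℝ) < kc1 * (n * p))
  have h5 := Pr_ex_le (n := n) (p := p) Finset.univ (fun v ω => ((goodSet (hh p) v ω).card : ℝ) < kc1 * (n * p))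
    _ (fun v _ => good_tail' hp0 hpq b16 v)
  rw [Finset.card_univ, Fintype.card_fin] at h5
  have hn0' : (0:ℝ) < n := by exact_mod_cast hn0
  have h6 : (n:ℝ) * Real.exp (-(kc1 * (n * p))) ≤ Real.exp (-(kc1/2 * (n*p))) := by
    have : (n:ℝ) = Real.exp (Real.log n) := (Real.exp_log hn0').symm
    conv_lhs => rw [this]
    rw [← Real.exp_add]
    apply Real.exp_le_exp.mpr
    rw [← this]
    have h7 : Real.log n ≤ kc1 / 2 * (n * p) := by
      have := mul_le_mul_of_nonneg_left hlog (show 0 ≤ kc1/2 by positivity)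
      rw [← mul_assoc] at this
      have h8 : kc1 / 2 * (2 / kc1) = 1 := by field_simp
      rw [h8, one_mul] at this
      exact this
    linarith
  linarith

open SimpleGraph MeasureTheory Filter

section
variable {n : ℕ} {p : ℝ} [hp : Fact (p ∈ Set.Icc (0:ℝ) 1)]

lemma Pr_lows (W Lw : Finset (Fin n)) (hL : Lw ⊆ W) (F : Finset (Sym2 (Fin n))) (hF : ∀ e ∈ F, ∀ x ∈ e, x ∈ W)
    (z : ℝ) (hz0 : 0 ≤ z) (hz1 : z ≤ 1) :
    Pr n p (fun ω => (∀ e ∈ F, ω e = true) ∧ ∀ v ∈ Lw, Low (graphOf ω) v) * z ^ (10 * Lw.card) ≤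
      p ^ F.card * (1 - p * (1 - z)) ^ (Lw.card * (n - W.card)) := by
  classical
  set S := (Lw ×ˢ Wᶜ).image (fun q : Fin n × Fin n => s(q.1, q.2)) with hS
  have hinj : Set.InjOn (fun q : Fin n × Fin n => s(q.1, q.2)) (Lw ×ˢ Wᶜ : Finset _) := by
    rintro ⟨a, b⟩ hab ⟨c, d⟩ hcd h
    simp only [Finset.coe_product, Set.mem_prod, Finset.mem_coe, Finset.mem_compl] at hab hcd
    simp only [Sym2.eq_iff] at h
    rcases h with h | h
    · exact Prod.ext h.1 h.2
    · exact absurd (hL hab.1) (h.1 ▸ hcd.2)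
  have hScard : S.card = Lw.card * (n - W.card) := by
    rw [hS, Finset.card_image_of_injOn hinj, Finset.card_product, Finset.card_compl, Fintype.card_fin]
  have hd : Disjoint F S := by
    rw [Finset.disjoint_left]
    intro e he heS
    rw [hS, Finset.mem_image] at heS
    obtain ⟨⟨a, b⟩, hab, rfl⟩ := heS
    rw [Finset.mem_product, Finset.mem_compl] at hab
    exact hab.2 (hF _ he b (by simp))
  have h := Pr_low (p := p) F S hd (10 * Lw.card) z hz0 hz1
  rw [hScard] at h
  refine le_trans (mul_le_mul_of_nonneg_right (Pr_mono ?_) (by positivity)) h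
  rintro ω ⟨h1, h2⟩
  refine ⟨h1, ?_⟩
  have hsub : S.filter (fun e => ω e = true) ⊆ Lw.biUnion (fun v => (Wᶜ.filter (fun u => ω s(v,u) = true)).image (fun u => s(v,u))) := by
    intro e he
    rw [Finset.mem_filter, hS, Finset.mem_image] at he
    obtain ⟨⟨⟨a, b⟩, hab, rfl⟩, hω⟩ := he
    rw [Finset.mem_product] at hab
    rw [Finset.mem_biUnion]
    refine ⟨a, hab.1, ?_⟩
    rw [Finset.mem_image]
    exact ⟨b, Finset.mem_filter.mpr ⟨hab.2, hω⟩, rfl⟩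
  refine (Finset.card_le_card hsub).trans ?_
  rw [mul_comm]
  apply Finset.card_biUnion_le_card_mul
  intro v hv
  refine Finset.card_image_le.trans ?_
  apply h2 v hv
  intro a ha
  rw [Finset.mem_filter, Finset.mem_compl] at ha
  refine ⟨?_, ha.2⟩
  rintro rfl
  exact ha.1 (hL hv)

/-- combined bound -/
lemma Pr_lows' (W Lw : Finset (Fin n)) (hL : Lw ⊆ W) (hW : W.card ≤ 5) (F : Finset (Sym2 (Fin n)))
    (hF : ∀ e ∈ F, ∀ x ∈ e, x ∈ W) (C : ℝ)
    (hlog : 1 ≤ Real.log n) (h1 : Real.log n ≤ n * p) (h2 : n * p ≤ C * Real.log n) :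
    Pr n p (fun ω => (∀ e ∈ F, ω e = true) ∧ ∀ v ∈ Lw, Low (graphOf ω) v) ≤
      p ^ F.card * (Real.log n ^ 10 * Real.exp (5 + C) / n) ^ Lw.card := by
  have hp0 := hp.out.1
  have hp1 := hp.out.2
  set l := Real.log n with hl
  have hl0 : 0 < l := by linarith
  have hn0 : (0:ℝ) < n := by
    rcases Nat.eq_zero_or_pos n with h | h
    · rw [hl, h] at hlog; norm_num at hlog
    · exact_mod_cast h
  have hz0 : (0:ℝ) < 1 / l := by positivity
  have hz1 : 1 / l ≤ 1 := by rw [div_le_one hl0]; exact hlog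
  have h := Pr_lows (p := p) W Lw hL F hF (1/l) hz0.le hz1
  have hpz : p * (1 - 1/l) ≤ 1 := by nlinarith
  have e1 : (1 - p * (1 - 1/l)) ^ (n - W.card) ≤ Real.exp (5 + C) / n := by
    have a1 : 1 - p * (1 - 1/l) ≤ Real.exp (-(p * (1 - 1/l))) := by
      have := Real.add_one_le_exp (-(p * (1 - 1/l))); linarith
    refine (pow_le_pow_left₀ (by linarith) a1 _).trans ?_
    rw [← Real.exp_nat_mul]
    have : (n:ℝ) = Real.exp l := by rw [hl, Real.exp_log hn0]
    conv_rhs => rw [this]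
    rw [← Real.exp_sub]
    apply Real.exp_le_exp.mpr
    have a2 : (n:ℝ) - 5 ≤ ((n - W.card : ℕ):ℝ) := by
      have : n ≤ (n - W.card) + 5 := by omega
      have : (n:ℝ) ≤ ((n - W.card : ℕ):ℝ) + 5 := by exact_mod_cast this
      linarith
    have a3 : 0 ≤ p * (1 - 1/l) := mul_nonneg hp0 (by linarith)
    have a4 := mul_le_mul_of_nonneg_right a2 a3
    have a5 : n * p * (1/l) ≤ C := by
      rw [mul_one_div, div_le_iff₀ hl0]; exact h2
    have a6 : p * (1/l) ≥ 0 := by positivity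
    nlinarith
  have e2 : (1 - p * (1 - 1/l)) ^ (Lw.card * (n - W.card)) ≤ (Real.exp (5 + C) / n) ^ Lw.card := by
    rw [mul_comm Lw.card, pow_mul]
    exact pow_le_pow_left₀ (pow_nonneg (by linarith) _) e1 _
  have e3 : (1/l) ^ (10 * Lw.card) = ((l ^ 10) ^ Lw.card)⁻¹ := by
    rw [one_div, inv_pow, pow_mul]
  rw [e3] at h
  rw [← div_eq_mul_inv, div_le_iff₀ (by positivity)] at h
  refine h.trans ?_
  rw [mul_assoc, mul_div_assoc, mul_pow (l^10), mul_comm ((l^10)^Lw.card)]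
  gcongr

lemma Pr_deg1 (v : Fin n) (hn : 2 ≤ n) :
    Pr n p (fun ω => ¬ ∃ x y, x ≠ y ∧ (graphOf ω).Adj v x ∧ (graphOf ω).Adj v y) ≤
      (1 + n * p) * Real.exp (-(p * (n - 2))) := by
  classical
  have hp0 := hp.out.1
  have hp1 := hp.out.2
  have hexp : ∀ k : ℕ, (n:ℝ) - 2 ≤ k → (1 - p) ^ k ≤ Real.exp (-(p * (n - 2))) := by
    intro k hk
    have h2 : 1 - p ≤ Real.exp (-p) := by linarith [Real.add_one_le_exp (-p)]
    refine (pow_le_pow_left₀ (by linarith) h2 _).trans ?_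
    rw [← Real.exp_nat_mul]
    apply Real.exp_le_exp.mpr
    nlinarith
  have hinj : ∀ A : Finset (Fin n), (A.image (fun u => s(v,u))).card = A.card := by
    intro A
    apply Finset.card_image_of_injective
    intro a b hab
    exact Sym2.congr_right.mp hab
  have hstep : Pr n p (fun ω => ¬ ∃ x y, x ≠ y ∧ (graphOf ω).Adj v x ∧ (graphOf ω).Adj v y) ≤
     Pr n p (fun ω => ((∀ e ∈ (∅ : Finset (Sym2 (Fin n))), ω e = true) ∧ ∀ e ∈ (Finset.univ.erase v).image (fun u => s(v,u)), ω e = false) ∨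
      ∃ x ∈ Finset.univ.erase v, (∀ e ∈ ({s(v,x)} : Finset (Sym2 (Fin n))), ω e = true) ∧ 
        ∀ e ∈ ((Finset.univ.erase v).erase x).image (fun u => s(v,u)), ω e = false) := by
    apply Pr_mono
    intro ω h
    push Not at h
    by_cases hx : ∃ x, (graphOf ω).Adj v x
    · right
      obtain ⟨x, hx⟩ := hx
      refine ⟨x, by simp [hx.1.symm], by simpa using hx.2, ?_⟩
      intro e he
      rw [Finset.mem_image] at he
      obtain ⟨u, hu, rfl⟩ := he
      simp only [Finset.mem_erase, Finset.mem_univ, and_true] at hu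
      by_contra hne
      exact h x u hu.1.symm hx ⟨hu.2.symm, by simpa using hne⟩
    · left
      push Not at hx
      refine ⟨by simp, ?_⟩
      intro e he
      rw [Finset.mem_image] at he
      obtain ⟨u, hu, rfl⟩ := he
      simp only [Finset.mem_erase, Finset.mem_univ, and_true] at hu
      by_contra hne
      exact hx u ⟨hu.symm, by simpa using hne⟩
  refine hstep.trans (Pr_or.trans ?_)
  rw [add_mul]
  apply add_le_add
  · refine (Pr_box_le _ _ (by simp)).trans ?_
    rw [hinj, Finset.card_erase_of_mem (Finset.mem_univ _), Finset.card_univ, Fintype.card_fin]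
    simp only [Finset.card_empty, pow_zero]
    apply mul_le_mul_of_nonneg_left _ zero_le_one
    apply hexp
    rw [Nat.cast_sub (by omega)]; push_cast; linarith
  · refine (Pr_ex_le _ _ (p * Real.exp (-(p * (n - 2)))) ?_).trans ?_
    · intro x hx
      refine (Pr_box_le _ _ ?_).trans ?_
      · rw [Finset.disjoint_singleton_left, Finset.mem_image]
        rintro ⟨u, hu, he⟩
        have : u = x := Sym2.congr_right.mp he
        simp [this] at hu
      · rw [hinj, Finset.card_erase_of_mem hx, Finset.card_erase_of_mem (Finset.mem_univ _), Finset.card_univ, Fintype.card_fin]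
        simp only [Finset.card_singleton, pow_one]
        apply mul_le_mul_of_nonneg_left _ hp0
        apply hexp
        rw [Nat.sub_sub, Nat.cast_sub (by omega)]; push_cast; linarith
    · rw [mul_assoc]
      apply mul_le_mul_of_nonneg_right _ (by positivity)
      have : (Finset.univ.erase v).card ≤ n := by
        refine (Finset.card_le_univ _).trans ?_
        simp
      exact_mod_cast this
end

open SimpleGraph MeasureTheory Filter

section
variable {n : ℕ} {p : ℝ} [hp : Fact (p ∈ Set.Icc (0:ℝ) 1)]

lemma Pr_tuple {τ : Type} [Fintype τ] (P : τ → Prop) (W Lw : τ → Finset (Fin n)) (F : τ → Finset (Sym2 (Fin n)))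
    (f j : ℕ) (hP : ∀ q, P q → Lw q ⊆ W q ∧ (W q).card ≤ 5 ∧ (∀ e ∈ F q, ∀ x ∈ e, x ∈ W q) ∧ (F q).card = f ∧ (Lw q).card = j)
    (C : ℝ) (hlog : 1 ≤ Real.log n) (h1 : Real.log n ≤ n * p) (h2 : n * p ≤ C * Real.log n) :
    Pr n p (fun ω => ∃ q, P q ∧ (∀ e ∈ F q, ω e = true) ∧ ∀ v ∈ Lw q, Low (graphOf ω) v) ≤
      (Fintype.card τ) * (p ^ f * (Real.log n ^ 10 * Real.exp (5 + C) / n) ^ j) := by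
  classical
  have hstep := Pr_ex_le (n := n) (p := p) (Finset.univ.filter P)
    (fun q ω => (∀ e ∈ F q, ω e = true) ∧ ∀ v ∈ Lw q, Low (graphOf ω) v)
    (p ^ f * (Real.log n ^ 10 * Real.exp (5 + C) / n) ^ j) (by
      intro q hq
      obtain ⟨a1, a2, a3, a4, a5⟩ := hP q (Finset.mem_filter.mp hq).2
      rw [← a4, ← a5]
      exact Pr_lows' _ _ a1 a2 _ a3 C hlog h1 h2)
  refine le_trans (Pr_mono ?_) (hstep.trans ?_)
  · rintro ω ⟨q, hq, h⟩
    exact ⟨q, by simp [hq], h⟩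
  · have hp0 := hp.out.1
    apply mul_le_mul_of_nonneg_right _ (by positivity)
    exact_mod_cast Finset.card_le_univ _

def PathsOK (G : SimpleGraph (Fin n)) : Prop :=
    (∀ v x y, Low G v → G.Adj v x → G.Adj v y → ¬ G.Adj x y) ∧
    (∀ u v, Low G u → Low G v → u ≠ v → ¬ G.Adj u v) ∧
    (∀ u v a, Low G u → Low G v → u ≠ v → G.Adj u a → G.Adj a v → False) ∧
    (∀ u v a b, Low G u → Low G v → u ≠ v → G.Adj u a → G.Adj a b → G.Adj b v → False) ∧
    (∀ u v a b c, Low G u → Low G v → u ≠ v → G.Adj u a → G.Adj a b → G.Adj b c →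
      G.Adj c v → False)

lemma pathsOK_of (ω : Sym2 (Fin n) → Bool)
   (ht : ¬ ∃ q : Fin n × Fin n × Fin n, (q.1 ≠ q.2.1 ∧ q.1 ≠ q.2.2 ∧ q.2.1 ≠ q.2.2) ∧
      (∀ e ∈ ({s(q.1,q.2.1), s(q.1,q.2.2), s(q.2.1,q.2.2)} : Finset (Sym2 (Fin n))), ω e = true) ∧ 
      ∀ v ∈ ({q.1} : Finset (Fin n)), Low (graphOf ω) v)
   (h1 : ¬ ∃ q : Fin n × Fin n, (q.1 ≠ q.2) ∧
      (∀ e ∈ ({s(q.1,q.2)} : Finset (Sym2 (Fin n))), ω e = true) ∧ 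
      ∀ v ∈ ({q.1, q.2} : Finset (Fin n)), Low (graphOf ω) v)
   (h2 : ¬ ∃ q : Fin n × Fin n × Fin n, (q.1 ≠ q.2.1 ∧ q.1 ≠ q.2.2 ∧ q.2.1 ≠ q.2.2) ∧
      (∀ e ∈ ({s(q.1,q.2.2), s(q.2.2,q.2.1)} : Finset (Sym2 (Fin n))), ω e = true) ∧ 
      ∀ v ∈ ({q.1, q.2.1} : Finset (Fin n)), Low (graphOf ω) v)
   (h3 : ¬ ∃ q : Fin n × Fin n × Fin n × Fin n, (q.1 ≠ q.2.1 ∧ q.1 ≠ q.2.2.1 ∧ q.1 ≠ q.2.2.2 ∧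
        q.2.1 ≠ q.2.2.1 ∧ q.2.1 ≠ q.2.2.2 ∧ q.2.2.1 ≠ q.2.2.2) ∧
      (∀ e ∈ ({s(q.1,q.2.2.1), s(q.2.2.1,q.2.2.2), s(q.2.2.2,q.2.1)} : Finset (Sym2 (Fin n))), ω e = true) ∧ 
      ∀ v ∈ ({q.1, q.2.1} : Finset (Fin n)), Low (graphOf ω) v)
   (h4 : ¬ ∃ q : Fin n × Fin n × Fin n × Fin n × Fin n, (q.1 ≠ q.2.1 ∧ q.1 ≠ q.2.2.1 ∧ q.1 ≠ q.2.2.2.1 ∧ q.1 ≠ q.2.2.2.2 ∧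
        q.2.1 ≠ q.2.2.1 ∧ q.2.1 ≠ q.2.2.2.1 ∧ q.2.1 ≠ q.2.2.2.2 ∧ q.2.2.1 ≠ q.2.2.2.1 ∧ q.2.2.1 ≠ q.2.2.2.2 ∧ q.2.2.2.1 ≠ q.2.2.2.2) ∧
      (∀ e ∈ ({s(q.1,q.2.2.1), s(q.2.2.1,q.2.2.2.1), s(q.2.2.2.1,q.2.2.2.2), s(q.2.2.2.2,q.2.1)} : Finset (Sym2 (Fin n))), ω e = true) ∧ 
      ∀ v ∈ ({q.1, q.2.1} : Finset (Fin n)), Low (graphOf ω) v) :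
    PathsOK (graphOf ω) := by
  have g1 : ∀ u v, Low (graphOf ω) u → Low (graphOf ω) v → u ≠ v → ¬ (graphOf ω).Adj u v := by
    intro u v lu lv huv hadj
    exact h1 ⟨(u,v), huv, by simpa using hadj.2, by simp [lu, lv]⟩
  have g2 : ∀ u v a, Low (graphOf ω) u → Low (graphOf ω) v → u ≠ v → (graphOf ω).Adj u a → (graphOf ω).Adj a v → False := by
    intro u v a lu lv huv hua hav
    exact h2 ⟨(u,v,a), ⟨huv, hua.1, hav.1.symm⟩, by simp [hua.2, hav.2], by simp [lu, lv]⟩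
  have g3 : ∀ u v a b, Low (graphOf ω) u → Low (graphOf ω) v → u ≠ v → (graphOf ω).Adj u a → (graphOf ω).Adj a b → (graphOf ω).Adj b v → False := by
    intro u v a b lu lv huv hua hab hbv
    refine h3 ⟨(u,v,a,b), ⟨huv, hua.1, ?_, ?_, hbv.1.symm, hab.1⟩, by simp [hua.2, hab.2, hbv.2], by simp [lu, lv]⟩
    · rintro h; simp only at h; subst h; exact g1 _ _ lu lv huv hbv
    · rintro h; simp only at h; subst h; exact g1 _ _ lu lv huv hua
  refine ⟨?_, g1, g2, g3, ?_⟩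
  · intro v x y lv hvx hvy hxy
    exact ht ⟨(v,x,y), ⟨hvx.1, hvy.1, hxy.1⟩, by simp [hvx.2, hvy.2, hxy.2], by simp [lv]⟩
  · intro u v a b c lu lv huv hua hab hbc hcv
    refine h4 ⟨(u,v,a,b,c), ⟨huv, hua.1, ?_, ?_, ?_, ?_, hcv.1.symm, hab.1, ?_, hbc.1⟩, by simp [hua.2, hab.2, hbc.2, hcv.2], by simp [lu, lv]⟩
    · rintro h; simp only at h; subst h; exact g2 _ _ c lu lv huv hbc hcv
    · rintro h; simp only at h; subst h; exact g1 _ _ lu lv huv hcv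
    · rintro h; simp only at h; subst h; exact g1 _ _ lu lv huv hua
    · rintro h; simp only at h; subst h; exact g2 _ _ _ lu lv huv hua hab
    · rintro h; simp only at h; subst h; exact g2 _ _ _ lu lv huv hua hcv

lemma num_bound (C : ℝ) (hC : 1 ≤ C) (hlog : 1 ≤ Real.log n) (h2 : n * p ≤ C * Real.log n) (f : ℕ) (hf : f ≤ 4) :
    (n:ℝ)^(f+1) * (p ^ f * (Real.log n ^ 10 * Real.exp (5 + C) / n) ^ 2) ≤ C^4 * Real.log n ^ 24 * Real.exp (5+C)^2 / n := by
  have hp0 := hp.out.1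
  have hn0 : (0:ℝ) < n := by
    rcases Nat.eq_zero_or_pos n with h | h
    · rw [h] at hlog; norm_num at hlog
    · exact_mod_cast h
  set l := Real.log n
  have e1 : (n:ℝ)^(f+1) * (p ^ f * (l ^ 10 * Real.exp (5 + C) / n) ^ 2) = (n*p)^f * l^20 * Real.exp (5+C)^2 / n := by
    rw [mul_pow, pow_succ]; field_simp
  rw [e1]
  have e2 : (n*p)^f ≤ C^4 * l^4 := by
    rw [← mul_pow]
    refine (pow_le_pow_left₀ (by positivity) h2 f).trans ?_
    exact pow_le_pow_right₀ (by nlinarith) hf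
  have e3 : C^4 * l ^ 24 * Real.exp (5+C)^2 / n = C^4 * l^4 * l^20 * Real.exp (5+C)^2 / n := by ring
  rw [e3]
  gcongr

lemma num_bound' (C : ℝ) (hC : 1 ≤ C) (hlog : 1 ≤ Real.log n) (h2 : n * p ≤ C * Real.log n) :
    (n:ℝ)^3 * (p ^ 3 * (Real.log n ^ 10 * Real.exp (5 + C) / n) ^ 1) ≤ C^4 * Real.log n ^ 24 * Real.exp (5+C)^2 / n := by
  have hp0 := hp.out.1
  have hn0 : (0:ℝ) < n := by
    rcases Nat.eq_zero_or_pos n with h | h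
    · rw [h] at hlog; norm_num at hlog
    · exact_mod_cast h
  set l := Real.log n
  have e1 : (n:ℝ)^3 * (p ^ 3 * (l ^ 10 * Real.exp (5 + C) / n) ^ 1) = (n*p)^3 * l^10 * Real.exp (5+C) / n := by
    rw [mul_pow]; field_simp
  rw [e1]
  have e2 : (n*p)^3 ≤ C^4 * l^4 := by
    rw [← mul_pow]
    refine (pow_le_pow_left₀ (by positivity) h2 3).trans ?_
    exact pow_le_pow_right₀ (by nlinarith) (by norm_num)
  have e3 : C^4 * l ^ 24 * Real.exp (5+C)^2 / n = C^4 * l^4 * l^20 * Real.exp (5+C)^2 / n := by ring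
  have e4 : l^10 ≤ l^20 := pow_le_pow_right₀ hlog (by norm_num)
  have e5 : Real.exp (5+C) ≤ Real.exp (5+C)^2 := by
    have : 1 ≤ Real.exp (5+C) := Real.one_le_exp (by linarith)
    nlinarith
  rw [e3]
  gcongr

lemma Pr_paths (C : ℝ) (hC : 1 ≤ C) (hlog : 1 ≤ Real.log n) (h1 : Real.log n ≤ n * p) (h2 : n * p ≤ C * Real.log n) :
    Pr n p (fun ω => ¬ PathsOK (graphOf ω)) ≤ 5 * (C^4 * Real.log n ^ 24 * Real.exp (5+C)^2 / n) := by
  have t := Pr_tuple (n := n) (p := p) (τ := Fin n × Fin n × Fin n) (fun q => q.1 ≠ q.2.1 ∧ q.1 ≠ q.2.2 ∧ q.2.1 ≠ q.2.2)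
    (fun q => {q.1, q.2.1, q.2.2}) (fun q => {q.1}) (fun q => {s(q.1,q.2.1), s(q.1,q.2.2), s(q.2.1,q.2.2)}) 3 1 (by
      rintro ⟨u, x, y⟩ ⟨n1, n2, n3⟩
      simp only at n1 n2 n3
      refine ⟨by simp, (Finset.card_le_three).trans (by norm_num), by simp, ?_, by simp⟩
      rw [Finset.card_eq_three]
      exact ⟨_, _, _, by grind, by grind, by grind, rfl⟩) C hlog h1 h2
  have t1 := Pr_tuple (n := n) (p := p) (τ := Fin n × Fin n) (fun q => q.1 ≠ q.2)
    (fun q => {q.1, q.2}) (fun q => {q.1, q.2}) (fun q => {s(q.1,q.2)}) 1 2 (by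
      rintro ⟨u, v⟩ n1
      simp only at n1
      refine ⟨by simp, (Finset.card_le_two).trans (by norm_num), by simp, by simp, Finset.card_pair n1⟩) C hlog h1 h2
  have t2 := Pr_tuple (n := n) (p := p) (τ := Fin n × Fin n × Fin n) (fun q => q.1 ≠ q.2.1 ∧ q.1 ≠ q.2.2 ∧ q.2.1 ≠ q.2.2)
    (fun q => {q.1, q.2.1, q.2.2}) (fun q => {q.1, q.2.1}) (fun q => {s(q.1,q.2.2), s(q.2.2,q.2.1)}) 2 2 (by
      rintro ⟨u, v, a⟩ ⟨n1, n2, n3⟩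
      simp only at n1 n2 n3
      refine ⟨by grind, (Finset.card_le_three).trans (by norm_num), by simp, ?_, Finset.card_pair n1⟩
      apply Finset.card_pair; grind) C hlog h1 h2
  have t3 := Pr_tuple (n := n) (p := p) (τ := Fin n × Fin n × Fin n × Fin n) (fun q => q.1 ≠ q.2.1 ∧ q.1 ≠ q.2.2.1 ∧ q.1 ≠ q.2.2.2 ∧
        q.2.1 ≠ q.2.2.1 ∧ q.2.1 ≠ q.2.2.2 ∧ q.2.2.1 ≠ q.2.2.2)
    (fun q => {q.1, q.2.1, q.2.2.1, q.2.2.2}) (fun q => {q.1, q.2.1}) (fun q => {s(q.1,q.2.2.1), s(q.2.2.1,q.2.2.2), s(q.2.2.2,q.2.1)}) 3 2 (by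
      rintro ⟨u, v, a, b⟩ ⟨n1, n2, n3, n4, n5, n6⟩
      simp only at n1 n2 n3 n4 n5 n6
      refine ⟨by grind, (Finset.card_le_four).trans (by norm_num), by simp, ?_, Finset.card_pair n1⟩
      rw [Finset.card_eq_three]
      exact ⟨_, _, _, by grind, by grind, by grind, rfl⟩) C hlog h1 h2
  have t4 := Pr_tuple (n := n) (p := p) (τ := Fin n × Fin n × Fin n × Fin n × Fin n) (fun q => q.1 ≠ q.2.1 ∧ q.1 ≠ q.2.2.1 ∧ q.1 ≠ q.2.2.2.1 ∧ q.1 ≠ q.2.2.2.2 ∧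
        q.2.1 ≠ q.2.2.1 ∧ q.2.1 ≠ q.2.2.2.1 ∧ q.2.1 ≠ q.2.2.2.2 ∧ q.2.2.1 ≠ q.2.2.2.1 ∧ q.2.2.1 ≠ q.2.2.2.2 ∧ q.2.2.2.1 ≠ q.2.2.2.2)
    (fun q => {q.1, q.2.1, q.2.2.1, q.2.2.2.1, q.2.2.2.2}) (fun q => {q.1, q.2.1}) (fun q => {s(q.1,q.2.2.1), s(q.2.2.1,q.2.2.2.1), s(q.2.2.2.1,q.2.2.2.2), s(q.2.2.2.2,q.2.1)}) 4 2 (by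
      rintro ⟨u, v, a, b, c⟩ ⟨n1, n2, n3, n4, n5, n6, n7, n8, n9, n10⟩
      simp only at n1 n2 n3 n4 n5 n6 n7 n8 n9 n10
      refine ⟨by grind, Finset.card_le_five, by simp, ?_, Finset.card_pair n1⟩
      rw [Finset.card_insert_of_notMem, Finset.card_eq_three.mpr ⟨_, _, _, ?_, ?_, ?_, rfl⟩]
      all_goals grind) C hlog h1 h2
  simp only [Fintype.card_prod, Fintype.card_fin, Nat.cast_mul] at t t1 t2 t3 t4
  have b := num_bound' (n := n) (p := p) C hC hlog h2
  have b1 := num_bound (n := n) (p := p) C hC hlog h2 1 (by norm_num)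
  have b2 := num_bound (n := n) (p := p) C hC hlog h2 2 (by norm_num)
  have b3 := num_bound (n := n) (p := p) C hC hlog h2 3 (by norm_num)
  have b4 := num_bound (n := n) (p := p) C hC hlog h2 4 (by norm_num)
  have r : (n:ℝ) * (n * n) = n^3 := by ring
  have r1 : (n:ℝ) * n = n^(1+1) := by ring
  have r2 : (n:ℝ) * (n * n) = n^(2+1) := by ring
  have r3 : (n:ℝ) * (n * (n * n)) = n^(3+1) := by ring
  have r4 : (n:ℝ) * (n * (n * (n * n))) = n^(4+1) := by ring
  rw [r] at t
  rw [r1] at t1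
  rw [r2] at t2
  rw [r3] at t3
  rw [r4] at t4
  have hstep : Pr n p (fun ω => ¬ PathsOK (graphOf ω)) ≤ _ := 
    (Pr_mono (fun ω h => by
      by_contra hcon
      rw [not_or, not_or, not_or, not_or] at hcon
      exact h (pathsOK_of ω hcon.1 hcon.2.1 hcon.2.2.1 hcon.2.2.2.1 hcon.2.2.2.2))).trans
    (Pr_or.trans (add_le_add t (Pr_or.trans (add_le_add t1 (Pr_or.trans (add_le_add t2 (Pr_or.trans (add_le_add t3 t4))))))))
  linarith
end

open SimpleGraph MeasureTheory Filter

lemma lim_small (k : ℕ) (c K ε : ℝ) (hc : 0 < c) (hε : 0 < ε) :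
    ∃ M : ℝ, ∀ L, M ≤ L → K * (L ^ k * Real.exp (-(c * L))) ≤ ε := by
  have h1 := (Real.tendsto_pow_mul_exp_neg_atTop_nhds_zero k).comp
    (Tendsto.const_mul_atTop hc tendsto_id)
  have h2 := h1.const_mul (K * (1 / c ^ k))
  rw [mul_zero] at h2
  obtain ⟨M0, hM0⟩ := eventually_atTop.mp (h2.eventually (ge_mem_nhds hε))
  refine ⟨M0, fun L hL => ?_⟩
  have := hM0 L hL
  simp only [Function.comp, id] at this
  refine le_trans (le_of_eq ?_) this
  rw [mul_pow]
  field_simp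

section
variable {n : ℕ} {p : ℝ} [hp : Fact (p ∈ Set.Icc (0:ℝ) 1)]

lemma deg_small (C M : ℝ) (hC : 1 ≤ C) (hlog : 1 ≤ Real.log n)
    (h1 : Real.log n + Real.log (Real.log n) + M ≤ n * p) (h2 : n * p ≤ C * Real.log n) :
    Pr n p (fun ω => ∃ v ∈ (Finset.univ : Finset (Fin n)), ¬ ∃ x y, x ≠ y ∧ (graphOf ω).Adj v x ∧ (graphOf ω).Adj v y)
      ≤ (1 + C) * Real.exp (2 - M) := by
  have hn0 : 0 < n := by
    rcases Nat.eq_zero_or_pos n with h | h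
    · rw [h] at hlog; norm_num at hlog
    · exact h
  have hn2 : 2 ≤ n := by
    by_contra h
    have : n = 1 := by omega
    rw [this] at hlog; norm_num at hlog
  have hn0' : (0:ℝ) < n := by exact_mod_cast hn0
  have h5 := Pr_ex_le (n := n) (p := p) Finset.univ (fun v ω => ¬ ∃ x y, x ≠ y ∧ (graphOf ω).Adj v x ∧ (graphOf ω).Adj v y)
    _ (fun v _ => Pr_deg1 v hn2)
  refine h5.trans ?_
  rw [Finset.card_univ, Fintype.card_fin]
  have e1 : (n:ℝ) = Real.exp (Real.log n) := (Real.exp_log hn0').symm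
  have e2 : Real.log n = Real.exp (Real.log (Real.log n)) := (Real.exp_log (by linarith)).symm
  have e3 : Real.exp (-(p * (n - 2))) ≤ Real.exp (2 - (Real.log n + Real.log (Real.log n) + M)) := by
    apply Real.exp_le_exp.mpr
    have := hp.out.2
    linarith
  have e4 : 1 + n * p ≤ (1 + C) * Real.log n := by linarith
  calc (n:ℝ) * ((1 + n * p) * Real.exp (-(p * (n - 2)))) 
      ≤ n * (((1 + C) * Real.log n) * Real.exp (2 - (Real.log n + Real.log (Real.log n) + M))) := by
        gcongr
    _ = (1 + C) * (n * Real.log n * Real.exp (2 - (Real.log n + Real.log (Real.log n) + M))) := by ring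
    _ = (1 + C) * (Real.exp (Real.log n) * Real.exp (Real.log (Real.log n)) * Real.exp (2 - (Real.log n + Real.log (Real.log n) + M))) := by
        rw [← e2, ← e1]
    _ = _ := by
        rw [← Real.exp_add, ← Real.exp_add]
        congr 2; ring

open Classical in
noncomputable def bad0 (n : ℕ) (p : ℝ) (ω : Sym2 (Fin n) → Bool) : Finset (Fin n) :=
  Finset.univ.filter (fun v => ((goodSet (hh p) v ω).card : ℝ) < kc1 * (n * p))

lemma bad_small (hp0 : 0 < p) (hpq : p ≤ 1 - 1/4000) (hnp : 16 ≤ n * p) (hn : 0 < n) (hL : Real.log n ≤ n * p) :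
    Pr n p (fun ω => n * Real.exp (-(kc1/2 * Real.log n)) < ((bad0 n p ω).card : ℝ)) ≤ Real.exp (-(kc1/2 * Real.log n)) := by
  classical
  have hn0' : (0:ℝ) < n := by exact_mod_cast hn
  have hk := kc1_pos
  set b : ℝ := n * Real.exp (-(kc1/2 * Real.log n)) with hb
  have hb0 : 0 < b := by positivity
  have h1 : Pr n p (fun ω => b < ((bad0 n p ω).card : ℝ)) ≤ EX n p (fun ω => (1/b) * ((bad0 n p ω).card : ℝ)) := by
    apply Pr_le_EX
    · intro ω; positivity
    · intro ω h
      rw [one_div, inv_mul_eq_div, one_le_div hb0]; exact h.le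
  have h2 : EX n p (fun ω => ((bad0 n p ω).card : ℝ)) ≤ n * Real.exp (-(kc1 * Real.log n)) := by
    have : (fun ω => ((bad0 n p ω).card : ℝ)) = fun ω => ∑ v : Fin n, if ((goodSet (hh p) v ω).card : ℝ) < kc1 * (n * p) then (1:ℝ) else 0 := by
      funext ω
      unfold bad0
      rw [Finset.card_filter]; push_cast
      rfl
    rw [this, EX_sum]
    calc _ ≤ ∑ v : Fin n, Real.exp (-(kc1 * Real.log n)) := by
          apply Finset.sum_le_sum
          intro v _
          rw [← Pr_eq_EX]
          refine (good_tail' hp0 hpq hnp v).trans ?_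
          apply Real.exp_le_exp.mpr
          have := mul_le_mul_of_nonneg_left hL hk.le
          linarith
      _ = _ := by simp
  rw [EX_mul_left] at h1
  refine h1.trans ?_
  rw [one_div, inv_mul_eq_div, div_le_iff₀ hb0]
  refine h2.trans (le_of_eq ?_)
  rw [hb, mul_left_comm, ← Real.exp_add]
  congr 2; ring

lemma sparse_small (C ρ : ℝ) (hρ : 0 < ρ) (hρ1 : ρ ≤ 1/2) (hC : 1 ≤ C) (hlog : 1 ≤ Real.log n) (a : ℝ)
    (h2 : n * p ≤ C * Real.log n)
    (hy : 96 * C * Real.log n * Real.exp (-(a * Real.log n)) ≤ 1)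
    (hy' : (9 * C * Real.log n)^4 * (96 * C * Real.log n * Real.exp (-(a * Real.log n))) ≤ ρ^4) :
    Pr n p (fun ω => ∃ W : Finset (Fin n), W.Nonempty ∧ (W.card:ℝ) ≤ 40 * (n * Real.exp (-(a * Real.log n))) ∧
      ∃ F, EdgesIn (graphOf ω) W F ∧ 5 * W.card ≤ 4 * F.card) ≤ 2 * ρ := by
  have he := exp1_lt
  have hp0 := hp.out.1
  set L := Real.log n with hL
  set y := 96 * C * L * Real.exp (-(a * L)) with hyd
  have hy0 : 0 < y := by positivity
  have key := Pr_EV (n := n) (p := p) (5/4) (by norm_num) ⌊40 * (n * Real.exp (-(a * L)))⌋₊ ρ hρ.le hρ1 ?_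
  · refine le_trans (Pr_mono ?_) key
    rintro ω ⟨W, hW, hWc, F, hF, hc⟩
    refine ⟨W, hW, Nat.le_floor hWc, F, hF, ?_⟩
    have : (5 * W.card : ℝ) ≤ 4 * F.card := by exact_mod_cast hc
    linarith
  · intro t ht htT
    have htT' : (t:ℝ) ≤ 40 * (n * Real.exp (-(a * L))) := (Nat.le_floor_iff (by positivity)).mp htT
    have ht0 : (0:ℝ) < t := by exact_mod_cast ht
    set x := Real.exp 1 * t * p / (5/4) with hx
    have hx0 : 0 ≤ x := by positivity
    have hxy : x ≤ y := by
      have : Real.exp 1 * t * p ≤ 3 * (40 * (n * Real.exp (-(a * L)))) * p := by gcongr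
      have h3 : n * p * Real.exp (-(a * L)) ≤ C * L * Real.exp (-(a * L)) := by gcongr
      rw [hx, div_le_iff₀ (by norm_num)]
      calc _ ≤ _ := this
        _ = 120 * (n * p * Real.exp (-(a * L))) := by ring
        _ ≤ 120 * (C * L * Real.exp (-(a * L))) := by gcongr
        _ = _ := by rw [hyd]; ring
    refine ⟨hxy.trans hy, ?_⟩
    have e1 : x ^ (5/4 : ℝ) = x * x ^ (1/4 : ℝ) := by
      rw [show (5/4 : ℝ) = 1 + 1/4 by norm_num, Real.rpow_add' hx0 (by norm_num), Real.rpow_one]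
    have e2 : x ^ (1/4 : ℝ) ≤ ρ / (9 * C * L) := by
      have h4 : x ≤ (ρ / (9 * C * L))^4 := by
        rw [div_pow, le_div_iff₀ (by positivity)]
        have : x * (9 * C * L)^4 ≤ y * (9 * C * L)^4 := by gcongr
        linarith
      have h5 := Real.rpow_le_rpow hx0 h4 (show (0:ℝ) ≤ 1/4 by norm_num)
      refine h5.trans (le_of_eq ?_)
      rw [← Real.rpow_natCast, ← Real.rpow_mul (by positivity)]
      norm_num
    have e3 : Real.exp 1 * n / t * x ≤ 9 * C * L := by
      have : Real.exp 1 * n / t * x = Real.exp 1 * Real.exp 1 * (n * p) * (4/5) := by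
        rw [hx]; field_simp
      rw [this]
      have h6 : Real.exp 1 * Real.exp 1 * (n * p) * (4/5) ≤ 3 * 3 * (C * L) * (4/5) := by gcongr
      have : 0 < C * L := by positivity
      linarith
    rw [e1, ← mul_assoc]
    calc _ ≤ (9 * C * L) * (ρ / (9 * C * L)) := by gcongr
      _ = ρ := by field_simp
end

lemma threshold_regime (C ε : ℝ) (hC : 1 ≤ C) (hε : 0 < ε) : ∃ M : ℝ, ∀ (n : ℕ) (p : ℝ) [Fact (p ∈ Set.Icc (0:ℝ) 1)],
    p ≤ 1 - 1/4000 → M ≤ Real.log n → Real.log n + Real.log (Real.log n) + M ≤ n * p → n * p ≤ C * Real.log n →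
    Pr n p (fun ω => ¬ HasLegalSystem (graphOf ω)) ≤ ε := by
  have hk := kc1_pos
  have hk1 := kc1_lt
  set ρ := min (ε/12) (1/2) with hρ
  have hρ0 : 0 < ρ := by positivity
  have hρ1 : ρ ≤ 1/2 := min_le_right _ _
  have hρ2 : ρ ≤ ε/12 := min_le_left _ _
  obtain ⟨M2, hM2⟩ := E2_small (ε/6) (by positivity)
  obtain ⟨M3, hM3⟩ := E3_small (ε/6) (by positivity)
  obtain ⟨M4, hM4⟩ := lim_small 24 1 (5 * C^4 * Real.exp (5+C)^2) (ε/6) one_pos (by positivity)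
  obtain ⟨M5, hM5⟩ := lim_small 0 1 ((1+C) * Real.exp 2) (ε/6) one_pos (by positivity)
  obtain ⟨M6, hM6⟩ := lim_small 0 (kc1/2) 1 (min (ε/6) (1/4)) (by positivity) (by positivity)
  obtain ⟨M7, hM7⟩ := lim_small 1 (kc1/2) (96 * C) 1 (by positivity) (by positivity)
  obtain ⟨M8, hM8⟩ := lim_small 5 (kc1/2) ((9*C)^4 * (96 * C)) (ρ^4) (by positivity) (by positivity)
  refine ⟨max (max (max M2 M3) (max M4 M5)) (max (max M6 M7) (max M8 (max 16 (32/kc1)))), ?_⟩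
  intro n p hp hpq hM hM1 hC2
  simp only [max_le_iff] at hM
  obtain ⟨⟨⟨m2, m3⟩, m4, m5⟩, ⟨m6, m7⟩, m8, m16, m32⟩ := hM
  set M := max (max (max M2 M3) (max M4 M5)) (max (max M6 M7) (max M8 (max 16 (32/kc1)))) with hMdef
  have hMge5 : M5 ≤ M := by simp [hMdef]
  have hM16 : 16 ≤ M := by simp [hMdef]
  set L := Real.log n with hL
  have hLL : 0 ≤ Real.log L := Real.log_nonneg (by linarith)
  have hnp : L ≤ n * p := by linarith
  rw [div_le_iff₀ hk] at m32
  have hp0 : 0 < p := by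
    rcases eq_or_lt_of_le hp.out.1 with h | h
    · rw [← h] at hnp; norm_num at hnp; linarith
    · exact h
  have hn0 : 0 < n := by
    rcases Nat.eq_zero_or_pos n with h | h
    · rw [h] at hL; norm_num at hL; linarith
    · exact h
  have hn0' : (0:ℝ) < n := by exact_mod_cast hn0
  have hnL : (n:ℝ) = Real.exp L := (Real.exp_log hn0').symm
  have b2 := hM2 n p (by linarith)
  have b3 := hM3 n p (by linarith)
  have b4 := hM4 L m4
  have b5 := hM5 M hMge5
  have b6 := hM6 L m6
  have b7 := hM7 L m7
  have b8 := hM8 L m8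
  rw [pow_zero, one_mul, one_mul] at b6
  have b6' := b6.trans (min_le_left _ _)
  have b6'' := b6.trans (min_le_right _ _)
  set b : ℝ := n * Real.exp (-(kc1/2 * L)) with hb
  have hb1 : 1 ≤ b := by
    rw [hb, hnL, ← Real.exp_add]
    apply Real.one_le_exp
    nlinarith
  have c4 : Pr n p (fun ω => ¬ PathsOK (graphOf ω)) ≤ ε/6 := by
    refine (Pr_paths C hC (by linarith) hnp hC2).trans (le_trans (le_of_eq ?_) b4)
    rw [← hL, one_mul, Real.exp_neg, ← hnL]; ring
  have c5 := deg_small (n := n) (p := p) C M hC (by linarith) hM1 hC2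
  have c5' : (1 + C) * Real.exp (2 - M) ≤ ε/6 := by
    refine le_trans (le_of_eq ?_) b5
    rw [sub_eq_add_neg, Real.exp_add, pow_zero]; ring_nf
  have c6 := bad_small (n := n) (p := p) hp0 hpq (by linarith) hn0 hnp
  have c7 := sparse_small (n := n) (p := p) C ρ hρ0 hρ1 hC (by linarith) (kc1/2) hC2
    (by refine le_trans (le_of_eq ?_) b7; rw [← hL]; ring) (by refine le_trans (le_of_eq ?_) b8; rw [← hL]; ring)
  rw [← hL, ← hb] at c6 c7
  refine le_trans (Pr_mono (B := fun ω => ¬ E2 n p ω ∨ (¬ E3 n ω ∨ (¬ PathsOK (graphOf ω) ∨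
     ((∃ v ∈ (Finset.univ : Finset (Fin n)), ¬ ∃ x y, x ≠ y ∧ (graphOf ω).Adj v x ∧ (graphOf ω).Adj v y) ∨
     ((b < ((bad0 n p ω).card : ℝ)) ∨ 
     (∃ W : Finset (Fin n), W.Nonempty ∧ (W.card:ℝ) ≤ 40 * b ∧
      ∃ F, EdgesIn (graphOf ω) W F ∧ 5 * W.card ≤ 4 * F.card)))))) ?_) ?_
  · intro ω hω
    by_contra hcon
    rw [not_or, not_or, not_or, not_or, not_or] at hcon
    obtain ⟨h2, h3, hP, hD, hB0, hsp⟩ := hcon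
    rw [not_not] at h2 h3 hP
    apply hω
    rw [not_lt] at hB0
    have hsp' : ∀ W : Finset (Fin n), W.Nonempty → W.card ≤ 30 * (bad0 n p ω).card + 10 → ∀ F, EdgesIn (graphOf ω) W F →
      4 * F.card < 5 * W.card := by
      intro W hW hWc F hF
      by_contra hlt
      refine hsp ⟨W, hW, ?_, F, hF, by omega⟩
      have : (W.card : ℝ) ≤ 30 * (bad0 n p ω).card + 10 := by exact_mod_cast hWc
      linarith
    obtain ⟨B, hsub, hBc, hfew⟩ := closure_exists (graphOf ω) (bad0 n p ω) hsp'
    have hdeg : ∀ v, ∃ x y, x ≠ y ∧ (graphOf ω).Adj v x ∧ (graphOf ω).Adj v y := by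
      intro v
      by_contra h
      exact hD ⟨v, Finset.mem_univ _, h⟩
    obtain ⟨q1, q2, q3, q4, q5⟩ := hP
    refine legal_common ω (by nlinarith) h2 h3 B ?_ ?_ hfew
      (privates_exist (graphOf ω) B (bad0 n p ω).card hBc hsp' hdeg q1 q2 q3 q4 q5)
    · by_contra h
      push Not at h
      have hBu : B = Finset.univ := Finset.eq_univ_iff_forall.mpr h
      rw [hBu, Finset.card_univ, Fintype.card_fin] at hBc
      have h1 : (n:ℝ) ≤ 3 * (bad0 n p ω).card := by exact_mod_cast hBc
      have h2 : b ≤ n * (1/4) := by rw [hb]; gcongr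
      linarith
    · intro v hv
      by_contra h
      apply hv
      apply hsub
      classical
      unfold bad0
      rw [Finset.mem_filter]
      exact ⟨Finset.mem_univ _, not_le.mp h⟩
  · refine (Pr_or.trans (add_le_add b2 (Pr_or.trans (add_le_add b3 (Pr_or.trans (add_le_add c4 (Pr_or.trans (add_le_add c5 (Pr_or.trans (add_le_add c6 c7)))))))))).trans ?_
    linarith

open SimpleGraph MeasureTheory Filter

section
variable {n : ℕ} {p : ℝ} [hp : Fact (p ∈ Set.Icc (0:ℝ) 1)]

def pairs (n : ℕ) : Finset (Sym2 (Fin n)) := (⊤ : SimpleGraph (Fin n)).edgeFinset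

lemma pairs_card (n : ℕ) : ((pairs n).card : ℝ) = n * (n - 1) / 2 := by
  unfold pairs
  rw [card_edgeFinset_top_eq_card_choose_two, Fintype.card_fin, Nat.cast_choose_two]

lemma nonedge_tail (hn : 2 ≤ n) :
    Pr n p (fun ω => (((pairs n).filter (fun e => ¬ (ω e = true))).card : ℝ) ≤ n^2 * (1 - p) / 16) ≤
      Real.exp (-(n^2 * (1 - p) / 16)) := by
  have hp0 := hp.out.1
  have hp1 := hp.out.2
  set K : ℝ := n^2 * (1 - p) / 16 with hK
  have h1 := EX_box (n := n) (p := p) ∅ (pairs n) (by simp) 1 (Real.exp (-1))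
  simp only [Finset.prod_empty, one_mul, Finset.card_empty, pow_zero] at h1
  have h2 : Pr n p (fun ω => (((pairs n).filter (fun e => ¬ (ω e = true))).card : ℝ) ≤ K) ≤
      EX n p (fun ω => Real.exp K * ∏ e ∈ pairs n, if ω e = true then 1 else Real.exp (-1)) := by
    apply Pr_le_EX
    · intro ω
      refine mul_nonneg (Real.exp_pos _).le (Finset.prod_nonneg fun e _ => ?_)
      split_ifs
      · exact zero_le_one
      · exact (Real.exp_pos _).le
    · intro ω h
      rw [Finset.prod_ite, Finset.prod_const_one, one_mul, Finset.prod_const, ← Real.exp_nat_mul, ← Real.exp_add]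
      apply Real.one_le_exp
      linarith
  rw [EX_mul_left, h1] at h2
  refine h2.trans ?_
  have he : Real.exp (-1) ≤ 1/2 := by
    rw [Real.exp_neg, inv_eq_one_div]
    apply one_div_le_one_div_of_le (by norm_num)
    have := Real.add_one_le_exp (1:ℝ)
    linarith
  have h3 : p * 1 + (1 - p) * Real.exp (-1) ≤ Real.exp (-((1-p)/2)) := by
    have := Real.add_one_le_exp (-((1-p)/2))
    nlinarith
  have h4 : (p * 1 + (1 - p) * Real.exp (-1))^(pairs n).card ≤ Real.exp (-((1-p)/2)) ^ (pairs n).card := by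
    have := Real.exp_pos (-1)
    have : 0 ≤ 1 - p := by linarith
    gcongr
  calc _ ≤ Real.exp K * Real.exp (-((1-p)/2)) ^ (pairs n).card := by gcongr
    _ = Real.exp (K + (pairs n).card * (-((1-p)/2))) := by rw [← Real.exp_nat_mul, ← Real.exp_add]
    _ ≤ _ := by
      apply Real.exp_le_exp.mpr
      rw [pairs_card, hK]
      have hn' : (2:ℝ) ≤ n := by exact_mod_cast hn
      have : (0:ℝ) ≤ n * (n - 2) * (1 - p) := mul_nonneg (mul_nonneg (by linarith) (by linarith)) (by linarith)
      nlinarith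

lemma codeg_tail (k : ℕ) (hk : 1 ≤ k) :
    Pr n p (fun ω => ∃ v ∈ (Finset.univ : Finset (Fin n)), ∃ A ∈ (Finset.univ : Finset (Fin n)).powersetCard k,
      ∀ a ∈ A, a ≠ v ∧ ¬ (graphOf ω).Adj v a) ≤ n * (Real.exp 1 * n / k * (1 - p)) ^ k := by
  classical
  have hp1 := hp.out.2
  have hq : 0 ≤ 1 - p := by linarith
  have hone : ∀ v : Fin n, ∀ A ∈ (Finset.univ : Finset (Fin n)).powersetCard k,
      Pr n p (fun ω => ∀ a ∈ A, a ≠ v ∧ ¬ (graphOf ω).Adj v a) ≤ (1 - p)^k := by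
    intro v A hA
    have hAc := (Finset.mem_powersetCard.mp hA).2
    have h := Pr_box_le (n := n) (p := p) ∅ (A.image (fun a => s(v,a))) (by simp)
    rw [Finset.card_image_of_injective _ (fun a b hab => by
      have h1 : a = b ∨ v = b ∧ a = v := by simpa using hab
      rcases h1 with h1 | h1
      · exact h1
      · exact h1.2.trans h1.1), hAc] at h
    simp only [Finset.card_empty, pow_zero, one_mul] at h
    refine le_trans (Pr_mono ?_) h
    intro ω hω
    refine ⟨by simp, ?_⟩
    intro e he
    obtain ⟨a, ha, rfl⟩ := Finset.mem_image.mp he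
    obtain ⟨h1, h2⟩ := hω a ha
    by_contra h3
    exact h2 ⟨h1.symm, by simpa using h3⟩
  have h2 := Pr_ex_le (n := n) (p := p) Finset.univ _ _ (fun (v : Fin n) _ =>
    Pr_ex_le (n := n) (p := p) ((Finset.univ : Finset (Fin n)).powersetCard k) _ _ (hone v))
  refine h2.trans ?_
  rw [Finset.card_powersetCard, Finset.card_univ, Fintype.card_fin, mul_pow]
  gcongr
  exact choose_le_exp n k hk
end

lemma dense_regime (ε : ℝ) (hε : 0 < ε) : ∃ M : ℝ, ∀ (n : ℕ) (p : ℝ) [Fact (p ∈ Set.Icc (0:ℝ) 1)],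
    1 - 1/4000 ≤ p → M ≤ n^2 * (1 - p) → 
    Pr n p (fun ω => ¬ HasLegalSystem (graphOf ω)) ≤ ε := by
  obtain ⟨M1, hM1⟩ := lim_small 0 (1/16) 1 (ε/2) (by norm_num) (by positivity)
  obtain ⟨M2, hM2⟩ := lim_small 2 (1/80) 1 (ε/2) (by norm_num) (by positivity)
  set M0 : ℝ := max (max M2 48) (48^3 / (ε/2)) with hM0
  refine ⟨max M1 (M0^2), ?_⟩
  intro n p hp hpq hM
  have hM48 : 48 ≤ M0 := (le_max_right _ _).trans (le_max_left _ _)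
  have he := exp1_lt
  have hq0 : 0 ≤ 1 - p := by linarith [hp.out.2]
  set s : ℝ := n * √(1-p) with hs
  have hss : s^2 = n^2 * (1 - p) := by rw [hs, mul_pow, Real.sq_sqrt hq0]
  have hs0 : 0 ≤ s := by positivity
  have hsM : M0 ≤ s := by
    have : M0^2 ≤ s^2 := by rw [hss]; exact (le_max_right _ _).trans hM
    exact le_of_sq_le_sq this hs0
  have hs48 : 48 ≤ s := hM48.trans hsM
  have hsq : √(1-p) ≤ 1/60 := by
    apply Real.sqrt_le_iff.mpr
    constructor
    · norm_num
    · norm_num; linarith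
  have hn0 : (0:ℝ) ≤ n := by positivity
  have hsn : s ≤ n / 60 := by
    calc s ≤ n * (1/60) := by rw [hs]; gcongr
      _ = _ := by ring
  have hn' : (0:ℝ) < n := by linarith
  have hn2 : 2 ≤ n := by
    have : (2:ℝ) ≤ n := by linarith
    exact_mod_cast this
  set k : ℕ := ⌊s/8⌋₊ with hk
  have hk1 : (k:ℝ) ≤ s/8 := Nat.floor_le (by positivity)
  have hk2 : s/8 < k + 1 := Nat.lt_floor_add_one _
  have hk3 : s/16 ≤ k := by linarith
  have hkk : 3 ≤ k := Nat.le_floor (by push_cast; linarith)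
  have t1 := nonedge_tail (n := n) (p := p) hn2
  have t2 := codeg_tail (n := n) (p := p) k (by omega)
  have t1' : Real.exp (-(n^2 * (1 - p) / 16)) ≤ ε/2 := by
    have := hM1 (n^2 * (1-p)) ((le_max_left _ _).trans hM)
    refine le_trans (le_of_eq ?_) this
    rw [pow_zero, one_mul, one_mul]; congr 1; ring
  set x : ℝ := 48 * (s / n) with hx
  have hx0 : 0 ≤ x := by positivity
  have hsn' : s / n ≤ 1/60 := by rw [div_le_iff₀ hn']; linarith
  have hx1 : x ≤ 4/5 := by rw [hx]; linarith
  have hbase : Real.exp 1 * n / k * (1 - p) ≤ x := by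
    have hkpos : (0:ℝ) < k := by linarith
    have e1 : 1 - p = s^2 / n^2 := by rw [hss]; field_simp
    rw [e1]
    have : Real.exp 1 * n / k * (s^2/n^2) = Real.exp 1 * (s / k) * (s / n) := by field_simp
    rw [this, hx]
    have h3 : s / k ≤ 16 := by rw [div_le_iff₀ hkpos]; linarith
    calc _ ≤ 3 * 16 * (s / n) := by gcongr
      _ = _ := by norm_num
  have t2' : n * (Real.exp 1 * n / k * (1 - p)) ^ k ≤ ε/2 := by
    have h3 : n * (Real.exp 1 * n / k * (1 - p)) ^ k ≤ n * x^k := by gcongr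
    refine h3.trans ?_
    rcases le_total (n:ℝ) (s^2) with hcase | hcase
    · have h4 : x ≤ Real.exp (-(1/5)) := by
        have := Real.add_one_le_exp (-(1/5) : ℝ)
        linarith
      have h5 : x^k ≤ Real.exp (-(1/80 * s)) := by
        calc x^k ≤ Real.exp (-(1/5)) ^ k := by gcongr
          _ = Real.exp (k * (-(1/5))) := by rw [← Real.exp_nat_mul]
          _ ≤ _ := by apply Real.exp_le_exp.mpr; linarith
      have h6 := hM2 s ((le_max_left _ _).trans ((le_max_left _ _).trans hsM))
      rw [one_mul] at h6
      refine le_trans ?_ h6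
      gcongr
    · have h5 : x^k ≤ x^3 := pow_le_pow_of_le_one hx0 (by linarith) hkk
      have h6 : 48^3 / (ε/2) ≤ s := (le_max_right _ _).trans hsM
      rw [div_le_iff₀ (by positivity)] at h6
      have h7 : n * x^3 ≤ 48^3 / s := by
        have : n * x^3 = 48^3 * (s^3 / n^2) := by rw [hx]; field_simp
        rw [this, div_eq_mul_one_div (48^3) s]
        apply mul_le_mul_of_nonneg_left _ (by norm_num)
        rw [div_le_div_iff₀ (by positivity) (by linarith)]
        have : (s^2)^2 ≤ (n:ℝ)^2 := by gcongr
        linarith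
      calc n * x^k ≤ n * x^3 := by gcongr
        _ ≤ 48^3/s := h7
        _ ≤ ε/2 := by rw [div_le_iff₀ (by linarith)]; linarith
  refine le_trans (Pr_mono (B := fun ω => ((((pairs n).filter (fun e => ¬ (ω e = true))).card : ℝ) ≤ n^2 * (1 - p) / 16) ∨
    (∃ v ∈ (Finset.univ : Finset (Fin n)), ∃ A ∈ (Finset.univ : Finset (Fin n)).powersetCard k,
      ∀ a ∈ A, a ≠ v ∧ ¬ (graphOf ω).Adj v a)) ?_) ((Pr_or.trans (add_le_add (t1.trans t1') (t2.trans t2'))).trans (by linarith))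
  intro ω hω
  by_contra hcon
  rw [not_or] at hcon
  obtain ⟨g1, g2⟩ := hcon
  rw [not_le] at g1
  apply hω
  refine legal_dense (graphOf ω) (k-1) ?_ ((pairs n).filter (fun e => ¬ (ω e = true))) ?_ ?_
  · intro v A hA
    by_contra hc
    obtain ⟨A', hA', hc'⟩ := Finset.exists_subset_card_eq (show k ≤ A.card by omega)
    exact g2 ⟨v, Finset.mem_univ _, A', Finset.mem_powersetCard.mpr ⟨Finset.subset_univ _, hc'⟩, fun a ha => hA a (hA' ha)⟩
  · intro e he
    rw [Finset.mem_filter] at he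
    obtain ⟨he1, he2⟩ := he
    unfold pairs at he1
    induction e using Sym2.ind with
    | _ u v =>
      rw [mem_edgeFinset, mem_edgeSet, top_adj] at he1
      refine ⟨by simpa using he1, ?_⟩
      rw [mem_edgeSet]
      exact fun h => he2 h.2
  · have h1 : (4 * (k-1) * (k-1+1) : ℕ) ≤ 4 * k * k := by
      rw [Nat.sub_add_cancel (by omega)]
      gcongr; omega
    have h2 : ((4 * k * k : ℕ) : ℝ) < ((pairs n).filter (fun e => ¬ (ω e = true))).card := by
      refine lt_of_le_of_lt ?_ g1
      push_cast
      rw [← hss]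
      nlinarith
    exact lt_of_le_of_lt h1 (by exact_mod_cast h2)

open SimpleGraph MeasureTheory Filter

theorem aas_gnp_has_legal_system (p : ℕ → ℝ)
    (hp01 : ∀ n : ℕ, p n ∈ Set.Icc (0 : ℝ) 1)
    (hp1 : Tendsto (fun n : ℕ => n * p n - Real.log n - Real.log (Real.log n)) atTop atTop)
    (hp2 : Tendsto (fun n : ℕ => (n : ℝ) ^ 2 * (1 - p n)) atTop atTop) :
    Tendsto (fun n : ℕ => erdosRenyi n (p n) {ω | HasLegalSystem (graphOf ω)})
      atTop (nhds 1) := by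

  have hk := kc1_pos
  have hk1 := kc1_lt
  have hC : 1 ≤ 2 / kc1 := by rw [le_div_iff₀ hk]; linarith
  have hlogn : Tendsto (fun n : ℕ => Real.log (n:ℝ)) atTop atTop :=
    Real.tendsto_log_atTop.comp tendsto_natCast_atTop_atTop
  have hbad : Tendsto (fun n : ℕ => Pr n (p n) (fun ω => ¬ HasLegalSystem (graphOf ω))) atTop (nhds 0) := by
    rw [Metric.tendsto_atTop]
    intro ε' hε'
    obtain ⟨M1, hM1⟩ := dense_regime (ε'/2) (by positivity)
    obtain ⟨M2, hM2⟩ := mid_regime (ε'/2) (by positivity)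
    obtain ⟨M3, hM3⟩ := threshold_regime (2/kc1) (ε'/2) hC (by positivity)
    have hev : ∀ᶠ n : ℕ in atTop, Pr n (p n) (fun ω => ¬ HasLegalSystem (graphOf ω)) ≤ ε'/2 := by
      filter_upwards [hp2.eventually_ge_atTop M1, hp1.eventually_ge_atTop M3, hlogn.eventually_ge_atTop M3,
        hp1.eventually_ge_atTop 0, hlogn.eventually_ge_atTop M2, hlogn.eventually_ge_atTop 1] with n a1 a2 a3 a4 a5 a6
      haveI := Fact.mk (hp01 n)
      have hLL : 0 ≤ Real.log (Real.log n) := Real.log_nonneg a6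
      rcases le_total (1 - 1/4000) (p n) with h | h
      · exact hM1 n (p n) h a1
      · rcases le_total (2/kc1 * Real.log n) (n * p n) with h' | h'
        · exact hM2 n (p n) h (by linarith) h'
        · exact hM3 n (p n) h a3 (by linarith) h'
    obtain ⟨N, hN⟩ := eventually_atTop.mp hev
    refine ⟨N, fun n hn => ?_⟩
    haveI := Fact.mk (hp01 n)
    rw [Real.dist_eq, sub_zero, abs_of_nonneg Pr_nonneg]
    linarith [hN n hn]
  have heq : ∀ n : ℕ, erdosRenyi n (p n) {ω | HasLegalSystem (graphOf ω)} =
      ENNReal.ofReal (1 - Pr n (p n) (fun ω => ¬ HasLegalSystem (graphOf ω))) := by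
    intro n
    haveI := Fact.mk (hp01 n)
    have h1 : (erdosRenyi n (p n)).real {ω | HasLegalSystem (graphOf ω)} =
        1 - Pr n (p n) (fun ω => ¬ HasLegalSystem (graphOf ω)) := by
      have h2 := probReal_compl_eq_one_sub (μ := erdosRenyi n (p n))
        (s := {ω | HasLegalSystem (graphOf ω)}) (Set.Finite.measurableSet (Set.toFinite _))
      have h3 : Pr n (p n) (fun ω => ¬ HasLegalSystem (graphOf ω)) =
        (erdosRenyi n (p n)).real {ω | HasLegalSystem (graphOf ω)}ᶜ := rfl
      rw [h3, h2]; ring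
    rw [← h1, ofReal_measureReal]
  simp_rw [heq]
  have h5 := ENNReal.tendsto_ofReal ((tendsto_const_nhds (x := (1:ℝ))).sub hbad)
  simpa using h5
end

section
/- Let n ≥ 4 and let (p_n) be a sequence in [0,1] with p_n ≤ log n / n. Let G ∼ 𝒢(n, p_n). Then asymptotically almost surely G has a vertex of degree at most 1, and consequently asymptotically almost surely G does not have a legal system. -/
open SimpleGraph

open MeasureTheory Filter

lemma iso_eq {V : Type*} (G : SimpleGraph V) (A : Set V) (h : (G.induce A).Connected)
    {x y : V} (hx : x ∈ A) (hy : y ∈ A) (hn : ∀ z ∈ A, ¬ G.Adj x z) : x = y := by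
  by_contra hne
  have hp := h.preconnected ⟨x, hx⟩ ⟨y, hy⟩
  obtain ⟨W⟩ := hp
  cases W with
  | nil => exact hne rfl
  | cons hadj _ => exact hn _ (Subtype.property _) hadj

lemma z2 (a b : ZMod 2) (h : a ≠ b) : a = b + 1 := by
  revert a b; decide

lemma legal_eq {V : Type*} (G : SimpleGraph V) (f : V → ZMod 2)
    (h : LegalState G {x | f x = 1})
    {x y : V} (hxy : f x = f y) (hn : ∀ z, f z = f x → ¬ G.Adj x z) : x = y := by
  obtain ⟨-, -, h1, h2⟩ := h
  by_cases hx : f x = 1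
  · exact iso_eq G _ h1 hx (show f y = 1 by rw [← hxy, hx]) (fun z hz => hn z (by
      have hz : f z = 1 := hz
      rw [hz, hx]))
  · refine iso_eq G _ h2 hx (show ¬ f y = 1 by rw [← hxy]; exact hx) (fun z hz => hn z ?_)
    have hz : ¬ f z = 1 := hz
    have : ∀ a b : ZMod 2, ¬ a = 1 → ¬ b = 1 → a = b := by decide
    exact this _ _ hz hx

lemma no_legal {n : ℕ} (hn : 4 ≤ n) (G : SimpleGraph (Fin n)) (w : Fin n)
    (hw : ∀ x y, G.Adj w x → G.Adj w y → x = y) : ¬ HasLegalSystem G := by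
  rintro ⟨S, M, hM, hL⟩
  set H := AddSubgroup.closure (Set.range fun v => chi (M v)) with hH
  have hL' : ∀ g ∈ H, LegalState G {x | (g + chi S) x = 1} := fun g hg => hL g hg
  have hmH : ∀ v, chi (M v) ∈ H := fun v => AddSubgroup.subset_closure ⟨v, rfl⟩
  have hmv : ∀ v, chi (M v) v = 1 := fun v => by
    simp [chi, (hM v).1]
  have hma : ∀ v x, chi (M v) x = 1 → ¬ G.Adj v x := fun v x hx => by
    apply (hM v).2
    by_contra hc
    simp [chi, hc] at hx
  have hex : ∀ u, ∃ x y : Fin n, x ≠ w ∧ y ≠ w ∧ x ≠ u ∧ y ≠ u ∧ x ≠ y := by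
    intro u
    have h1 : 1 < (Finset.univ \ {w, u} : Finset (Fin n)).card := by
      have := Finset.le_card_sdiff ({w, u} : Finset (Fin n)) Finset.univ
      have h2 : ({w, u} : Finset (Fin n)).card ≤ 2 := Finset.card_le_two
      simp only [Finset.card_univ, Fintype.card_fin] at this
      omega
    obtain ⟨x, hx, y, hy, hxy⟩ := Finset.one_lt_card.1 h1
    simp at hx hy
    exact ⟨x, y, hx.1, hy.1, hx.2, hy.2, hxy⟩
  by_cases hu : ∃ u, G.Adj w u
  · obtain ⟨u, hu⟩ := hu
    have hwu : ∀ x, G.Adj w x → x = u := fun x hx => hw _ _ hx hu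
    -- separated states
    have hP : ∀ g ∈ H, (g + chi S) u ≠ (g + chi S) w →
        ∀ x, x ≠ w → (g + chi S) x = (g + chi S) w + 1 := by
      intro g hg hs x hx
      apply z2
      intro he
      apply hx
      symm
      refine legal_eq G _ (hL' g hg) he.symm ?_
      intro z hz hadj
      rw [hwu z hadj] at hz
      exact hs hz
    have hmwu : chi (M w) u = 0 := by
      have := hma w u
      by_contra hc
      exact this (by simpa using z2 _ _ hc) hu
    have hg0 : ∃ g ∈ H, (g + chi S) u ≠ (g + chi S) w := by
      by_cases h0 : chi S u = chi S w
      · refine ⟨chi (M w), hmH w, ?_⟩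
        simp [hmwu, hmv w, h0]
      · exact ⟨0, H.zero_mem, by simpa using h0⟩
    obtain ⟨g, hg, hgs⟩ := hg0
    have hPg := hP g hg hgs
    have hconst : ∀ h ∈ H, h u = h w → ∀ x, h x = h w := by
      intro h hh he x
      by_cases hx : x = w
      · rw [hx]
      have h1 := hP (h + g) (H.add_mem hh hg) (by
        simp only [Pi.add_apply] at hgs ⊢
        rw [he, add_assoc, add_assoc]
        intro hc
        exact hgs (add_left_cancel hc)) x hx
      have h2 := hPg x hx
      simp only [Pi.add_apply] at h1 h2
      rw [add_assoc, h2] at h1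
      have : h x + (g w + chi S w + 1) = h w + (g w + chi S w + 1) := by
        rw [h1]; ring
      exact add_right_cancel this
    have hbip : ∀ v x, G.Adj v x → chi (M w) v ≠ chi (M w) x := by
      intro v x hadj he
      apply hma v x _ hadj
      by_cases hv : chi (M v) u = chi (M v) w
      · have h1 := hconst _ (hmH v) hv
        rw [h1 x, ← h1 v, hmv v]
      · have h1 := hconst (chi (M v) + chi (M w)) (H.add_mem (hmH v) (hmH w)) (by
          simp only [Pi.add_apply]
          rw [hmwu, hmv w, z2 _ _ hv]; ring)
        have h2 := h1 x
        rw [← h1 v] at h2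
        simp only [Pi.add_apply] at h2
        rw [he, hmv v] at h2
        exact add_right_cancel h2
    have hleg := hL' (g + chi (M w)) (H.add_mem hg (hmH w))
    have hval : ∀ x, x ≠ w → (g + chi (M w) + chi S) x = (g + chi S) w + 1 + chi (M w) x := by
      intro x hx
      rw [← hPg x hx]; simp only [Pi.add_apply]; ring
    have hvalw : (g + chi (M w) + chi S) w = (g + chi S) w + 1 := by
      simp only [Pi.add_apply, hmv w]; ring
    have hB : ∀ x, x ≠ w → x ≠ u → chi (M w) x = 1 := by
      intro x hxw hxu
      by_contra hc
      have hc0 : chi (M w) x = 0 := by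
        have : ∀ a : ZMod 2, a ≠ 1 → a = 0 := by decide
        exact this _ hc
      apply hxw
      refine legal_eq G _ hleg (by rw [hval x hxw, hvalw, hc0, add_zero]) ?_
      intro z hz hadj
      by_cases hzw : z = w
      · subst hzw
        exact hxu (hwu x hadj.symm)
      · rw [hval z hzw, hval x hxw] at hz
        exact hbip _ _ hadj (add_left_cancel hz).symm
    obtain ⟨x, y, hx, hy, hxu, hyu, hxy⟩ := hex u
    apply hxy
    refine legal_eq G _ hleg (by rw [hval x hx, hval y hy, hB x hx hxu, hB y hy hyu]) ?_
    intro z hz hadj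
    by_cases hzw : z = w
    · subst hzw
      exact hxu (hwu x hadj.symm)
    · rw [hval z hzw, hval x hx] at hz
      exact hbip _ _ hadj (add_left_cancel hz).symm
  · push Not at hu
    have hP : ∀ g ∈ H, ∀ x, x ≠ w → (g + chi S) x = (g + chi S) w + 1 := by
      intro g hg x hx
      apply z2
      intro he
      apply hx
      symm
      exact legal_eq G _ (hL' g hg) he.symm fun z _ => hu z
    have hconst : ∀ h ∈ H, ∀ x, h x = h w := by
      intro h hh x
      by_cases hx : x = w
      · rw [hx]
      have h1 := hP h hh x hx
      have h2 := hP 0 H.zero_mem x hx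
      simp only [Pi.add_apply, Pi.zero_apply, zero_add] at h1 h2
      rw [h2] at h1
      have : h x + (chi S w + 1) = h w + (chi S w + 1) := by
        rw [h1]; ring
      exact add_right_cancel this
    obtain ⟨x, y, hx, hy, -, -, hxy⟩ := hex w
    apply hxy
    refine legal_eq G _ (hL' 0 H.zero_mem) ?_ ?_
    · rw [hP 0 H.zero_mem x hx, hP 0 H.zero_mem y hy]
    · intro z _
      apply hma
      rw [hconst _ (hmH x) z, ← hconst _ (hmH x) x, hmv]

instance bern_fin (p : ℝ) : IsFiniteMeasure (bernoulliMeasure p) := by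
  constructor
  simp [bernoulliMeasure]

lemma bern_prob_s16 {p : ℝ} (hp : p ∈ Set.Icc (0:ℝ) 1) : IsProbabilityMeasure (bernoulliMeasure p) := by
  constructor
  have h1 : 0 ≤ 1 - p := by linarith [hp.2]
  simp only [bernoulliMeasure, Measure.add_apply, Measure.smul_apply, measure_univ, smul_eq_mul,
    mul_one]
  rw [← ENNReal.ofReal_add hp.1 h1]
  simp

lemma bern_true {p : ℝ} (hp : p ∈ Set.Icc (0:ℝ) 1) : (bernoulliMeasure p).real {true} = p := by
  simp [bernoulliMeasure, Measure.real, ENNReal.toReal_ofReal hp.1]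

lemma bern_false {p : ℝ} (hp : p ∈ Set.Icc (0:ℝ) 1) :
    (bernoulliMeasure p).real {false} = 1 - p := by
  have h1 : 0 ≤ 1 - p := by linarith [hp.2]
  simp [bernoulliMeasure, Measure.real, ENNReal.toReal_ofReal h1]

lemma er_prob_s16 (n : ℕ) {p : ℝ} (hp : p ∈ Set.Icc (0:ℝ) 1) :
    IsProbabilityMeasure (erdosRenyi n p) := by
  have := bern_prob_s16 hp
  unfold erdosRenyi
  infer_instance

/-- measure of a cylinder -/
lemma er_cyl (n : ℕ) {p : ℝ} (hp : p ∈ Set.Icc (0:ℝ) 1) (F : Finset (Sym2 (Fin n)))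
    (c : Sym2 (Fin n) → Bool) :
    (erdosRenyi n p).real {ω | ∀ i ∈ F, ω i = c i} =
      ∏ i ∈ F, (bernoulliMeasure p).real {c i} := by
  have := bern_prob_s16 hp
  classical
  have h1 : {ω : Sym2 (Fin n) → Bool | ∀ i ∈ F, ω i = c i} =
      Set.pi Set.univ (fun i => if i ∈ F then {c i} else Set.univ) := by
    ext ω
    simp only [Set.mem_setOf_eq, Set.mem_pi, Set.mem_univ, true_imp_iff]
    refine forall_congr' fun i => ?_
    by_cases hi : i ∈ F <;> simp [hi]
  rw [h1, Measure.real, erdosRenyi, Measure.pi_pi, ENNReal.toReal_prod,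
    ← Finset.prod_subset (Finset.subset_univ F)]
  · refine Finset.prod_congr rfl fun i hi => ?_
    simp [hi, Measure.real]
  · intro i _ hi
    rw [if_neg hi, measure_univ, ENNReal.toReal_one]

def AtMost {n : ℕ} (F : Finset (Sym2 (Fin n))) : Set (Sym2 (Fin n) → Bool) :=
  {ω | ∀ e ∈ F, ∀ e' ∈ F, ω e = true → ω e' = true → e = e'}

noncomputable def aval (p : ℝ) (k : ℕ) : ℝ := (1 - p) ^ k + k * (p * (1 - p) ^ (k - 1))

lemma er_atMost (n : ℕ) {p : ℝ} (hp : p ∈ Set.Icc (0:ℝ) 1) (F : Finset (Sym2 (Fin n))) :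
    (erdosRenyi n p).real (AtMost F) = aval p F.card := by
  classical
  have := er_prob_s16 n hp
  have h1 : AtMost F = {ω : Sym2 (Fin n) → Bool | ∀ i ∈ F, ω i = false} ∪
      ⋃ j ∈ F, {ω : Sym2 (Fin n) → Bool | ∀ i ∈ F, ω i = decide (i = j)} := by
    ext ω
    simp only [AtMost, Set.mem_setOf_eq, Set.mem_union, Set.mem_iUnion, exists_prop]
    constructor
    · intro h
      by_cases hj : ∃ j ∈ F, ω j = true
      · right
        obtain ⟨j, hj, hjt⟩ := hj
        refine ⟨j, hj, fun i hi => ?_⟩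
        by_cases hij : i = j
        · simp [hij, hjt]
        · simp only [hij, decide_false]
          by_contra hc
          exact hij (h i hi j hj (by simpa using hc) hjt)
      · left
        intro i hi
        by_contra hc
        exact hj ⟨i, hi, by simpa using hc⟩
    · rintro (h | ⟨j, hj, h⟩) e he e' he' h1 h2
      · rw [h e he] at h1; simp at h1
      · rw [h e he] at h1; rw [h e' he'] at h2
        simp at h1 h2
        rw [h1, h2]
  rw [h1, measureReal_union ?_ ?_ (measure_ne_top _ _) (measure_ne_top _ _)]
  · rw [measureReal_biUnion_finset]
    · rw [er_cyl n hp F (fun _ => false)]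
      simp only [bern_false hp, Finset.prod_const, aval]
      congr 1
      rw [Finset.sum_congr rfl (g := fun _ => p * (1 - p) ^ (F.card - 1))]
      · simp
      · intro j hj
        rw [er_cyl n hp F (fun i => decide (i = j)), ← Finset.mul_prod_erase F _ hj]
        simp only [decide_true, bern_true hp]
        congr 1
        rw [← Finset.card_erase_of_mem hj, ← Finset.prod_const]
        refine Finset.prod_congr rfl fun i hi => ?_
        rw [decide_eq_false (Finset.ne_of_mem_erase hi), bern_false hp]
    · intro i hi j hj hij
      rw [Function.onFun, Set.disjoint_left]
      intro ω h h'
      have h2 := h i hi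
      have h3 := h' i hi
      rw [h2] at h3
      simp [hij] at h3
    · intro i _
      exact .of_discrete
  · rw [Set.disjoint_left]
    intro ω h h'
    simp only [Set.mem_iUnion] at h'
    obtain ⟨j, hj, h'⟩ := h'
    have h2 := h j hj
    have h3 := h' j hj
    rw [h2] at h3
    simp at h3
  · exact .of_discrete

lemma er_indep (n : ℕ) {p : ℝ} (hp : p ∈ Set.Icc (0:ℝ) 1) (F F' : Finset (Sym2 (Fin n)))
    (hd : Disjoint F F') (A : Set (F → Bool)) (B : Set (F' → Bool)) :
    (erdosRenyi n p).real ({ω | (fun i : F => ω i) ∈ A} ∩ {ω | (fun i : F' => ω i) ∈ B}) =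
    (erdosRenyi n p).real {ω | (fun i : F => ω i) ∈ A} *
      (erdosRenyi n p).real {ω | (fun i : F' => ω i) ∈ B} := by
  have := bern_prob_s16 hp
  have h1 := ProbabilityTheory.iIndepFun_pi (μ := fun _ : Sym2 (Fin n) => bernoulliMeasure p)
    (X := fun _ => id) (fun _ => aemeasurable_id)
  have h2 := h1.indepFun_finset F F' hd (fun i => measurable_of_finite _)
  have h3 := h2.measure_inter_preimage_eq_mul A B .of_discrete .of_discrete
  simp only [Measure.real, ← ENNReal.toReal_mul]
  congr 1

lemma er_atMost_inter (n : ℕ) {p : ℝ} (hp : p ∈ Set.Icc (0:ℝ) 1) (F F' : Finset (Sym2 (Fin n)))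
    (hd : Disjoint F F') :
    (erdosRenyi n p).real (AtMost F ∩ AtMost F') = aval p F.card * aval p F'.card := by
  rw [← er_atMost n hp, ← er_atMost n hp]
  have := er_indep n hp F F' hd {f | ∀ e e', f e = true → f e' = true → e = e'}
    {f | ∀ e e', f e = true → f e' = true → e = e'}
  simpa [AtMost] using this

lemma er_atMost_edge (n : ℕ) {p : ℝ} (hp : p ∈ Set.Icc (0:ℝ) 1) (F : Finset (Sym2 (Fin n)))
    (i : Sym2 (Fin n)) (hd : i ∉ F) :
    (erdosRenyi n p).real (AtMost F ∩ {ω | ω i = false}) = aval p F.card * (1 - p) := by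
  rw [← er_atMost n hp]
  have := er_indep n hp F {i} (by simpa using hd)
    {f | ∀ e e', f e = true → f e' = true → e = e'}
    {f | ∀ e, f e = false}
  have h2 := er_cyl n hp {i} (fun _ => false)
  simp only [Finset.prod_singleton, bern_false hp] at h2
  rw [← h2]
  simpa [AtMost] using this

def Row {n : ℕ} (w v : Fin n) : Finset (Sym2 (Fin n)) :=
  (Finset.univ \ {w, v}).image (fun x => s(w, x))

lemma row_card {n : ℕ} (w v : Fin n) (h : w ≠ v) : (Row w v).card = n - 2 := by
  rw [Row, Finset.card_image_of_injective]
  · rw [Finset.card_sdiff_of_subset (Finset.subset_univ _), Finset.card_pair h]; simp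
  · intro x y hxy
    exact Sym2.congr_right.1 hxy

lemma row_disj {n : ℕ} (w v : Fin n) (h : w ≠ v) : Disjoint (Row w v) (Row v w) := by
  rw [Finset.disjoint_left]
  intro e h1 h2
  simp only [Row, Finset.mem_image, Finset.mem_sdiff, Finset.mem_univ, true_and,
    Finset.mem_insert, Finset.mem_singleton, not_or] at h1 h2
  obtain ⟨x, hx, rfl⟩ := h1
  obtain ⟨y, hy, he⟩ := h2
  rw [Sym2.eq_iff] at he
  rcases he with he | he
  · exact h he.1.symm
  · exact hx.2 he.1.symm

lemma deg_iff {n : ℕ} (ω : Sym2 (Fin n) → Bool) (w : Fin n) :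
    (graphOf ω).degree w ≤ 1 ↔ ∀ x y, (graphOf ω).Adj w x → (graphOf ω).Adj w y → x = y := by
  rw [SimpleGraph.degree, Finset.card_le_one]
  simp only [SimpleGraph.mem_neighborFinset]
  constructor
  · intro h x y hx hy; exact h x hx y hy
  · intro h x hx y hy; exact h x y hx hy

def E {n : ℕ} (w : Fin n) : Set (Sym2 (Fin n) → Bool) := {ω | (graphOf ω).degree w ≤ 1}

lemma E_sub {n : ℕ} (w v : Fin n) : E w ⊆ AtMost (Row w v) := by
  intro ω h
  have h := (deg_iff ω w).1 h
  intro e he e' he' h1 h2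
  simp only [Row, Finset.mem_image, Finset.mem_sdiff, Finset.mem_univ, true_and,
    Finset.mem_insert, Finset.mem_singleton, not_or] at he he'
  obtain ⟨x, hx, rfl⟩ := he
  obtain ⟨y, hy, rfl⟩ := he'
  rw [h x y ⟨Ne.symm hx.1, h1⟩ ⟨Ne.symm hy.1, h2⟩]

lemma sub_E {n : ℕ} (w v : Fin n) : AtMost (Row w v) ∩ {ω | ω s(w, v) = false} ⊆ E w := by
  rintro ω ⟨h, hv⟩
  refine (deg_iff ω w).2 ?_
  have hv : ω s(w, v) = false := hv
  have key : ∀ x, (graphOf ω).Adj w x → s(w, x) ∈ Row w v := by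
    intro x hx
    simp only [Row, Finset.mem_image, Finset.mem_sdiff, Finset.mem_univ, true_and,
      Finset.mem_insert, Finset.mem_singleton, not_or]
    refine ⟨x, ⟨Ne.symm hx.1, ?_⟩, rfl⟩
    rintro rfl
    have := hx.2
    rw [hv] at this
    simp at this
  intro x y hx hy
  have := h _ (key x hx) _ (key y hy) hx.2 hy.2
  exact Sym2.congr_right.1 this

lemma E_ge {n : ℕ} {p : ℝ} (hp : p ∈ Set.Icc (0:ℝ) 1) (hn : 2 ≤ n) (w : Fin n) :
    (1 - p) * aval p (n - 2) ≤ (erdosRenyi n p).real (E w) := by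
  have := er_prob_s16 n hp
  have : Nontrivial (Fin n) := Fin.nontrivial_iff_two_le.2 hn
  obtain ⟨v, hv⟩ := exists_ne w
  have h1 := er_atMost_edge n hp (Row w v) s(w, v) (by
    simp only [Row, Finset.mem_image, Finset.mem_sdiff, Finset.mem_univ, true_and,
      Finset.mem_insert, Finset.mem_singleton, not_or]
    rintro ⟨x, hx, he⟩
    exact hx.2 (Sym2.congr_right.1 he))
  rw [row_card w v hv.symm] at h1
  rw [mul_comm, ← h1]
  exact measureReal_mono (sub_E w v)

lemma EE_le {n : ℕ} {p : ℝ} (hp : p ∈ Set.Icc (0:ℝ) 1) (w v : Fin n) (h : w ≠ v) :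
    (erdosRenyi n p).real (E w ∩ E v) ≤ aval p (n - 2) ^ 2 := by
  have := er_prob_s16 n hp
  have h1 := er_atMost_inter n hp _ _ (row_disj w v h)
  rw [row_card w v h, row_card v w h.symm] at h1
  rw [sq, ← h1]
  exact measureReal_mono (Set.inter_subset_inter (E_sub w v) (E_sub v w))

/-- second moment method -/
lemma second_moment {Ω ι : Type*} [MeasurableSpace Ω] [Fintype ι]
    (μ : Measure Ω) [IsProbabilityMeasure μ] (A : ι → Set Ω) (hA : ∀ i, MeasurableSet (A i))
    (a : ℝ) (h2 : ∀ i j, i ≠ j → μ.real (A i ∩ A j) ≤ a ^ 2) :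
    (∑ i, μ.real (A i)) ^ 2 * μ.real {ω | ∀ i, ω ∉ A i} ≤
      (∑ i, μ.real (A i)) + (Fintype.card ι : ℝ) ^ 2 * a ^ 2 - (∑ i, μ.real (A i)) ^ 2 := by
  classical
  set m := ∑ i, μ.real (A i) with hm
  let X : Ω → ℝ := fun ω => ∑ i, (A i).indicator 1 ω
  have hint : ∀ s : Set Ω, MeasurableSet s → Integrable (s.indicator (1 : Ω → ℝ)) μ := fun s hs =>
    (integrable_const (1:ℝ)).indicator hs
  have hiv : ∀ s : Set Ω, MeasurableSet s → ∫ ω, s.indicator (1 : Ω → ℝ) ω ∂μ = μ.real s := fun s hs =>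
    integral_indicator_one hs
  have hX : Integrable X μ := integrable_finsetSum _ fun i _ => hint _ (hA i)
  have hEX : ∫ ω, X ω ∂μ = m := by
    rw [integral_finsetSum _ fun i _ => hint _ (hA i)]
    exact Finset.sum_congr rfl fun i _ => hiv _ (hA i)
  have hXX : (fun ω => X ω ^ 2) = fun ω => ∑ i, ∑ j, (A i ∩ A j).indicator (1 : Ω → ℝ) ω := by
    funext ω
    simp only [X]
    rw [sq, Finset.sum_mul_sum]
    refine Finset.sum_congr rfl fun i _ => Finset.sum_congr rfl fun j _ => ?_
    rw [Set.inter_indicator_one]; rfl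
  have hX2 : Integrable (fun ω => X ω ^ 2) μ := by
    rw [hXX]
    exact integrable_finsetSum _ fun i _ => integrable_finsetSum _ fun j _ =>
      hint _ ((hA i).inter (hA j))
  have hEX2 : ∫ ω, X ω ^ 2 ∂μ ≤ m + (Fintype.card ι : ℝ) ^ 2 * a ^ 2 := by
    rw [hXX, integral_finsetSum _ fun i _ => integrable_finsetSum _ fun j _ =>
      hint _ ((hA i).inter (hA j))]
    have : ∀ i, ∫ ω, ∑ j, (A i ∩ A j).indicator (1 : Ω → ℝ) ω ∂μ ≤
        μ.real (A i) + Fintype.card ι * a ^ 2 := by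
      intro i
      rw [integral_finsetSum _ fun j _ => hint _ ((hA i).inter (hA j))]
      calc _ ≤ ∑ j, ((if j = i then μ.real (A i) else 0) + a ^ 2) := by
            refine Finset.sum_le_sum fun j _ => ?_
            rw [hiv _ ((hA i).inter (hA j))]
            by_cases hij : j = i
            · subst hij
              simp only [Set.inter_self, if_true]
              linarith [sq_nonneg a]
            · simp only [hij, if_false, zero_add]
              exact h2 i j (Ne.symm hij)
        _ = _ := by
            rw [Finset.sum_add_distrib]
            simp
    refine (Finset.sum_le_sum fun i _ => this i).trans_eq ?_
    rw [Finset.sum_add_distrib]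
    simp [hm]
    ring
  have hZ : MeasurableSet {ω | ∀ i, ω ∉ A i} := by
    have : {ω | ∀ i, ω ∉ A i} = ⋂ i, (A i)ᶜ := by ext; simp
    rw [this]
    exact MeasurableSet.iInter fun i => (hA i).compl
  have hle : ∫ ω, m ^ 2 * ({ω | ∀ i, ω ∉ A i}).indicator (1 : Ω → ℝ) ω ∂μ ≤
      ∫ ω, (X ω ^ 2 - 2 * m * X ω + m ^ 2) ∂μ := by
    refine integral_mono ((hint _ hZ).const_mul _)
      ((hX2.sub (hX.const_mul (2 * m))).add (integrable_const _)) fun ω => ?_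
    by_cases hω : ω ∈ {ω | ∀ i, ω ∉ A i}
    · have hx : X ω = 0 := Finset.sum_eq_zero fun i _ => by
        simp [hω i]
      simp [hω, hx]
    · simp only [Set.indicator_of_notMem hω, mul_zero]
      nlinarith [sq_nonneg (X ω - m)]
  have hsub : Integrable (fun ω => X ω ^ 2 - 2 * m * X ω) μ := hX2.sub (hX.const_mul (2 * m))
  rw [integral_const_mul, hiv _ hZ, integral_add hsub (integrable_const _),
    integral_sub hX2 (hX.const_mul (2 * m)), integral_const_mul, hEX, integral_const,
    probReal_univ, one_smul] at hle
  nlinarith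

/-- analytic lower bound -/
lemma aval_ge {n : ℕ} {p : ℝ} (hn : 3 ≤ n) (hp0 : 0 ≤ p) (hp2 : p ≤ 1 / 2)
    (hp : p ≤ Real.log n / n) (hl : Real.log n ^ 2 ≤ n) :
    Real.exp (-1) * (1 + Real.log n) ≤ n * aval p (n - 2) := by
  have hn0 : (0:ℝ) < n := by positivity
  have hq : 0 ≤ 1 - p := by linarith
  obtain ⟨k, rfl⟩ : ∃ k, n = k + 3 := ⟨n - 3, by omega⟩
  set L := Real.log ((k + 3 : ℕ) : ℝ) with hL
  set N : ℝ := ((k + 3 : ℕ) : ℝ) with hN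
  have hNk : N = k + 3 := by rw [hN]; push_cast; ring
  have h1 : (1 - p) ^ (k + 1) * (1 + (k + 1) * p) ≤ aval p (k + 3 - 2) := by
    have : k + 3 - 2 = k + 1 := by omega
    rw [this, aval]
    simp only [Nat.add_sub_cancel]
    have h0 : (1 - p) ^ (k + 1) ≤ (1 - p) ^ k := pow_le_pow_of_le_one hq (by linarith) (by omega)
    push_cast
    have h3 : 0 ≤ ((k:ℝ) + 1) * p := by positivity
    nlinarith
  have h2 : Real.exp (-(p + p ^ 2)) ≤ 1 - p := by
    have h3 : 1 ≤ (1 - p) * Real.exp (p + p ^ 2) := by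
      have := Real.quadratic_le_exp_of_nonneg (x := p + p ^ 2) (by positivity)
      nlinarith [mul_le_mul_of_nonneg_left this hq, pow_nonneg hp0 2, pow_nonneg hp0 3, pow_nonneg hp0 4, pow_nonneg hp0 5]
    rw [Real.exp_neg]
    rw [inv_le_iff_one_le_mul₀ (Real.exp_pos _)]
    exact h3
  set x : ℝ := (k + 1) * p with hx
  have hx0 : 0 ≤ x := by positivity
  have hNp : N * p ≤ L := by
    rw [le_div_iff₀ hn0] at hp; linarith
  have hxL : x ≤ L := by
    rw [hx]; nlinarith
  have hp2 : (k + 1) * p ^ 2 ≤ 1 := by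
    have : N * (N * p ^ 2) ≤ N * 1 := by
      have : (N * p) ^ 2 ≤ L ^ 2 := pow_le_pow_left₀ (by positivity) hNp 2
      nlinarith
    have := le_of_mul_le_mul_left this hn0
    nlinarith [sq_nonneg p]
  have h4 : Real.exp (-1) * Real.exp (-x) ≤ (1 - p) ^ (k + 1) := by
    refine le_trans ?_ (pow_le_pow_left₀ (Real.exp_pos _).le h2 (k + 1))
    rw [← Real.exp_nat_mul, ← Real.exp_add]
    apply Real.exp_le_exp.2
    push_cast
    rw [hx]; nlinarith
  have h5 : (1 + L) * Real.exp (-L) ≤ (1 + x) * Real.exp (-x) := by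
    have h6 := Real.add_one_le_exp (L - x)
    have h7 : Real.exp (-x) = Real.exp (L - x) * Real.exp (-L) := by
      rw [← Real.exp_add]; congr 1; ring
    rw [h7, ← mul_assoc]
    apply mul_le_mul_of_nonneg_right _ (Real.exp_pos _).le
    nlinarith
  have h8 : N * Real.exp (-L) = 1 := by
    rw [Real.exp_neg, hL, Real.exp_log hn0]
    exact mul_inv_cancel₀ hn0.ne'
  calc Real.exp (-1) * (1 + L) = N * (Real.exp (-1) * ((1 + L) * Real.exp (-L))) := by
        linear_combination (- Real.exp (-1) * (1 + L)) * h8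
    _ ≤ N * (Real.exp (-1) * ((1 + x) * Real.exp (-x))) := by
        gcongr
    _ = N * ((Real.exp (-1) * Real.exp (-x)) * (1 + x)) := by ring
    _ ≤ N * ((1 - p) ^ (k + 1) * (1 + x)) := by gcongr
    _ ≤ _ := by gcongr

lemma none_le {n : ℕ} {p : ℝ} (hn : 3 ≤ n) (hp0 : 0 ≤ p) (hp2 : p ≤ 1 / 2)
    (hp : p ≤ Real.log n / n) (hl : Real.log n ^ 2 ≤ n) :
    (erdosRenyi n p).real {ω | ∀ w : Fin n, ω ∉ E w} ≤
      2 / (Real.exp (-1) * (1 + Real.log n)) + 6 * (Real.log n / n) := by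
  have hp01 : p ∈ Set.Icc (0:ℝ) 1 := ⟨hp0, by linarith⟩
  have := er_prob_s16 n hp01
  have hs := second_moment (erdosRenyi n p) (fun w : Fin n => E w) (fun _ => .of_discrete)
    (aval p (n - 2)) (fun i j hij => EE_le hp01 i j hij)
  have hm : n * ((1 - p) * aval p (n - 2)) ≤ ∑ w : Fin n, (erdosRenyi n p).real (E w) := by
    have := Finset.sum_le_sum (s := Finset.univ) fun (w : Fin n) _ =>
      E_ge hp01 (by omega : 2 ≤ n) w
    simpa using this
  have ha := aval_ge hn hp0 hp2 hp hl
  simp only [Fintype.card_fin] at hs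
  set m := ∑ w : Fin n, (erdosRenyi n p).real (E w)
  set P := (erdosRenyi n p).real {ω | ∀ w : Fin n, ω ∉ E w}
  set B := Real.exp (-1) * (1 + Real.log n) with hB
  set c := n * aval p (n - 2) with hc
  have hlog : 0 ≤ Real.log n := Real.log_natCast_nonneg n
  have hB0 : 0 < B := by positivity
  have hc0 : 0 < c := by linarith
  have hm2 : (1 - p) * c ≤ m := by rw [hc]; linarith
  have hmB : B / 2 ≤ m := by nlinarith
  have hm0 : 0 < m := by linarith
  have h1 : P ≤ 1 / m + c ^ 2 / m ^ 2 - 1 := by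
    have : m ^ 2 * P ≤ m ^ 2 * (1 / m + c ^ 2 / m ^ 2 - 1) := by
      have e : m ^ 2 * (1 / m + c ^ 2 / m ^ 2 - 1) = m + c ^ 2 - m ^ 2 := by
        field_simp
      rw [e, hc, mul_pow]; exact hs
    exact le_of_mul_le_mul_left this (by positivity)
  have h2 : 1 / m ≤ 2 / B := by
    rw [div_le_div_iff₀ hm0 hB0]; linarith
  have h3 : c ^ 2 / m ^ 2 ≤ 1 + 6 * p := by
    rw [div_le_iff₀ (by positivity)]
    have h4 : ((1 - p) * c) ^ 2 ≤ m ^ 2 := pow_le_pow_left₀ (by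
      have : 0 ≤ 1 - p := by linarith
      positivity) hm2 2
    have h5 : 1 ≤ (1 + 6 * p) * (1 - p) ^ 2 := by
      nlinarith [mul_nonneg hp0 (by linarith : 0 ≤ 1/2 - p), mul_nonneg (mul_nonneg hp0 hp0) hp0]
    have h6 : 0 ≤ 1 + 6 * p := by linarith
    nlinarith [sq_nonneg c, mul_le_mul_of_nonneg_left h4 h6, mul_le_mul_of_nonneg_right h5 (sq_nonneg c)]
  linarith

theorem aas_sparse_gnp_no_legal_system (p : ℕ → ℝ)
    (hp01 : ∀ n : ℕ, p n ∈ Set.Icc (0 : ℝ) 1)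
    (hp : ∀ᶠ n : ℕ in atTop, p n ≤ Real.log n / n) :
    Tendsto (fun n : ℕ =>
        erdosRenyi n (p n) {ω | ∃ w : Fin n, (graphOf ω).degree w ≤ 1})
      atTop (nhds 1) ∧
    Tendsto (fun n : ℕ =>
        erdosRenyi n (p n) {ω | ¬ HasLegalSystem (graphOf ω)})
      atTop (nhds 1) := by
  have hlo : Tendsto (fun n : ℕ => Real.log n / n) atTop (nhds 0) := by
    have h := Real.isLittleO_log_id_atTop.tendsto_div_nhds_zero
    exact h.comp tendsto_natCast_atTop_atTop
  have hlo2 : Tendsto (fun n : ℕ => Real.log n ^ 2 / n) atTop (nhds 0) := by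
    have h := (Real.isLittleO_pow_log_id_atTop (n := 2)).tendsto_div_nhds_zero
    exact h.comp tendsto_natCast_atTop_atTop
  have hlog : Tendsto (fun n : ℕ => Real.log n) atTop atTop :=
    Real.tendsto_log_atTop.comp tendsto_natCast_atTop_atTop
  have hbd : Tendsto (fun n : ℕ => 2 / (Real.exp (-1) * (1 + Real.log n)) + 6 * (Real.log n / n))
      atTop (nhds 0) := by
    have h1 : Tendsto (fun n : ℕ => Real.exp (-1) * (1 + Real.log n)) atTop atTop :=
      (tendsto_atTop_add_const_left _ _ hlog).const_mul_atTop (Real.exp_pos _)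
    have h2 := (h1.const_div_atTop 2).add (hlo.const_mul 6)
    simpa using h2
  have hev : ∀ᶠ n : ℕ in atTop, (erdosRenyi n (p n)).real {ω | ∀ w : Fin n, ω ∉ E w} ≤
      2 / (Real.exp (-1) * (1 + Real.log n)) + 6 * (Real.log n / n) := by
    filter_upwards [hp, eventually_ge_atTop 3, hlo.eventually_le_const (by norm_num : (0:ℝ) < 1/2),
      hlo2.eventually_le_const (by norm_num : (0:ℝ) < 1)] with n h1 h2 h3 h4
    refine none_le h2 (hp01 n).1 (h1.trans h3) h1 ?_
    have hn0 : (0:ℝ) < n := by positivity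
    rw [div_le_iff₀ hn0] at h4
    linarith
  have hnone : Tendsto (fun n : ℕ => (erdosRenyi n (p n)).real {ω | ∀ w : Fin n, ω ∉ E w})
      atTop (nhds 0) :=
    squeeze_zero' (Eventually.of_forall fun n => measureReal_nonneg) hev hbd
  have hfirst : Tendsto (fun n : ℕ =>
        erdosRenyi n (p n) {ω | ∃ w : Fin n, (graphOf ω).degree w ≤ 1})
      atTop (nhds 1) := by
    have h1 : Tendsto (fun n : ℕ => ENNReal.ofReal
        (1 - (erdosRenyi n (p n)).real {ω | ∀ w : Fin n, ω ∉ E w})) atTop (nhds 1) := by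
      have := ENNReal.tendsto_ofReal (hnone.const_sub 1)
      simpa using this
    refine h1.congr fun n => ?_
    have := er_prob_s16 n (hp01 n)
    have h2 : {ω : Sym2 (Fin n) → Bool | ∃ w : Fin n, (graphOf ω).degree w ≤ 1} =
        {ω | ∀ w : Fin n, ω ∉ E w}ᶜ := by
      ext ω
      simp only [E, Set.mem_setOf_eq, Set.mem_compl_iff, not_forall, not_not]
    rw [h2, ← probReal_compl_eq_one_sub .of_discrete, ofReal_measureReal]
  refine ⟨hfirst, ?_⟩
  refine tendsto_of_tendsto_of_tendsto_of_le_of_le' hfirst tendsto_const_nhds ?_ ?_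
  · filter_upwards [eventually_ge_atTop 4] with n hn
    refine measure_mono ?_
    rintro ω ⟨w, hw⟩
    exact no_legal hn _ w ((deg_iff ω w).1 hw)
  · refine Eventually.of_forall fun n => ?_
    have := er_prob_s16 n (hp01 n)
    exact prob_le_one
end
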